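/- Let (a_ℓ)_{ℓ≥1} be a sequence of positive integers, let α = [0; a_1, a_2, …] be the value of the corresponding infinite continued fraction, and let (p_ℓ/q_ℓ)_{ℓ≥1} denote its convergents. If there exists a rational number w > 1 such that (a_ℓ)_{ℓ≥1} satisfies Condition (*)_w, and if the sequence (q_ℓ^{1/ℓ})_{ℓ≥1} is bounded, then α is transcendental. -/

import Mathlib

open Filter Topology

/-- Denominators of the convergents of the continued fraction `[0; a 0, a 1, ...]`,
where `a i` denotes the `(i+1)`-st partial quotient `a_{i+1}` of the paper:
`q_0 = 1`, `q_1 = a_1`, `q_{ℓ+1} = a_{ℓ+1} q_ℓ + q_{ℓ-1}`. -/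
def cfQ (a : ℕ → ℕ) : ℕ → ℕ
  | 0 => 1
  | 1 => a 0
  | n + 2 => a (n + 1) * cfQ a (n + 1) + cfQ a n

/-- Numerators of the convergents of the continued fraction `[0; a 0, a 1, ...]`:
`p_0 = 0`, `p_1 = 1`, `p_{ℓ+1} = a_{ℓ+1} p_ℓ + p_{ℓ-1}`. -/
def cfP (a : ℕ → ℕ) : ℕ → ℕ
  | 0 => 0
  | 1 => 1
  | n + 2 => a (n + 1) * cfP a (n + 1) + cfP a n

/-- An infinite word is eventually periodic. -/
def EventuallyPeriodic {A : Type*} (x : ℕ → A) : Prop :=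
  ∃ k p : ℕ, 0 < p ∧ ∀ n, k ≤ n → x (n + p) = x n

/-- The infinite word `x` begins with `V^w`: its prefix of length `⌈w·|V|⌉`
coincides with the prefix of the same length of the periodic word `VVV⋯`. -/
def BeginsWithPow {A : Type*} (x : ℕ → A) (V : List A) (w : ℝ) : Prop :=
  ∀ i < ⌈w * V.length⌉₊, V[i % V.length]? = some (x i)

/-- Condition `(*)_w`: `x` is not eventually periodic and there is a sequence of
nonempty finite words `V n` with strictly increasing lengths such that `x` begins
with `(V n)^w` for every `n`. -/
def ConditionStar {A : Type*} (x : ℕ → A) (w : ℝ) : Prop :=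
  ¬ EventuallyPeriodic x ∧
    ∃ V : ℕ → List A, (∀ n, V n ≠ []) ∧
      (StrictMono fun n => (V n).length) ∧
      ∀ n, BeginsWithPow x (V n) w

section
namespace ABT
open MvPolynomial
set_option linter.unusedSectionVars false
set_option linter.unusedSimpArgs false

/-- product of binomial coefficients -/
def mch {σ : Type*} [Fintype σ] (e I : σ →₀ ℕ) : ℕ := ∏ i, (e i).choose (I i)

/-- Hasse derivative -/
noncomputable def hasse {σ R : Type*} [Fintype σ] [CommRing R] (I : σ →₀ ℕ) :
    MvPolynomial σ R →ₗ[R] MvPolynomial σ R :=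
  (basisMonomials σ R).constr R (fun e => monomial (e - I) ((mch e I : ℕ) : R))

section hasse
variable {σ R : Type*} [Fintype σ] [CommRing R]

theorem hasse_monomial (I e : σ →₀ ℕ) (c : R) :
    hasse I (monomial e c) = monomial (e - I) (c * (mch e I : ℕ)) := by
  have : (monomial e c : MvPolynomial σ R) = c • basisMonomials σ R e := by
    simp [smul_monomial]
  rw [this, map_smul, hasse, Module.Basis.constr_basis, smul_monomial, smul_eq_mul]

theorem mch_eq_zero {e I : σ →₀ ℕ} (h : ¬ I ≤ e) : mch e I = 0 := by
  rw [Finsupp.le_def] at h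
  push Not at h
  obtain ⟨i, hi⟩ := h
  exact Finset.prod_eq_zero (Finset.mem_univ i) (Nat.choose_eq_zero_of_lt hi)

theorem coeff_hasse (I e : σ →₀ ℕ) (P : MvPolynomial σ R) :
    coeff e (hasse I P) = coeff (e + I) P * (mch (e + I) I : ℕ) := by
  classical
  induction P using MvPolynomial.induction_on' with
  | add p q hp hq => simp [hp, hq, add_mul]
  | monomial n a =>
    rw [hasse_monomial, coeff_monomial, coeff_monomial]
    by_cases h : n = e + I
    · simp [h]
    · rw [if_neg h, zero_mul]
      by_cases hI : I ≤ n
      · rw [if_neg]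
        intro h2
        apply h
        rw [← h2, tsub_add_cancel_of_le hI]
      · rw [mch_eq_zero hI]; simp

theorem hasse_zero (P : MvPolynomial σ R) : hasse 0 P = P := by
  ext e; simp [coeff_hasse, mch]

theorem mch_succ (e I : σ →₀ ℕ) (i : σ) :
    (I i + 1) * mch (e + (I + Finsupp.single i 1)) (I + Finsupp.single i 1)
      = (e i + 1) * mch (e + Finsupp.single i 1 + I) I := by
  classical
  unfold mch
  rw [← Finset.mul_prod_erase _ _ (Finset.mem_univ i), ← Finset.mul_prod_erase _ _ (Finset.mem_univ i),
    ← mul_assoc, ← mul_assoc]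
  congr 1
  · simp only [Finsupp.add_apply, Finsupp.single_eq_same]
    have h := Nat.add_one_mul_choose_eq (e i + I i) (I i)
    have h2 := Nat.choose_mul_succ_eq (e i + I i) (I i)
    have e1 : e i + (I i + 1) = e i + I i + 1 := by ring
    have e2 : e i + 1 + I i = e i + I i + 1 := by ring
    rw [e1, e2]
    have e3 : e i + I i + 1 - I i = e i + 1 := by omega
    rw [e3] at h2
    linarith
  · apply Finset.prod_congr rfl
    intro j hj
    have : j ≠ i := (Finset.mem_erase.1 hj).1
    simp [Finsupp.single_apply, this.symm]

theorem pderiv_hasse (I : σ →₀ ℕ) (i : σ) (P : MvPolynomial σ R) :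
    pderiv i (hasse I P) = ((I i + 1 : ℕ) : R) • hasse (I + Finsupp.single i 1) P := by
  ext e
  rw [coeff_pderiv, coeff_hasse, coeff_smul, coeff_hasse, smul_eq_mul]
  have h := congrArg (Nat.cast (R := R)) (mch_succ e I i)
  rw [show e + Finsupp.single i 1 + I = e + (I + Finsupp.single i 1) by abel] at *
  push_cast at h ⊢
  linear_combination (-coeff (e + (I + Finsupp.single i 1)) P) * h

theorem hasse_map {S : Type*} [CommRing S] (f : R →+* S) (I : σ →₀ ℕ) (P : MvPolynomial σ R) :
    hasse I (MvPolynomial.map f P) = MvPolynomial.map f (hasse I P) := by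
  ext e; simp [coeff_hasse, coeff_map]

/-- translation -/
noncomputable def shift (s : σ → R) : MvPolynomial σ R →ₐ[R] MvPolynomial σ R :=
  aeval (fun i => X i + C (s i))

theorem pderiv_shift (s : σ → R) (i : σ) (P : MvPolynomial σ R) :
    pderiv i (shift s P) = shift s (pderiv i P) := by
  classical
  induction P using MvPolynomial.induction_on with
  | C a => simp [shift]
  | add p q hp hq => simp [hp, hq]
  | mul_X p j hp =>
    simp only [map_mul, Derivation.leibniz, smul_eq_mul, hp, map_add]
    by_cases h : i = j
    · subst h; simp [shift]
    · simp [shift, pderiv_X, Pi.single_apply, Ne.symm h]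

theorem degree_pos_split (I : σ →₀ ℕ) (h : I ≠ 0) : ∃ i J, I = J + Finsupp.single i 1 := by
  obtain ⟨i, hi⟩ := Finsupp.ne_iff.1 h
  refine ⟨i, I - Finsupp.single i 1, ?_⟩
  rw [tsub_add_cancel_of_le]
  rw [Finsupp.single_le_iff]
  exact Nat.one_le_iff_ne_zero.2 hi

theorem hasse_shift [CharZero R] [NoZeroDivisors R] (s : σ → R) (I : σ →₀ ℕ)
    (P : MvPolynomial σ R) : hasse I (shift s P) = shift s (hasse I P) := by
  classical
  induction h : I.degree generalizing I with
  | zero =>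
    rw [Finsupp.degree_eq_zero_iff] at h
    subst h; simp [hasse_zero]
  | succ n ih =>
    have h0 : I ≠ 0 := by rintro rfl; simp at h
    obtain ⟨i, J, rfl⟩ := degree_pos_split I h0
    have hJ : J.degree = n := by simpa using h
    have h1 := pderiv_hasse J i (shift s P)
    rw [ih J hJ, pderiv_shift, pderiv_hasse, map_smul] at h1
    have h2 : ((J i + 1 : ℕ) : R) ≠ 0 := by exact_mod_cast Nat.succ_ne_zero (J i)
    exact (smul_right_injective _ h2 h1).symm

end hasse

section wronskian
variable {σ K : Type*} [Fintype σ] [Field K] [CharZero K]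

/-- differential operators of order at most `s` -/
noncomputable def Sp (σ K : Type*) [Fintype σ] [Field K] (s : ℕ) :
    Submodule (MvPolynomial σ K) (MvPolynomial σ K →ₗ[K] MvPolynomial σ K) :=
  Submodule.span _ {T | ∃ I : σ →₀ ℕ, I.degree ≤ s ∧ T = hasse I}

theorem Sp_mono {s t : ℕ} (h : s ≤ t) : Sp σ K s ≤ Sp σ K t :=
  Submodule.span_mono (by rintro T ⟨I, hI, rfl⟩; exact ⟨I, hI.trans h, rfl⟩)

theorem Sp_pderiv {s : ℕ} (i : σ) (T : MvPolynomial σ K →ₗ[K] MvPolynomial σ K)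
    (hT : T ∈ Sp σ K s) : (pderiv i).toLinearMap ∘ₗ T ∈ Sp σ K (s + 1) := by
  induction hT using Submodule.span_induction with
  | mem T h =>
    obtain ⟨I, hI, rfl⟩ := h
    have : (pderiv i).toLinearMap ∘ₗ (hasse I : MvPolynomial σ K →ₗ[K] MvPolynomial σ K)
      = (C ((I i + 1 : ℕ) : K) : MvPolynomial σ K) • hasse (I + Finsupp.single i 1) := by
      ext1 P
      have := pderiv_hasse I i (monomial P 1 : MvPolynomial σ K)
      ext1
      simp only [LinearMap.comp_apply, LinearMap.smul_apply, smul_eq_mul]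
      rw [C_mul']
      exact this
    rw [this]
    apply Submodule.smul_mem
    apply Submodule.subset_span
    exact ⟨_, by simpa using hI, rfl⟩
  | zero => simp
  | add x y _ _ hx hy => rw [LinearMap.comp_add]; exact Submodule.add_mem _ hx hy
  | smul a x hx h =>
    have : (pderiv i).toLinearMap ∘ₗ (a • x) = a • ((pderiv i).toLinearMap ∘ₗ x) + (pderiv i a) • x := by
      ext1 P
      ext1
      simp [mul_comm]
    rw [this]
    exact Submodule.add_mem _ (Submodule.smul_mem _ _ h) (Submodule.smul_mem _ _ (Sp_mono (by simp) hx))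

theorem coeff_euler (i : σ) (e : σ →₀ ℕ) (P : MvPolynomial σ K) :
    coeff e (X i * pderiv i P) = (e i : K) * coeff e P := by
  classical
  induction P using MvPolynomial.induction_on' with
  | add p q hp hq => simp only [map_add, mul_add, coeff_add, hp, hq]
  | monomial n a =>
    rw [X_mul_pderiv_monomial, coeff_smul, coeff_monomial]
    split_ifs with h
    · rw [h]; simp
    · simp

theorem exists_sep {k : ℕ} (e : Fin k → σ →₀ ℕ) (he : Function.Injective e) (j0 : Fin k)
    (s : Finset (Fin k)) (hs : j0 ∉ s) :
    ∃ T ∈ Sp σ K s.card, ∃ γ : (σ →₀ ℕ) → K, (∀ φ d, coeff d (T φ) = γ d * coeff d φ) ∧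
      γ (e j0) ≠ 0 ∧ ∀ j ∈ s, γ (e j) = 0 := by
  classical
  induction s using Finset.induction_on with
  | empty =>
    refine ⟨hasse 0, Submodule.subset_span ⟨0, by simp, rfl⟩, fun _ => 1, ?_, by simp, by simp⟩
    intro φ d; simp [hasse_zero]
  | insert j s hj ih =>
    obtain ⟨T, hT, γ, h1, h2, h3⟩ := ih (fun h => hs (Finset.mem_insert_of_mem h))
    have hne : e j0 ≠ e j := fun h => hs (by rw [he h]; exact Finset.mem_insert_self _ _)
    obtain ⟨i, hi⟩ := Finsupp.ne_iff.1 hne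
    refine ⟨(X i : MvPolynomial σ K) • ((pderiv i).toLinearMap ∘ₗ T) - (C ((e j i : ℕ) : K) : MvPolynomial σ K) • T, ?_,
      fun d => ((d i : K) - (e j i : K)) * γ d, ?_, ?_, ?_⟩
    · rw [Finset.card_insert_of_notMem hj]
      exact Submodule.sub_mem _ (Submodule.smul_mem _ _ (Sp_pderiv i T hT))
        (Submodule.smul_mem _ _ (Sp_mono (by simp) hT))
    · intro φ d
      simp only [LinearMap.sub_apply, LinearMap.smul_apply, LinearMap.comp_apply, smul_eq_mul, coeff_sub]
      have := coeff_euler i d (T φ)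
      erw [this]
      rw [coeff_C_mul, h1]; ring
    · refine mul_ne_zero ?_ h2
      rw [sub_ne_zero]; exact_mod_cast hi
    · intro l hl
      rcases Finset.mem_insert.1 hl with rfl | hl
      · simp
      · simp [h3 l hl]

theorem annih_zero_of_inj [LinearOrder σ] {k : ℕ} (φ : Fin k → MvPolynomial σ K) (hφ : ∀ j, φ j ≠ 0)
    (hinj : Function.Injective fun j => (MonomialOrder.lex (σ := σ)).degree (φ j))
    (c : Fin k → MvPolynomial σ K)
    (hc : ∀ T ∈ Sp σ K (k - 1), ∑ j, c j * T (φ j) = 0) : c = 0 := by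
  classical
  set m := (MonomialOrder.lex (σ := σ)) with hm
  by_contra hne
  obtain ⟨j1, hj1⟩ := Function.ne_iff.1 hne
  have hj1' : c j1 ≠ 0 := hj1
  obtain ⟨j0, hj0, hmax⟩ := Finset.exists_max_image (Finset.univ.filter fun j => c j ≠ 0)
    (fun j => m.toSyn (m.degree (c j) + m.degree (φ j))) ⟨j1, by simp [hj1']⟩
  have hc0 : c j0 ≠ 0 := by simpa using hj0
  obtain ⟨T, hT, γ, h1, h2, h3⟩ := exists_sep (K := K) (fun j => m.degree (φ j)) hinj j0 (Finset.univ.erase j0)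
    (by simp)
  have hcard : (Finset.univ.erase j0).card = k - 1 := by simp
  rw [hcard] at hT
  have hT0 := congrArg (coeff (m.degree (c j0) + m.degree (φ j0))) (hc T hT)
  rw [coeff_sum, coeff_zero] at hT0
  have hdeg : ∀ j, m.toSyn (m.degree (T (φ j))) ≤ m.toSyn (m.degree (φ j)) := by
    intro j
    rw [m.degree_le_iff]
    intro b hb
    apply m.le_degree
    rw [mem_support_iff] at hb ⊢
    rw [h1] at hb
    exact right_ne_zero_of_mul hb
  rw [Finset.sum_eq_single j0] at hT0
  · rw [m.coeff_mul_of_add_of_degree_le le_rfl (hdeg j0), h1] at hT0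
    have a1 : coeff (m.degree (c j0)) (c j0) ≠ 0 := m.coeff_degree_ne_zero_iff.2 hc0
    have a2 : coeff (m.degree (φ j0)) (φ j0) ≠ 0 := m.coeff_degree_ne_zero_iff.2 (hφ j0)
    exact mul_ne_zero a1 (mul_ne_zero h2 a2) hT0
  · intro j _ hj
    by_cases hcj : c j = 0
    · simp [hcj]
    have hle := hmax j (by simp [hcj])
    rcases eq_or_lt_of_le hle with h | h
    · rw [← m.toSyn.injective h, m.coeff_mul_of_add_of_degree_le le_rfl (hdeg j), h1,
        h3 j (by simp [hj])]
      simp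
    · apply m.coeff_eq_zero_of_lt
      refine lt_of_le_of_lt m.degree_mul_le ?_
      refine lt_of_le_of_lt ?_ h
      rw [map_add, map_add]
      exact add_le_add le_rfl (hdeg j)
  · simp

theorem annih_zero [LinearOrder σ] {k : ℕ} (φ : Fin k → MvPolynomial σ K) (hφ : LinearIndependent K φ)
    (c : Fin k → MvPolynomial σ K)
    (hc : ∀ T ∈ Sp σ K (k - 1), ∑ j, c j * T (φ j) = 0) : c = 0 := by
  classical
  set m := (MonomialOrder.lex (σ := σ)) with hm
  induction hs : ∑ j, m.toSyn (m.degree (φ j)) using WellFoundedLT.induction generalizing φ c with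
  | ind x ih =>
  by_cases hinj : Function.Injective fun j => m.degree (φ j)
  · exact annih_zero_of_inj φ (fun j => hφ.ne_zero j) hinj c hc
  unfold Function.Injective at hinj
  push Not at hinj
  obtain ⟨i, j, hij, hne⟩ := hinj
  set t := m.leadingCoeff (φ i) / m.leadingCoeff (φ j) with ht
  have hlj : m.leadingCoeff (φ j) ≠ 0 := m.leadingCoeff_ne_zero_iff.2 (hφ.ne_zero j)
  set φ' := Function.update φ i (φ i - t • φ j) with hφ'
  set c' := Function.update c j (c j + C t * c i) with hc'
  have hsum : ∀ T : MvPolynomial σ K →ₗ[K] MvPolynomial σ K,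
      ∑ l, c' l * T (φ' l) = ∑ l, c l * T (φ l) := by
    intro T
    have e1 : ∀ l, c' l * T (φ' l) = c l * T (φ l) + (if l = j then C t * c i * T (φ j) else 0)
      - (if l = i then C t * c i * T (φ j) else 0) := by
      intro l
      by_cases hl : l = i
      · subst hl
        simp [hc', hφ', hne, map_sub, mul_sub]
        rw [smul_eq_C_mul]; ring
      · by_cases hl2 : l = j
        · subst hl2
          simp [hc', hφ', hl]; ring
        · simp [hc', hφ', hl, hl2]
    rw [Finset.sum_congr rfl (fun l _ => e1 l)]
    simp [Finset.sum_sub_distrib, Finset.sum_add_distrib]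
  have hφ'i : LinearIndependent K φ' := by
    rw [Fintype.linearIndependent_iff] at hφ ⊢
    intro g hg
    have e1 : ∀ l, g l • φ' l = (g l - if l = j then t * g i else 0) • φ l
        + (if l = j then (t * g i) • φ j else 0) - (if l = i then (t * g i) • φ j else 0) := by
      intro l
      by_cases hl : l = i
      · subst hl
        simp [hφ', hne, smul_sub, smul_smul, mul_comm]
      · by_cases hl2 : l = j
        · subst hl2
          simp [hφ', hl, sub_smul]
        · simp [hφ', hl, hl2]
    rw [Finset.sum_congr rfl (fun l _ => e1 l)] at hg
    simp only [Finset.sum_sub_distrib, Finset.sum_add_distrib, Finset.sum_ite_eq', Finset.mem_univ,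
      if_true, add_sub_cancel_right] at hg
    have h3 := hφ _ hg
    have h4 : g i = 0 := by simpa [hne] using h3 i
    intro l
    have := h3 l
    simpa [h4] using this
  have hdeg : m.toSyn (m.degree (φ' i)) < m.toSyn (m.degree (φ i)) := by
    have h0 : φ' i ≠ 0 := hφ'i.ne_zero i
    have hi : φ' i = φ i - t • φ j := by simp [hφ']
    rw [hi] at h0 ⊢
    have hle : m.toSyn (m.degree (φ i - t • φ j)) ≤ m.toSyn (m.degree (φ i)) := by
      refine m.degree_sub_le.trans (sup_le le_rfl ?_)
      rw [hij]
      exact m.degree_smul_le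
    refine lt_of_le_of_ne hle fun h => ?_
    have h2 := m.toSyn.injective h
    apply m.coeff_degree_ne_zero_iff.2 h0
    rw [h2, coeff_sub, coeff_smul]
    have e3 : coeff (m.degree (φ i)) (φ i) = m.leadingCoeff (φ i) := rfl
    have e4 : coeff (m.degree (φ i)) (φ j) = m.leadingCoeff (φ j) := by
      have : m.degree (φ i) = m.degree (φ j) := hij
      rw [this]; rfl
    rw [e3, e4, ht, smul_eq_mul, div_mul_cancel₀ _ hlj, sub_self]
  have hc0 := ih (∑ l, m.toSyn (m.degree (φ' l))) (by
    rw [← hs]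
    apply Finset.sum_lt_sum
    · intro l _
      by_cases hl : l = i
      · subst hl; exact hdeg.le
      · simp [hφ', hl]
    · exact ⟨i, Finset.mem_univ _, hdeg⟩) φ' hφ'i c' (fun T hT => by rw [hsum]; exact hc T hT) rfl
  have hci : c i = 0 := by
    have := congrFun hc0 i
    simpa [hc', hne] using this
  funext l
  by_cases hl : l = j
  · subst hl
    have := congrFun hc0 l
    simpa [hc', hci] using this
  · have := congrFun hc0 l
    simpa [hc', hl] using this

theorem wronskian [LinearOrder σ] {k : ℕ} (φ : Fin k → MvPolynomial σ K)
    (hφ : LinearIndependent K φ) :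
    ∃ I : Fin k → (σ →₀ ℕ), (∀ i, (I i).degree ≤ k - 1) ∧
      (Matrix.of fun i j => hasse (I i) (φ j)).det ≠ 0 := by
  classical
  let F := FractionRing (MvPolynomial σ K)
  let v : (σ →₀ ℕ) → (Fin k → F) := fun I j => algebraMap (MvPolynomial σ K) F (hasse I (φ j))
  let S : Set (Fin k → F) := v '' {I | I.degree ≤ k - 1}
  have hinj : Function.Injective (algebraMap (MvPolynomial σ K) F) := IsFractionRing.injective _ _
  have htop : Submodule.span F S = ⊤ := by
    by_contra hne
    obtain ⟨f, hf0, hf⟩ := Submodule.exists_le_ker_of_lt_top _ (lt_top_iff_ne_top.2 hne)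
    obtain ⟨b, hb⟩ := IsLocalization.exist_integer_multiples_of_finite
      (nonZeroDivisors (MvPolynomial σ K)) (fun j : Fin k => f (Pi.single j 1))
    choose c hc using hb
    have hfv : ∀ x, f x = ∑ j, x j * f (Pi.single j 1) := by
      intro x
      conv_lhs => rw [← Finset.univ_sum_single x]
      rw [map_sum]
      refine Finset.sum_congr rfl fun j _ => ?_
      have : (Pi.single j (x j) : Fin k → F) = x j • Pi.single j 1 := by
        rw [← Pi.single_smul]; simp
      rw [this, map_smul, smul_eq_mul]
    have hc0 : c = 0 := by
      apply annih_zero φ hφ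
      intro T hT
      induction hT using Submodule.span_induction with
      | mem T h =>
        obtain ⟨I, hI, rfl⟩ := h
        have h1 : f (v I) = 0 := hf (Submodule.subset_span ⟨I, hI, rfl⟩)
        rw [hfv] at h1
        apply hinj
        rw [map_zero, map_sum]
        have h2 := congrArg (fun z => algebraMap (MvPolynomial σ K) F b * z) h1
        simp only [mul_zero, Finset.mul_sum] at h2
        rw [← h2]
        refine Finset.sum_congr rfl fun j _ => ?_
        rw [map_mul, hc j, Algebra.smul_def]
        simp only [v]; ring
      | zero => simp
      | add x y _ _ hx hy => simp [mul_add, Finset.sum_add_distrib, hx, hy]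
      | smul a x _ h =>
        have := congrArg (fun z => a * z) h
        simp only [mul_zero, Finset.mul_sum] at this
        rw [← this]
        refine Finset.sum_congr rfl fun j _ => ?_
        simp only [LinearMap.smul_apply, smul_eq_mul]; ring
    apply hf0
    ext x
    have hb0 : algebraMap (MvPolynomial σ K) F b ≠ 0 := by
      rw [Ne, map_eq_zero_iff _ hinj]
      exact nonZeroDivisors.ne_zero b.2
    have h5 := hc x
    rw [hc0, Pi.zero_apply, map_zero, Algebra.smul_def] at h5
    have h6 := (mul_eq_zero.1 h5.symm).resolve_left hb0
    simpa using h6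
  have hex := Submodule.exists_fun_fin_finrank_span_eq F S
  have hk : Module.finrank F (Submodule.span F S) = k := by
    rw [htop, finrank_top]; simp
  rw [hk] at hex
  obtain ⟨f, hf1, hf2, hf3⟩ := hex
  choose I hI1 hI2 using hf1
  refine ⟨I, hI1, fun hdet => ?_⟩
  have hf3' : LinearIndependent F (Matrix.of f).row := hf3
  rw [Matrix.linearIndependent_rows_iff_isUnit, Matrix.isUnit_iff_isUnit_det, isUnit_iff_ne_zero] at hf3'
  apply hf3'
  have h7 := congrArg (algebraMap (MvPolynomial σ K) F) hdet
  rw [map_zero, RingHom.map_det] at h7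
  rw [← h7]
  congr 1
  ext i j
  simp [← hI2 i, v]

end wronskian
end ABT
end

section
namespace ABT
open MvPolynomial
set_option linter.unusedSectionVars false
set_option linter.unusedSimpArgs false

section nrm
variable {σ R : Type*} [CommRing R]

/-- the sum of the sizes of the coefficients -/
noncomputable def nrm (N : RingSeminorm R) (P : MvPolynomial σ R) : ℝ :=
  ∑ e ∈ P.support, N (coeff e P)

variable (N : RingSeminorm R)

theorem nrm_eq (P : MvPolynomial σ R) (s : Finset (σ →₀ ℕ)) (h : P.support ⊆ s) :
    nrm N P = ∑ e ∈ s, N (coeff e P) := by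
  apply Finset.sum_subset h
  intro e _ he
  rw [notMem_support_iff.1 he, map_zero]

theorem nrm_nonneg (P : MvPolynomial σ R) : 0 ≤ nrm N P :=
  Finset.sum_nonneg fun _ _ => apply_nonneg _ _

theorem nrm_zero : nrm N (0 : MvPolynomial σ R) = 0 := by simp [nrm]

theorem nrm_monomial (e : σ →₀ ℕ) (c : R) : nrm N (monomial e c) = N c := by
  classical
  rw [nrm_eq N _ {e} (support_monomial_subset)]
  simp

theorem nrm_C (c : R) : nrm N (C c : MvPolynomial σ R) = N c := nrm_monomial N 0 c

theorem nrm_X (i : σ) : nrm N (X i : MvPolynomial σ R) = N 1 := nrm_monomial N _ 1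

theorem nrm_add (P Q : MvPolynomial σ R) : nrm N (P + Q) ≤ nrm N P + nrm N Q := by
  classical
  rw [nrm_eq N (P + Q) (P.support ∪ Q.support) support_add,
    nrm_eq N P (P.support ∪ Q.support) Finset.subset_union_left,
    nrm_eq N Q (P.support ∪ Q.support) Finset.subset_union_right, ← Finset.sum_add_distrib]
  apply Finset.sum_le_sum
  intro e _
  rw [coeff_add]
  exact map_add_le_add _ _ _

theorem nrm_neg (P : MvPolynomial σ R) : nrm N (-P) = nrm N P := by
  unfold nrm
  rw [support_neg]
  apply Finset.sum_congr rfl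
  intro e _
  rw [coeff_neg, map_neg_eq_map]

theorem nrm_sum {ι : Type*} (s : Finset ι) (f : ι → MvPolynomial σ R) :
    nrm N (∑ i ∈ s, f i) ≤ ∑ i ∈ s, nrm N (f i) := by
  classical
  induction s using Finset.induction_on with
  | empty => simp [nrm_zero]
  | insert a s ha ih =>
    rw [Finset.sum_insert ha, Finset.sum_insert ha]
    exact (nrm_add N _ _).trans (by linarith)

theorem nrm_mul (P Q : MvPolynomial σ R) : nrm N (P * Q) ≤ nrm N P * nrm N Q := by
  classical
  conv_lhs => rw [P.as_sum, Q.as_sum, Finset.sum_mul_sum]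
  refine (nrm_sum N _ _).trans ?_
  rw [nrm, nrm, Finset.sum_mul_sum]
  apply Finset.sum_le_sum
  intro e _
  refine (nrm_sum N _ _).trans ?_
  apply Finset.sum_le_sum
  intro d _
  rw [monomial_mul, nrm_monomial]
  exact map_mul_le_mul _ _ _

theorem nrm_prod (hN : N 1 ≤ 1) {ι : Type*} (s : Finset ι) (f : ι → MvPolynomial σ R) :
    nrm N (∏ i ∈ s, f i) ≤ ∏ i ∈ s, nrm N (f i) := by
  classical
  induction s using Finset.induction_on with
  | empty => rw [Finset.prod_empty, Finset.prod_empty, ← C_1, nrm_C]; exact hN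
  | insert a s ha ih =>
    rw [Finset.prod_insert ha, Finset.prod_insert ha]
    exact (nrm_mul N _ _).trans (mul_le_mul_of_nonneg_left ih (nrm_nonneg _ _))

theorem nrm_pow (hN : N 1 ≤ 1) (f : MvPolynomial σ R) (n : ℕ) :
    nrm N (f ^ n) ≤ nrm N f ^ n := by
  have := nrm_prod N hN (Finset.range n) (fun _ => f)
  simpa using this

theorem coeff_le_nrm (P : MvPolynomial σ R) (e : σ →₀ ℕ) : N (coeff e P) ≤ nrm N P := by
  by_cases he : e ∈ P.support
  · exact Finset.single_le_sum (f := fun e => N (coeff e P)) (fun _ _ => apply_nonneg _ _) he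
  · rw [notMem_support_iff.1 he, map_zero]; exact nrm_nonneg _ _

theorem nrm_le_of_inj {τ : Type*} (P : MvPolynomial σ R) (Q : MvPolynomial τ R)
    (g : (τ →₀ ℕ) → (σ →₀ ℕ)) (hg : Function.Injective g) (h : ∀ e, coeff e Q = coeff (g e) P) :
    nrm N Q ≤ nrm N P := by
  classical
  unfold nrm
  calc ∑ e ∈ Q.support, N (coeff e Q) = ∑ e ∈ Q.support.image g, N (coeff e P) := by
        rw [Finset.sum_image (fun a _ b _ hab => hg hab)]
        exact Finset.sum_congr rfl fun e _ => by rw [h]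
    _ ≤ _ := by
        apply Finset.sum_le_sum_of_subset_of_nonneg
        · intro e he
          obtain ⟨d, hd, rfl⟩ := Finset.mem_image.1 he
          rw [mem_support_iff] at hd ⊢
          rwa [← h]
        · intro _ _ _; exact apply_nonneg _ _

theorem nrm_smul_le (c : R) (P : MvPolynomial σ R) : nrm N (c • P) ≤ N c * nrm N P := by
  rw [smul_eq_C_mul]
  refine (nrm_mul N _ _).trans ?_
  rw [nrm_C]

theorem nrm_det (hN : N 1 ≤ 1) {k : ℕ} (A : Matrix (Fin k) (Fin k) (MvPolynomial σ R)) (B : ℝ)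
    (hA : ∀ i j, nrm N (A i j) ≤ B) : nrm N A.det ≤ k.factorial * B ^ k := by
  rw [Matrix.det_apply]
  refine (nrm_sum N _ _).trans ?_
  have : ∀ p ∈ (Finset.univ : Finset (Equiv.Perm (Fin k))),
      nrm N (Equiv.Perm.sign p • ∏ i, A (p i) i) ≤ B ^ k := by
    intro p _
    have h1 : nrm N (∏ i, A (p i) i) ≤ B ^ k := by
      refine (nrm_prod N hN _ _).trans ?_
      refine (Finset.prod_le_prod (fun i _ => nrm_nonneg _ _) (fun i _ => hA _ _)).trans ?_
      simp
    rcases Int.units_eq_one_or (Equiv.Perm.sign p) with h | h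
    · simpa [h] using h1
    · simpa [h, nrm_neg] using h1
  refine (Finset.sum_le_sum this).trans ?_
  simp [Fintype.card_perm]

theorem map_natCast_mul_le (n : ℕ) (x : R) : N (x * n) ≤ n * N x := by
  induction n with
  | zero => simp
  | succ n ih =>
    push_cast
    rw [mul_add, mul_one, add_mul, one_mul]
    exact (map_add_le_add N _ _).trans (by linarith)

theorem nrm_hasse [Fintype σ] (I : σ →₀ ℕ) (P : MvPolynomial σ R) (r : σ → ℕ)
    (hr : ∀ i, degreeOf i P ≤ r i) : nrm N (hasse I P) ≤ 2 ^ (∑ i, r i) * nrm N P := by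
  classical
  conv_lhs => rw [P.as_sum, map_sum]
  refine (nrm_sum N _ _).trans ?_
  rw [nrm, Finset.mul_sum]
  apply Finset.sum_le_sum
  intro e he
  rw [hasse_monomial, nrm_monomial]
  refine (map_natCast_mul_le N _ _).trans ?_
  apply mul_le_mul_of_nonneg_right _ (apply_nonneg _ _)
  rw [mch, ← Finset.prod_pow_eq_pow_sum]
  push_cast
  apply Finset.prod_le_prod (fun i _ => by positivity)
  intro i _
  have h1 : (e i).choose (I i) ≤ 2 ^ (e i) := Nat.choose_le_two_pow _ _
  have h2 : e i ≤ r i := (degreeOf_le_iff.1 (hr i)) e he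
  calc ((e i).choose (I i) : ℝ) ≤ 2 ^ (e i) := by exact_mod_cast h1
    _ ≤ 2 ^ r i := pow_le_pow_right₀ (by norm_num) h2

theorem degreeOf_hasse [Fintype σ] (I : σ →₀ ℕ) (P : MvPolynomial σ R) (i : σ) :
    degreeOf i (hasse I P) ≤ degreeOf i P := by
  rw [degreeOf_le_iff]
  intro e he
  rw [mem_support_iff, coeff_hasse] at he
  have h1 : e + I ∈ P.support := mem_support_iff.2 (left_ne_zero_of_mul he)
  have := degreeOf_le_iff.1 (le_refl (degreeOf i P)) _ h1
  rw [Finsupp.add_apply] at this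
  omega

theorem degreeOf_det {k : ℕ} (A : Matrix (Fin k) (Fin k) (MvPolynomial σ R)) (i : σ) (r : ℕ)
    (hA : ∀ a b, degreeOf i (A a b) ≤ r) : degreeOf i A.det ≤ k * r := by
  classical
  rw [Matrix.det_apply]
  refine (degreeOf_sum_le _ _ _).trans ?_
  apply Finset.sup_le
  intro p _
  have h1 : degreeOf i (∏ j, A (p j) j) ≤ k * r := by
    refine (degreeOf_prod_le _ _ _).trans ?_
    refine (Finset.sum_le_sum (fun j _ => hA (p j) j)).trans ?_
    simp
  rcases Int.units_eq_one_or (Equiv.Perm.sign p) with h | h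
  · simpa [h] using h1
  · simpa [h, degreeOf_neg] using h1

end nrm

section idx
variable {σ R : Type*} [Fintype σ] [CommRing R]

/-- weight of an exponent -/
noncomputable def wt (ρ : σ → ℝ) (J : σ →₀ ℕ) : ℝ := ∑ i, (J i : ℝ) * ρ i

/-- all monomials have weight at least `θ` -/
def IdxGE (ρ : σ → ℝ) (θ : ℝ) (P : MvPolynomial σ R) : Prop :=
  ∀ J, coeff J P ≠ 0 → θ ≤ wt ρ J

theorem wt_add (ρ : σ → ℝ) (I J : σ →₀ ℕ) : wt ρ (I + J) = wt ρ I + wt ρ J := by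
  simp [wt, add_mul, Finset.sum_add_distrib]

theorem wt_nonneg {ρ : σ → ℝ} (hρ : ∀ i, 0 ≤ ρ i) (J : σ →₀ ℕ) : 0 ≤ wt ρ J :=
  Finset.sum_nonneg fun i _ => mul_nonneg (by positivity) (hρ i)

variable {ρ : σ → ℝ} {θ η : ℝ} {P Q : MvPolynomial σ R}

theorem IdxGE.add (hP : IdxGE ρ θ P) (hQ : IdxGE ρ θ Q) : IdxGE ρ θ (P + Q) := by
  intro J hJ
  rw [coeff_add] at hJ
  by_cases h : coeff J P = 0
  · exact hQ J (by simpa [h] using hJ)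
  · exact hP J h

theorem IdxGE.neg (hP : IdxGE ρ θ P) : IdxGE ρ θ (-P) := fun J hJ => hP J (by simpa using hJ)

theorem IdxGE.zero : IdxGE ρ θ (0 : MvPolynomial σ R) := fun J hJ => by simp at hJ

theorem IdxGE.sum {ι : Type*} (s : Finset ι) (f : ι → MvPolynomial σ R)
    (h : ∀ i ∈ s, IdxGE ρ θ (f i)) : IdxGE ρ θ (∑ i ∈ s, f i) := by
  classical
  induction s using Finset.induction_on with
  | empty => simpa using IdxGE.zero
  | insert a s ha ih =>
    rw [Finset.sum_insert ha]
    exact (h a (by simp)).add (ih fun i hi => h i (by simp [hi]))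

theorem IdxGE.mul (hP : IdxGE ρ θ P) (hQ : IdxGE ρ η Q) : IdxGE ρ (θ + η) (P * Q) := by
  classical
  intro J hJ
  rw [coeff_mul] at hJ
  obtain ⟨x, hx, hne⟩ := Finset.exists_ne_zero_of_sum_ne_zero hJ
  rw [← Finset.HasAntidiagonal.mem_antidiagonal.1 hx, wt_add]
  exact add_le_add (hP _ (left_ne_zero_of_mul hne)) (hQ _ (right_ne_zero_of_mul hne))

theorem IdxGE.prod {ι : Type*} (s : Finset ι) (f : ι → MvPolynomial σ R) (t : ι → ℝ)
    (h : ∀ i ∈ s, IdxGE ρ (t i) (f i)) : IdxGE ρ (∑ i ∈ s, t i) (∏ i ∈ s, f i) := by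
  classical
  induction s using Finset.induction_on with
  | empty =>
    intro J hJ
    simp only [Finset.prod_empty] at hJ
    rw [← C_1, coeff_C] at hJ
    have : J = 0 := by
      by_contra h; exact hJ (if_neg (Ne.symm h))
    simp [this, wt]
  | insert a s ha ih =>
    rw [Finset.prod_insert ha, Finset.sum_insert ha]
    exact (h a (by simp)).mul (ih fun i hi => h i (by simp [hi]))

theorem IdxGE.hasse (I : σ →₀ ℕ) (hP : IdxGE ρ θ P) : IdxGE ρ (θ - wt ρ I) (hasse I P) := by
  intro J hJ
  rw [coeff_hasse] at hJ
  have := hP _ (left_ne_zero_of_mul hJ)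
  rw [wt_add] at this
  linarith

theorem IdxGE.mono (h : η ≤ θ) (hP : IdxGE ρ θ P) : IdxGE ρ η P := fun J hJ => h.trans (hP J hJ)

theorem IdxGE.max_zero (hρ : ∀ i, 0 ≤ ρ i) (hP : IdxGE ρ θ P) : IdxGE ρ (max 0 θ) P :=
  fun J hJ => max_le (wt_nonneg hρ J) (hP J hJ)

theorem IdxGE.det {k : ℕ} (A : Matrix (Fin k) (Fin k) (MvPolynomial σ R)) (t : Fin k → ℝ)
    (hA : ∀ i j, IdxGE ρ (t j) (A i j)) : IdxGE ρ (∑ j, t j) A.det := by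
  rw [Matrix.det_apply]
  apply IdxGE.sum
  intro p _
  have h1 : IdxGE ρ (∑ j, t j) (∏ j, A (p j) j) := IdxGE.prod _ _ _ fun j _ => hA _ _
  rcases Int.units_eq_one_or (Equiv.Perm.sign p) with h | h
  · simpa [h] using h1
  · simpa [h] using h1.neg

end idx
end ABT
end

section
namespace ABT
open MvPolynomial
set_option linter.unusedSectionVars false
set_option linter.unusedSimpArgs false

theorem coeff_cons_eq_zero {R : Type*} [CommRing R] {m r0 : ℕ} (P : MvPolynomial (Fin (m+1)) R)
    (h : degreeOf 0 P ≤ r0) (e : ℕ) (J : Fin m →₀ ℕ) (he : r0 < e) :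
    coeff (J.cons e) P = 0 := by
  by_contra hne
  have := degreeOf_le_iff.1 h _ (mem_support_iff.2 hne)
  rw [Finsupp.cons_zero] at this
  omega

theorem exists_factor {m r0 : ℕ} (P : MvPolynomial (Fin (m+1)) ℚ) (hP : P ≠ 0)
    (h : degreeOf 0 P ≤ r0) : ∃ k, 0 < k ∧ k ≤ r0 + 1 ∧ ∃ φ : Fin k → MvPolynomial (Fin m) ℚ,
      ∃ ψ : Fin k → MvPolynomial (Fin 1) ℚ, LinearIndependent ℚ φ ∧ LinearIndependent ℚ ψ ∧
      ∀ e J, coeff (J.cons e) P = ∑ i, coeff J (φ i) * coeff (Finsupp.single 0 e) (ψ i) := by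
  classical
  let p : Fin (r0+1) → MvPolynomial (Fin m) ℚ := fun e => (finSuccEquiv ℚ m P).coeff e
  let S := Set.range p
  have : Module.Finite ℚ (Submodule.span ℚ S) := Module.Finite.span_of_finite ℚ (Set.finite_range p)
  obtain ⟨φ, h1, h2, h3⟩ := Submodule.exists_fun_fin_finrank_span_eq ℚ S
  have hk : Module.finrank ℚ (Submodule.span ℚ S) ≤ r0 + 1 := by
    have := finrank_range_le_card (R := ℚ) p
    simpa [Set.finrank] using this
  choose e0 he0 using h1
  have hmem : ∀ e, ∃ c : Fin _ → ℚ, ∑ i, c i • φ i = p e := by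
    intro e
    rw [← Submodule.mem_span_range_iff_exists_fun, h2]
    exact Submodule.subset_span ⟨e, rfl⟩
  choose c hc using hmem
  refine ⟨_, ?_, hk, φ, fun i => ∑ e : Fin (r0+1), monomial (Finsupp.single 0 (e : ℕ)) (c e i), h3, ?_, ?_⟩
  · by_contra h0
    have h0 : Module.finrank ℚ (Submodule.span ℚ S) = 0 := by omega
    apply hP
    have hz : ∀ e, p e = 0 := by
      intro e
      rw [← hc e]
      apply Finset.sum_eq_zero
      intro i; rw [h0] at i; exact i.elim0
    ext d
    rw [← Finsupp.cons_tail d, coeff_zero]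
    by_cases hd : r0 < d 0
    · exact coeff_cons_eq_zero P h _ _ hd
    · rw [← finSuccEquiv_coeff_coeff]
      have := hz ⟨d 0, by omega⟩
      simp only [p] at this
      rw [this, coeff_zero]
  · rw [Fintype.linearIndependent_iff] at h3 ⊢
    intro g hg i
    have hd : ∀ l, c (e0 i) l = if l = i then 1 else 0 := by
      intro l
      have h5 : ∑ l, (c (e0 i) l - if l = i then 1 else 0) • φ l = 0 := by
        simp only [sub_smul, Finset.sum_sub_distrib, hc, he0]
        simp
      have := h3 _ h5 l
      linarith
    have h6 := congrArg (coeff (Finsupp.single 0 (e0 i : ℕ))) hg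
    have hinj : ∀ x y : Fin (r0+1), (Finsupp.single (0 : Fin 1) (x : ℕ) = Finsupp.single 0 (y:ℕ)) ↔ x = y := by
      intro x y
      constructor
      · intro hxy
        have := DFunLike.congr_fun hxy 0
        simpa [Fin.ext_iff] using this
      · rintro rfl; rfl
    simp only [coeff_sum, coeff_smul, coeff_monomial, hinj, coeff_zero] at h6
    simpa [hd] using h6
  · intro e J
    by_cases hd : r0 < e
    · rw [coeff_cons_eq_zero P h _ _ hd]
      symm
      apply Finset.sum_eq_zero
      intro i _
      simp only [coeff_sum, coeff_monomial]
      rw [Finset.sum_eq_zero, mul_zero]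
      intro x _
      rw [if_neg]
      intro hx
      have := DFunLike.congr_fun hx 0
      simp at this
      have := x.2
      omega
    · rw [← finSuccEquiv_coeff_coeff]
      have h7 := hc ⟨e, by omega⟩
      simp only [p] at h7
      rw [← h7, coeff_sum]
      apply Finset.sum_congr rfl
      intro i _
      rw [coeff_smul, smul_eq_mul, mul_comm]
      congr 1
      simp only [coeff_sum, coeff_monomial]
      rw [Finset.sum_eq_single ⟨e, by omega⟩]
      · simp
      · intro x _ hx
        rw [if_neg]
        intro hx2
        have := DFunLike.congr_fun hx2 0
        simp at this
        exact hx (Fin.ext this)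
      · simp

section emb
variable {R : Type*} [CommRing R] {m : ℕ}

/-- the product of a polynomial in the first variable and one in the others -/
noncomputable def emb (m : ℕ) : MvPolynomial (Fin 1) R →ₐ[R] MvPolynomial (Fin (m+1)) R :=
  rename (fun _ => 0)

noncomputable def emt (m : ℕ) : MvPolynomial (Fin m) R →ₐ[R] MvPolynomial (Fin (m+1)) R :=
  rename Fin.succ

theorem coeff_emb_emt (u : MvPolynomial (Fin 1) R) (v : MvPolynomial (Fin m) R) (e : ℕ)
    (J : Fin m →₀ ℕ) :
    coeff (J.cons e) (emb m u * emt m v) = coeff (Finsupp.single 0 e) u * coeff J v := by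
  classical
  induction u using MvPolynomial.induction_on' with
  | add p q hp hq => simp only [map_add, add_mul, coeff_add, hp, hq]
  | monomial d a =>
    induction v using MvPolynomial.induction_on' with
    | add p q hp hq => simp only [map_add, mul_add, coeff_add, hp, hq]
    | monomial L b =>
      have h1 : Finsupp.mapDomain (fun _ : Fin 1 => (0 : Fin (m+1))) d + Finsupp.mapDomain Fin.succ L
          = L.cons (d 0) := by
        have hd : d = Finsupp.single 0 (d 0) := by
          ext; simp
        rw [hd]
        ext i
        refine Fin.cases ?_ (fun j => ?_) i
        · rw [Finsupp.mapDomain_single, Finsupp.add_apply, Finsupp.mapDomain_of_notMem_range]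
          · simp
          · simp [Fin.succ_ne_zero]
        · rw [Finsupp.mapDomain_single, Finsupp.add_apply, Finsupp.mapDomain_apply (Fin.succ_injective _)]
          simp
      rw [emb, emt, rename_monomial, rename_monomial, monomial_mul, h1, coeff_monomial, coeff_monomial, coeff_monomial]
      have h2 : (d = Finsupp.single 0 e) ↔ d 0 = e := by
        constructor
        · rintro rfl; simp
        · intro h; ext; simp [h]
      simp only [Finsupp.cons_injective2.eq_iff, h2]
      by_cases ha : d 0 = e <;> by_cases hb : L = J <;> simp [ha, hb]

theorem cons_add_cons (e e' : ℕ) (J J' : Fin m →₀ ℕ) :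
    (J.cons e + J'.cons e' : Fin (m+1) →₀ ℕ) = (J + J').cons (e + e') := by
  ext i; refine Fin.cases ?_ (fun j => ?_) i <;> simp

theorem mch_cons (e K : ℕ) (J I : Fin m →₀ ℕ) :
    mch (J.cons e) (I.cons K) = mch (Finsupp.single (0 : Fin 1) e) (Finsupp.single 0 K) * mch J I := by
  simp [mch, Fin.prod_univ_succ]

theorem hasse_emb_emt {k : ℕ} (φ : Fin k → MvPolynomial (Fin m) R) (ψ : Fin k → MvPolynomial (Fin 1) R)
    (P : MvPolynomial (Fin (m+1)) R)
    (h : ∀ e J, coeff (J.cons e) P = ∑ i, coeff J (φ i) * coeff (Finsupp.single 0 e) (ψ i))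
    (I : Fin m →₀ ℕ) (K : ℕ) :
    hasse (I.cons K) P = ∑ i, emt m (hasse I (φ i)) * emb m (hasse (Finsupp.single 0 K) (ψ i)) := by
  ext d
  rw [← Finsupp.cons_tail d, coeff_hasse, cons_add_cons, h, mch_cons, coeff_sum, Finset.sum_mul]
  apply Finset.sum_congr rfl
  intro i _
  rw [mul_comm (emt m _), coeff_emb_emt, coeff_hasse, coeff_hasse, ← Finsupp.single_add]
  push_cast
  ring

theorem shift_emb (s : Fin (m+1) → R) (u : MvPolynomial (Fin 1) R) :
    shift s (emb m u) = emb m (shift (fun _ => s 0) u) := by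
  have : (shift s).comp (emb m) = (emb m).comp (shift (fun _ => s 0)) := by
    ext i : 1
    simp [shift, emb]
  exact DFunLike.congr_fun this u

theorem shift_emt (s : Fin (m+1) → R) (u : MvPolynomial (Fin m) R) :
    shift s (emt m u) = emt m (shift (fun j => s j.succ) u) := by
  have : (shift s).comp (emt m) = (emt m).comp (shift (fun j => s j.succ)) := by
    ext i : 1
    simp [shift, emt]
  exact DFunLike.congr_fun this u

/-- pass to univariate polynomials -/
noncomputable def toUni : MvPolynomial (Fin 1) R →ₐ[R] Polynomial R := aeval (fun _ => Polynomial.X)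

theorem coeff_toUni (u : MvPolynomial (Fin 1) R) (l : ℕ) :
    (toUni u).coeff l = coeff (Finsupp.single 0 l) u := by
  classical
  induction u using MvPolynomial.induction_on' with
  | add p q hp hq => simp [hp, hq]
  | monomial d a =>
    have h2 : (d = Finsupp.single 0 l) ↔ l = d 0 := by
      constructor
      · rintro rfl; simp
      · intro h; ext; simp [h]
    simp only [toUni, aeval_monomial, coeff_monomial, h2]
    rw [Finsupp.prod_fintype _ _ (by simp)]
    simp [Polynomial.coeff_X_pow, ← Polynomial.C_eq_algebraMap]

theorem toUni_shift (s : R) (u : MvPolynomial (Fin 1) R) :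
    toUni (shift (fun _ => s) u) = Polynomial.taylor s (toUni u) := by
  have : toUni.comp (shift (fun _ => s)) = (Polynomial.taylorAlgHom s).comp toUni := by
    ext i : 1
    simp [shift, toUni]
  exact DFunLike.congr_fun this u

end emb

/-- the absolute value on the integers -/
noncomputable abbrev NZ : RingSeminorm ℤ := normRingSeminorm ℤ

theorem NZ_apply (x : ℤ) : NZ x = |(x : ℝ)| := rfl

theorem roth_one (s q : ℤ) (hq : 0 < q) (hcop : IsCoprime s q) (u : MvPolynomial (Fin 1) ℤ) (hu : u ≠ 0) :
    ∃ l : ℕ, coeff (Finsupp.single 0 l) (shift (fun _ => (s : ℚ) / q) (MvPolynomial.map (Int.castRingHom ℚ) u)) ≠ 0 ∧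
      (q : ℝ) ^ l ≤ nrm NZ u := by
  set p : Polynomial ℤ := toUni u with hp
  have hp0 : p ≠ 0 := by
    intro h
    apply hu
    ext d
    have hd : d = Finsupp.single 0 (d 0) := by ext; simp
    rw [hd, ← coeff_toUni, ← hp, h]; simp
  set pq : Polynomial ℚ := p.map (Int.castRingHom ℚ) with hpq
  have hpq0 : pq ≠ 0 := (Polynomial.map_ne_zero_iff Int.cast_injective).2 hp0
  have hmap : toUni (MvPolynomial.map (Int.castRingHom ℚ) u) = pq := by
    ext l
    rw [coeff_toUni, coeff_map, hpq, Polynomial.coeff_map, hp, coeff_toUni]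
  set x : ℚ := (s : ℚ) / q with hx
  set l := pq.rootMultiplicity x with hl
  refine ⟨l, ?_, ?_⟩
  · rw [← coeff_toUni, toUni_shift, hmap]
    obtain ⟨g, hg, hg2⟩ := Polynomial.exists_eq_pow_rootMultiplicity_mul_and_not_dvd pq hpq0 x
    rw [hg, ← hl, Polynomial.taylor_mul, Polynomial.taylor_pow]
    have : Polynomial.taylor x (Polynomial.X - Polynomial.C x) = Polynomial.X := by simp
    rw [this, mul_comm, Polynomial.coeff_mul_X_pow', if_pos le_rfl, Nat.sub_self, Polynomial.taylor_coeff_zero]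
    rwa [Polynomial.dvd_iff_isRoot] at hg2
  · have hdvd : (Polynomial.C q * Polynomial.X - Polynomial.C s) ^ l ∣ p := by
      have hprim : ((Polynomial.C q * Polynomial.X - Polynomial.C s : Polynomial ℤ) ^ l).IsPrimitive := by
        have hb : (Polynomial.C q * Polynomial.X - Polynomial.C s : Polynomial ℤ).IsPrimitive := by
          intro r hr
          rw [Polynomial.C_dvd_iff_dvd_coeff] at hr
          have h0 := hr 0
          have h1 := hr 1
          rw [Polynomial.coeff_sub, Polynomial.coeff_C_mul, Polynomial.coeff_X_one, Polynomial.coeff_C] at h1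
          simp at h0 h1
          exact hcop.isUnit_of_dvd' h0 h1
        clear hl
        clear_value l
        induction l with
        | zero => simp
        | succ n ih => rw [pow_succ]; exact ih.mul hb
      rw [Polynomial.IsPrimitive.Int.dvd_iff_map_cast_dvd_map_cast _ _ hprim, ← hpq]
      have hq' : (q : ℚ) ≠ 0 := by exact_mod_cast hq.ne'
      have e1 : Polynomial.map (Int.castRingHom ℚ) ((Polynomial.C q * Polynomial.X - Polynomial.C s) ^ l)
          = Polynomial.C ((q : ℚ) ^ l) * (Polynomial.X - Polynomial.C x) ^ l := by
        rw [Polynomial.C_pow, ← mul_pow, mul_sub, ← Polynomial.C_mul, hx, mul_div_cancel₀ _ hq']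
        simp
      rw [e1]
      have hun : IsUnit (Polynomial.C ((q : ℚ) ^ l)) := Polynomial.isUnit_C.2 (isUnit_iff_ne_zero.2 (pow_ne_zero _ hq'))
      rw [hun.mul_left_dvd]
      exact Polynomial.pow_rootMultiplicity_dvd pq x
    obtain ⟨g, hg⟩ := hdvd
    have hlc : p.leadingCoeff = q ^ l * g.leadingCoeff := by
      rw [hg, Polynomial.leadingCoeff_mul, Polynomial.leadingCoeff_pow]
      congr 2
      rw [sub_eq_add_neg, ← Polynomial.C_neg]
      exact Polynomial.leadingCoeff_linear hq.ne'
    have h3 : q ^ l ≤ |p.leadingCoeff| := by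
      have h4 : p.leadingCoeff ≠ 0 := Polynomial.leadingCoeff_ne_zero.2 hp0
      exact Int.le_of_dvd (abs_pos.2 h4) ((dvd_abs _ _).2 ⟨_, hlc⟩)
    have h5 := coeff_le_nrm NZ u (Finsupp.single 0 p.natDegree)
    rw [← coeff_toUni, ← hp, NZ_apply] at h5
    refine le_trans ?_ h5
    exact_mod_cast h3

end ABT
end

section
namespace ABT
open MvPolynomial
set_option linter.unusedSectionVars false
set_option linter.unusedSimpArgs false

theorem sum_max_ge (k r0 : ℕ) (hk : k ≤ r0 + 1) (hr : 0 < r0) (t : ℝ) (ht0 : 0 < t) (ht1 : t ≤ 1) :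
    k * t ^ 2 / 8 ≤ ∑ j : Fin k, max 0 (t - (j : ℕ) * (1 / (r0 : ℝ))) := by
  rw [Fin.sum_univ_eq_sum_range (fun j : ℕ => max 0 (t - j * (1 / (r0 : ℝ))))]
  have hr' : (0 : ℝ) < r0 := by exact_mod_cast hr
  set n := min k (⌊(r0 : ℝ) * t / 2⌋₊ + 1) with hn
  have hsub : Finset.range n ⊆ Finset.range k := by
    intro x hx; rw [Finset.mem_range] at *; omega
  have h1 : ∑ j ∈ Finset.range n, (t / 2) ≤ ∑ j ∈ Finset.range n, max 0 (t - j * (1 / (r0 : ℝ))) := by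
    apply Finset.sum_le_sum
    intro j hj
    rw [Finset.mem_range] at hj
    have hj2 : j ≤ ⌊(r0 : ℝ) * t / 2⌋₊ := by omega
    have hj3 : (j : ℝ) ≤ (r0 : ℝ) * t / 2 := (Nat.le_floor_iff (by positivity)).1 hj2
    have hj4 : (j : ℝ) * (1 / (r0 : ℝ)) ≤ t / 2 := by
      rw [mul_one_div, div_le_iff₀ hr']; linarith
    exact le_trans (by linarith) (le_max_right _ _)
  have h2 : ∑ j ∈ Finset.range n, max 0 (t - j * (1 / (r0 : ℝ))) ≤
      ∑ j ∈ Finset.range k, max 0 (t - j * (1 / (r0 : ℝ))) :=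
    Finset.sum_le_sum_of_subset_of_nonneg hsub fun _ _ _ => le_max_left _ _
  have h3 : (k : ℝ) * t / 4 ≤ n := by
    rw [hn]
    push_cast
    apply le_min
    · have : (0 : ℝ) ≤ k := by positivity
      nlinarith
    · have h4 := (Nat.lt_floor_add_one ((r0 : ℝ) * t / 2)).le
      have h5 : (k : ℝ) ≤ 2 * r0 := by
        have : k ≤ 2 * r0 := by omega
        exact_mod_cast this
      nlinarith
  rw [Finset.sum_const, Finset.card_range, nsmul_eq_mul] at h1
  nlinarith

theorem sum_perm_max (k : ℕ) (K : Fin k → ℕ) (hinj : Function.Injective K) (hK : ∀ j, K j ≤ k - 1)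
    (f : ℕ → ℝ) : ∑ j, f (K j) = ∑ j : Fin k, f j := by
  have hlt : ∀ j, K j < k := fun j => by have := hK j; have := j.2; omega
  let g : Fin k → Fin k := fun j => ⟨K j, hlt j⟩
  have hg : Function.Bijective g := by
    rw [Fintype.bijective_iff_injective_and_card]
    exact ⟨fun a b hab => hinj (by simpa [g] using hab), rfl⟩
  exact Function.Bijective.sum_comp hg (fun j => f j)

/-- Roth's lemma in `m` variables -/
def RothProp (m : ℕ) : Prop := ∀ ε : ℝ, 0 < ε → ∃ ω : ℝ, 0 < ω ∧ ∀ (r : Fin m → ℕ) (E : ℝ)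
    (s q : Fin m → ℤ), (∀ j, 0 < r j) → (∀ j, 0 < q j) → (∀ j, IsCoprime (s j) (q j)) →
    (∀ j, E ≤ r j * Real.log (q j)) → (∀ j, (r j : ℝ) ≤ ω * E) →
    (∀ i j, i < j → (r i : ℝ) ≤ ω * r j) → ∀ P : MvPolynomial (Fin m) ℤ, P ≠ 0 →
    (∀ j, degreeOf j P ≤ r j) → nrm NZ P ≤ Real.exp (ω * E) →
    ∃ J, coeff J (shift (fun j => (s j : ℚ) / q j) (MvPolynomial.map (Int.castRingHom ℚ) P)) ≠ 0 ∧
      wt (fun j => 1 / (r j : ℝ)) J ≤ ε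

theorem roth_zero : RothProp 0 := by
  intro ε hε
  refine ⟨1, one_pos, fun r E s q _ _ _ _ _ _ P hP _ _ => ?_⟩
  refine ⟨0, ?_, by simpa [wt] using hε.le⟩
  have h1 : shift (fun j => (s j : ℚ) / q j) (MvPolynomial.map (Int.castRingHom ℚ) P) ≠ 0 := by
    have hz : (shift (fun j : Fin 0 => (s j : ℚ) / q j)) = AlgHom.id _ _ := by
      ext i; exact i.elim0
    rw [hz]
    simp only [AlgHom.id_apply]
    intro h
    exact hP (map_injective _ Int.cast_injective (by simpa using h))
  intro h
  apply h1
  ext d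
  rw [Subsingleton.elim d 0, h]; simp

/-- the structure of the determinant used in the induction step -/
theorem exists_det {m r0 : ℕ} (P : MvPolynomial (Fin (m+1)) ℤ) (hP : P ≠ 0) (h : degreeOf 0 P ≤ r0) :
    ∃ k, 0 < k ∧ k ≤ r0 + 1 ∧ ∃ (I : Fin k → (Fin m →₀ ℕ)) (K : Fin k → ℕ) 
      (U : MvPolynomial (Fin 1) ℚ) (V : MvPolynomial (Fin m) ℚ),
      (∀ i, (I i).degree ≤ k - 1) ∧ Function.Injective K ∧ (∀ i, K i ≤ k - 1) ∧ U ≠ 0 ∧ V ≠ 0 ∧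
      MvPolynomial.map (Int.castRingHom ℚ) (Matrix.of fun i j => hasse ((I i).cons (K j)) P).det = emb m U * emt m V := by
  classical
  have hinj : Function.Injective (MvPolynomial.map (σ := Fin (m+1)) (Int.castRingHom ℚ)) := map_injective _ Int.cast_injective
  have hP' : MvPolynomial.map (Int.castRingHom ℚ) P ≠ 0 := by
    intro h; exact hP (hinj (by simpa using h))
  have hd' : degreeOf 0 (MvPolynomial.map (Int.castRingHom ℚ) P) ≤ r0 := by
    rw [degreeOf_le_iff] at h ⊢
    intro d hd
    exact h d (support_map_subset _ _ hd)
  obtain ⟨k, hk0, hk, φ, ψ, h1, h2, h3⟩ := exists_factor _ hP' hd'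
  obtain ⟨I, hI, hV⟩ := wronskian φ h1
  obtain ⟨L, hL, hU⟩ := wronskian ψ h2
  have hLs : ∀ j, L j = Finsupp.single 0 (L j 0) := by intro j; ext; simp
  refine ⟨k, hk0, hk, I, fun j => L j 0, _, _, hI, ?_, ?_, hU, hV, ?_⟩
  · intro a b hab
    by_contra hne
    apply hU
    apply Matrix.det_zero_of_row_eq hne
    ext j : 1
    simp only [Matrix.of_apply]
    rw [hLs a, hLs b]
    simp only at hab
    rw [hab]
  · intro i
    have := hL i
    rw [hLs i] at this
    simpa using this
  · rw [RingHom.map_det, AlgHom.map_det, AlgHom.map_det, mul_comm]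
    rw [← Matrix.det_transpose ((emb m).mapMatrix _), ← Matrix.det_mul]
    congr 1
    ext i j : 1
    simp only [RingHom.mapMatrix_apply, AlgHom.mapMatrix_apply, Matrix.map_apply, Matrix.of_apply,
      Matrix.mul_apply, Matrix.transpose_apply]
    rw [← hasse_map, hasse_emb_emt φ ψ _ h3]
    apply Finset.sum_congr rfl
    intro l _
    rw [← hLs j]

theorem wt_cons {m : ℕ} (ρ : Fin (m+1) → ℝ) (e : ℕ) (J : Fin m →₀ ℕ) :
    wt ρ (J.cons e) = e * ρ 0 + wt (fun j => ρ j.succ) J := by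
  simp [wt, Fin.sum_univ_succ]

theorem wt_le_degree {m : ℕ} (ρ : Fin m → ℝ) (c : ℝ) (hρ : ∀ j, ρ j ≤ c) (J : Fin m →₀ ℕ) :
    wt ρ J ≤ J.degree * c := by
  rw [wt, Finsupp.degree_eq_sum]
  push_cast
  rw [Finset.sum_mul]
  exact Finset.sum_le_sum fun i _ => mul_le_mul_of_nonneg_left (hρ i) (by positivity)

theorem NZ_one : NZ 1 ≤ 1 := by rw [NZ_apply]; simp

theorem shift_map_det_idx {m k : ℕ} (ρ : Fin (m+1) → ℝ) (hρ : ∀ i, 0 ≤ ρ i) (P : MvPolynomial (Fin (m+1)) ℤ)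
    (x : Fin (m+1) → ℚ) (θ c : ℝ) (hP : IdxGE ρ θ (shift x (MvPolynomial.map (Int.castRingHom ℚ) P)))
    (I : Fin k → (Fin m →₀ ℕ)) (K : Fin k → ℕ) (hI : ∀ i, wt (fun j => ρ j.succ) (I i) ≤ c) :
    IdxGE ρ (∑ j, max 0 (θ - c - K j * ρ 0))
      (shift x (MvPolynomial.map (Int.castRingHom ℚ) (Matrix.of fun i j => hasse ((I i).cons (K j)) P).det)) := by
  rw [RingHom.map_det, AlgHom.map_det]
  apply IdxGE.det
  intro i j
  simp only [RingHom.mapMatrix_apply, AlgHom.mapMatrix_apply, Matrix.map_apply, Matrix.of_apply]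
  rw [← hasse_map, ← hasse_shift]
  apply IdxGE.max_zero hρ
  refine (hP.hasse _).mono ?_
  rw [wt_cons]
  have := hI i
  linarith

theorem det_nrm {m k : ℕ} (r : Fin (m+1) → ℕ) (X : ℝ) (P : MvPolynomial (Fin (m+1)) ℤ)
    (hd : ∀ j, degreeOf j P ≤ r j) (hrX : ∀ j, (r j : ℝ) ≤ X) (hX : nrm NZ P ≤ Real.exp X)
    (hk0 : 0 < k) (hk : k ≤ r 0 + 1) (L : Fin k → Fin k → (Fin (m+1) →₀ ℕ)) :
    nrm NZ (Matrix.of fun i j => hasse (L i j) P).det ≤ Real.exp (k * ((m + 3) * X)) := by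
  have h1 : ∀ i j, nrm NZ ((Matrix.of fun i j => hasse (L i j) P) i j) ≤ Real.exp ((m + 2) * X) := by
    intro i j
    refine (nrm_hasse NZ _ P r hd).trans ?_
    have h2 : ((2 : ℝ)) ^ (∑ i, r i) ≤ Real.exp ((m + 1) * X) := by
      have e2 : (2 : ℝ) ≤ Real.exp 1 := by
        have := Real.add_one_le_exp (1 : ℝ); linarith
      calc (2 : ℝ) ^ (∑ i, r i) ≤ (Real.exp 1) ^ (∑ i, r i) := pow_le_pow_left₀ (by norm_num) e2 _
        _ = Real.exp ((∑ i, r i : ℕ) : ℝ) := by rw [← Real.exp_nat_mul, mul_one]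
        _ ≤ _ := by
          apply Real.exp_le_exp.2
          push_cast
          refine (Finset.sum_le_sum (fun i _ => hrX i)).trans ?_
          simp
    calc (2 : ℝ) ^ (∑ i, r i) * nrm NZ P ≤ Real.exp ((m + 1) * X) * Real.exp X :=
          mul_le_mul h2 hX (nrm_nonneg _ _) (by positivity)
      _ = _ := by rw [← Real.exp_add]; ring_nf
  refine (nrm_det NZ NZ_one _ _ h1).trans ?_
  have h3 : (k.factorial : ℝ) ≤ Real.exp (k * X) := by
    have h4 : (k : ℝ) ≤ Real.exp X := by
      have h5 : (k : ℝ) ≤ r 0 + 1 := by exact_mod_cast hk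
      have := Real.add_one_le_exp X
      linarith [hrX 0]
    calc (k.factorial : ℝ) ≤ (k : ℝ) ^ k := by exact_mod_cast Nat.factorial_le_pow k
      _ ≤ Real.exp X ^ k := pow_le_pow_left₀ (by positivity) h4 _
      _ = _ := by rw [← Real.exp_nat_mul]
  calc (k.factorial : ℝ) * Real.exp ((m + 2) * X) ^ k ≤ Real.exp (k * X) * Real.exp ((m + 2) * X) ^ k :=
        mul_le_mul_of_nonneg_right h3 (by positivity)
    _ = _ := by rw [← Real.exp_nat_mul, ← Real.exp_add]; ring_nf

theorem roth_succ (m : ℕ) (ih : RothProp m) : RothProp (m+1) := by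
  classical
  intro ε hε
  set θ := min ε 1 with hθ
  have hθ0 : 0 < θ := lt_min hε one_pos
  have hθ1 : θ ≤ 1 := min_le_right _ _
  set ε' := θ ^ 2 / 128 with hε'
  have hε'0 : 0 < ε' := by positivity
  obtain ⟨ω', hω'0, hω'⟩ := ih ε' hε'0
  have hm3 : (0 : ℝ) < m + 3 := by positivity
  set ω := min (min (ω' / (m+3)) (ε' / (m+3))) (min ω' (θ / 2)) with hω
  have hω0 : 0 < ω := by
    apply lt_min (lt_min _ _) (lt_min hω'0 (by positivity)) <;> positivity
  have hω1 : ω * (m+3) ≤ ω' := by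
    rw [← le_div_iff₀ hm3]; exact (min_le_left _ _).trans (min_le_left _ _)
  have hω2 : ω * (m+3) ≤ ε' := by
    rw [← le_div_iff₀ hm3]; exact (min_le_left _ _).trans (min_le_right _ _)
  have hω3 : ω ≤ ω' := (min_le_right _ _).trans (min_le_left _ _)
  have hω4 : ω ≤ θ / 2 := (min_le_right _ _).trans (min_le_right _ _)
  clear_value ω ε' θ
  refine ⟨ω, hω0, fun r E s q hr hq hcop hE hrE hrr P hP hd hPn => ?_⟩
  have hr0 : (0 : ℝ) < r 0 := by exact_mod_cast hr 0
  have hEpos : 0 < E := by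
    have := hrE 0
    by_contra h
    nlinarith
  by_contra hcon
  push Not at hcon
  set x : Fin (m+1) → ℚ := fun j => (s j : ℚ) / q j with hx
  set ρ : Fin (m+1) → ℝ := fun j => 1 / (r j : ℝ) with hρ
  have hρ0 : ∀ i, 0 ≤ ρ i := fun i => by simp only [hρ]; positivity
  have hidx : IdxGE ρ θ (shift x (MvPolynomial.map (Int.castRingHom ℚ) P)) := by
    intro J hJ
    have := hcon J hJ
    exact ((min_le_left ε 1).trans this.le).trans' hθ.le
  obtain ⟨k, hk0, hk, I, K, U, V, hI, hKinj, hK, hU, hV, hdet⟩ := exists_det P hP (hd 0)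
  set W := (Matrix.of fun i j => hasse ((I i).cons (K j)) P).det with hW
  have hk0' : (0 : ℝ) < k := by exact_mod_cast hk0
  have hI' : ∀ i, wt (fun j => ρ j.succ) (I i) ≤ ω := by
    intro i
    refine (wt_le_degree _ (ω / r 0) ?_ _).trans ?_
    · intro j
      have h1 := hrr 0 j.succ (Fin.succ_pos j)
      have h2 : (0 : ℝ) < r j.succ := by exact_mod_cast hr _
      simp only [hρ]
      rw [div_le_div_iff₀ h2 hr0]
      linarith
    · have h3 : ((I i).degree : ℝ) ≤ r 0 := by
        have := hI i
        have : (I i).degree ≤ r 0 := by omega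
        exact_mod_cast this
      calc ((I i).degree : ℝ) * (ω / r 0) ≤ r 0 * (ω / r 0) := mul_le_mul_of_nonneg_right h3 (by positivity)
        _ = ω := by field_simp
  have hlow := shift_map_det_idx ρ hρ0 P x θ ω hidx I K hI'
  rw [← hW, hdet] at hlow
  have hWn : nrm NZ W ≤ Real.exp (k * ((m + 3) * (ω * E))) :=
    det_nrm r (ω * E) P hd hrE hPn hk0 hk _
  have hWd : ∀ j, degreeOf j W ≤ k * r j := fun j =>
    degreeOf_det _ _ _ fun a b => (degreeOf_hasse _ _ _).trans (hd j)
  have hWc : ∀ e J, ((coeff (Finsupp.cons e J) W : ℤ) : ℚ) = coeff (Finsupp.single 0 e) U * coeff J V := by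
    intro e J
    rw [← coeff_emb_emt, ← hdet, coeff_map]; simp
  obtain ⟨d0, hd0⟩ := ne_zero_iff.1 hU
  obtain ⟨J0, hJ0⟩ := ne_zero_iff.1 hV
  have hd0s : d0 = Finsupp.single 0 (d0 0) := by ext; simp
  rw [hd0s] at hd0
  set e0 := d0 0
  -- the polynomial v
  set v : MvPolynomial (Fin m) ℤ := (finSuccEquiv ℤ m W).coeff e0 with hv
  have hvc : ∀ J, coeff J v = coeff (Finsupp.cons e0 J) W := fun J => finSuccEquiv_coeff_coeff _ _ _
  have hvV : MvPolynomial.map (Int.castRingHom ℚ) v = C (coeff (Finsupp.single 0 e0) U) * V := by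
    ext J
    rw [coeff_map, hvc, coeff_C_mul, ← hWc]; simp
  have hv0 : v ≠ 0 := by
    intro h
    rw [h, map_zero] at hvV
    exact mul_ne_zero (by simpa using hd0) hV hvV.symm
  obtain ⟨J', hJ'1, hJ'2⟩ := hω' (fun j => k * r j.succ) (k * E) (fun j => s j.succ) (fun j => q j.succ)
    (fun j => Nat.mul_pos hk0 (hr _)) (fun j => hq _) (fun j => hcop _)
    (fun j => by
      push_cast
      rw [mul_assoc]
      exact mul_le_mul_of_nonneg_left (hE _) hk0'.le)
    (fun j => by
      push_cast
      have h1 := hrE j.succ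
      have h2 : ω * E ≤ ω' * E := mul_le_mul_of_nonneg_right hω3 hEpos.le
      nlinarith)
    (fun i j hij => by
      push_cast
      have h1 := hrr i.succ j.succ (Fin.succ_lt_succ_iff.2 hij)
      have h2 : ω * r j.succ ≤ ω' * r j.succ := mul_le_mul_of_nonneg_right hω3 (by positivity)
      nlinarith)
    v hv0
    (fun j => by
      rw [degreeOf_le_iff]
      intro J hJ
      rw [mem_support_iff, hvc] at hJ
      have := degreeOf_le_iff.1 (hWd j.succ) _ (mem_support_iff.2 hJ)
      simpa using this)
    (by
      refine (nrm_le_of_inj NZ W v (fun J => Finsupp.cons e0 J) ?_ hvc).trans (hWn.trans ?_)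
      · intro a b hab
        exact (Finsupp.cons_injective2 hab).2
      · apply Real.exp_le_exp.2
        have : ω * (m+3) * E ≤ ω' * E := mul_le_mul_of_nonneg_right hω1 hEpos.le
        nlinarith)
  rw [hvV, map_mul, show (C (coeff (Finsupp.single 0 e0) U) : MvPolynomial (Fin m) ℚ) = algebraMap _ _ _ from rfl,
    AlgHom.commutes, algebraMap_eq, coeff_C_mul] at hJ'1
  have hJ'3 := right_ne_zero_of_mul hJ'1
  -- the polynomial u
  set u : MvPolynomial (Fin 1) ℤ := ∑ e ∈ Finset.range (k * r 0 + 1),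
    monomial (Finsupp.single 0 e) (coeff (Finsupp.cons e J0) W) with hu
  have huc : ∀ d, coeff d u = coeff (Finsupp.cons (d 0) J0) W := by
    intro d
    have hds : d = Finsupp.single 0 (d 0) := by ext; simp
    rw [hu, coeff_sum]
    by_cases hde : d 0 < k * r 0 + 1
    · rw [Finset.sum_eq_single (d 0)]
      · rw [coeff_monomial, if_pos hds.symm]
      · intro b _ hb
        rw [coeff_monomial, if_neg]
        intro h; apply hb; rw [← h]; simp
      · intro h; exact absurd (Finset.mem_range.2 hde) h
    · rw [coeff_cons_eq_zero W (hWd 0) _ _ (by omega)]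
      apply Finset.sum_eq_zero
      intro b hb
      rw [coeff_monomial, if_neg]
      intro h
      rw [Finset.mem_range] at hb
      apply hde; rw [← h]; simpa using hb
  have huU : MvPolynomial.map (Int.castRingHom ℚ) u = C (coeff J0 V) * U := by
    ext d
    have hds : d = Finsupp.single 0 (d 0) := by ext; simp
    rw [coeff_map, huc, coeff_C_mul]
    conv_rhs => rw [hds]
    rw [mul_comm, ← hWc]; simp
  have hu0 : u ≠ 0 := by
    intro h
    rw [h, map_zero] at huU
    exact mul_ne_zero (by simpa using hJ0) hU huU.symm
  obtain ⟨l, hl1, hl2⟩ := roth_one (s 0) (q 0) (hq 0) (hcop 0) u hu0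
  rw [huU, map_mul, show (C (coeff J0 V) : MvPolynomial (Fin 1) ℚ) = algebraMap _ _ _ from rfl,
    AlgHom.commutes, algebraMap_eq, coeff_C_mul] at hl1
  have hl3 := right_ne_zero_of_mul hl1
  have hl4 : (l : ℝ) * Real.log (q 0) ≤ k * ((m + 3) * (ω * E)) := by
    have h1 : (q 0 : ℝ) ^ l ≤ Real.exp (k * ((m + 3) * (ω * E))) := by
      refine hl2.trans ((nrm_le_of_inj NZ W u (fun d => Finsupp.cons (d 0) J0) ?_ huc).trans hWn)
      intro a b hab
      have := (Finsupp.cons_injective2 hab).1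
      ext; simpa using this
    have hq0 : (0 : ℝ) < q 0 := by exact_mod_cast hq 0
    have := Real.log_le_log (by positivity) h1
    rwa [Real.log_pow, Real.log_exp] at this
  have hlq : 0 < Real.log (q 0) := by
    have := hE 0
    by_contra h
    nlinarith
  have hl5 : (l : ℝ) * ρ 0 ≤ k * ε' := by
    simp only [hρ]
    rw [mul_one_div, div_le_iff₀ hr0]
    have h1 : (k : ℝ) * ((m + 3) * (ω * E)) ≤ k * ε' * E := by
      have : ω * (m+3) * E ≤ ε' * E := mul_le_mul_of_nonneg_right hω2 hEpos.le
      nlinarith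
    have h2 : (l : ℝ) * Real.log (q 0) ≤ k * ε' * r 0 * Real.log (q 0) := by
      refine hl4.trans (h1.trans ?_)
      rw [mul_assoc (_ * _)]
      exact mul_le_mul_of_nonneg_left (hE 0) (by positivity)
    exact le_of_mul_le_mul_right h2 hlq
  have hJ'5 : wt (fun j => ρ j.succ) J' ≤ k * ε' := by
    have : wt (fun j => ρ j.succ) J' = k * wt (fun j : Fin m => 1 / ((k * r j.succ : ℕ) : ℝ)) J' := by
      simp only [wt, Finset.mul_sum, hρ]
      apply Finset.sum_congr rfl
      intro j _
      push_cast
      field_simp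
    rw [this]
    exact mul_le_mul_of_nonneg_left hJ'2 hk0'.le
  have hfin := hlow (Finsupp.cons l J') (by
    rw [map_mul, shift_emb, shift_emt, coeff_emb_emt]
    exact mul_ne_zero hl3 hJ'3)
  rw [wt_cons, sum_perm_max k K hKinj hK (fun n => max 0 (θ - ω - n * ρ 0))] at hfin
  have h8 := sum_max_ge k (r 0) hk (hr 0) (θ / 2) (by positivity) (by linarith)
  have h9 : ∑ j : Fin k, max 0 (θ / 2 - (j : ℕ) * (1 / (r 0 : ℝ))) ≤
      ∑ j : Fin k, max 0 (θ - ω - (j : ℕ) * ρ 0) := by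
    apply Finset.sum_le_sum
    intro j _
    apply max_le_max le_rfl
    simp only [hρ]
    linarith
  have h10 : (k : ℝ) * (θ / 2) ^ 2 / 8 ≤ k * ε' + k * ε' := by linarith
  rw [hε'] at h10
  have : 0 < (k : ℝ) * θ ^ 2 := by positivity
  nlinarith

theorem roth (m : ℕ) : RothProp m := by
  induction m with
  | zero => exact roth_zero
  | succ m ih => exact roth_succ m ih

end ABT
end

section
namespace ABT
open MvPolynomial
set_option linter.unusedSectionVars false
set_option linter.unusedSimpArgs false

section siegel
open Matrix

theorem siegel {α β : Type*} [Fintype α] [Fintype β] (A : α → β → ℤ) (M : ℝ) (hM : 1 ≤ M)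
    (hA : ∀ i j, |(A i j : ℝ)| ≤ M) (hcard : 2 * Fintype.card α ≤ Fintype.card β)
    (hb : 0 < Fintype.card β) :
    ∃ t : β → ℤ, t ≠ 0 ∧ (∀ i, ∑ j, A i j * t j = 0) ∧
      ∀ j, |(t j : ℝ)| ≤ Fintype.card β * M := by
  classical
  have hb1 : (1 : ℝ) ≤ Fintype.card β := by exact_mod_cast hb
  have hbM : 1 ≤ (Fintype.card β : ℝ) * M := by nlinarith
  rcases Nat.eq_zero_or_pos (Fintype.card α) with h0 | h0
  · have := Fintype.card_eq_zero_iff.1 h0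
    obtain ⟨b⟩ := Fintype.card_pos_iff.1 hb
    refine ⟨fun _ => 1, fun h => one_ne_zero (congrFun h b), fun i => isEmptyElim i, fun j => ?_⟩
    simpa using hbM
  · let := Matrix.seminormedAddCommGroup (m := α) (n := β) (α := ℤ)
    obtain ⟨t, ht0, ht, htn⟩ := Int.Matrix.exists_ne_zero_int_vec_norm_le (Matrix.of A)
      (by omega) h0
    refine ⟨t, ht0, fun i => congrFun ht i, fun j => ?_⟩
    have h1 : ‖t j‖ ≤ ‖t‖ := norm_le_pi_norm t j
    rw [Int.norm_eq_abs] at h1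
    refine (h1.trans htn).trans ?_
    have hmax : max 1 ‖Matrix.of A‖ ≤ M := by
      apply max_le hM
      rw [Matrix.norm_le_iff (by linarith)]
      intro i j
      rw [Int.norm_eq_abs]
      exact hA i j
    have hc : (2 * Fintype.card α : ℝ) ≤ Fintype.card β := by exact_mod_cast hcard
    have hα : (0 : ℝ) < Fintype.card α := by exact_mod_cast h0
    calc _ ≤ ((Fintype.card β : ℝ) * M) ^ ((Fintype.card α : ℝ) / (Fintype.card β - Fintype.card α)) := by
          apply Real.rpow_le_rpow
          · positivity
          · gcongr
          · apply div_nonneg <;> linarith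
      _ ≤ ((Fintype.card β : ℝ) * M) ^ (1 : ℝ) := by
          apply Real.rpow_le_rpow_of_exponent_le hbM
          rw [div_le_one] <;> linarith
      _ = _ := Real.rpow_one _
end siegel

section cheb
variable {m : ℕ} {κ : Fin m → Type*} [∀ j, DecidableEq (κ j)]

theorem sum_sq_pi (S : ∀ j, Finset (κ j)) (g : ∀ j, κ j → ℝ)
    (hg0 : ∀ j, ∑ x ∈ S j, g j x = 0) (hg1 : ∀ j, ∀ x ∈ S j, |g j x| ≤ 1) :
    ∑ e ∈ Fintype.piFinset S, (∑ j, g j (e j)) ^ 2 ≤ m * (Fintype.piFinset S).card := by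
  have hcross : ∀ j k, j ≠ k → ∑ e ∈ Fintype.piFinset S, g j (e j) * g k (e k) = 0 := by
    intro j k hjk
    let f : ∀ x, κ x → ℝ := fun x y => if x = j then g x y else if x = k then g x y else 1
    have h1 : ∀ e : ∀ x, κ x, ∏ x, f x (e x) = g j (e j) * g k (e k) := by
      intro e
      have : ∏ x, f x (e x) = ∏ x ∈ {j, k}, f x (e x) := by
        symm
        apply Finset.prod_subset (Finset.subset_univ _)
        intro x _ hx
        simp only [Finset.mem_insert, Finset.mem_singleton, not_or] at hx
        simp [f, hx.1, hx.2]
      rw [this, Finset.prod_pair hjk]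
      simp [f]
    calc _ = ∑ e ∈ Fintype.piFinset S, ∏ x, f x (e x) := by simp only [h1]
      _ = ∏ x, ∑ y ∈ S x, f x y := (Finset.prod_univ_sum S f).symm
      _ = 0 := by
        apply Finset.prod_eq_zero (Finset.mem_univ j)
        simpa [f] using hg0 j
  calc _ = ∑ e ∈ Fintype.piFinset S, ∑ j, ∑ k, g j (e j) * g k (e k) := by
        apply Finset.sum_congr rfl
        intro e _
        rw [sq, Finset.sum_mul_sum]
    _ = ∑ j, ∑ k, ∑ e ∈ Fintype.piFinset S, g j (e j) * g k (e k) := by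
        rw [Finset.sum_comm]
        apply Finset.sum_congr rfl
        intro j _
        rw [Finset.sum_comm]
    _ = ∑ j, ∑ e ∈ Fintype.piFinset S, g j (e j) * g j (e j) := by
        apply Finset.sum_congr rfl
        intro j _
        rw [Finset.sum_eq_single j]
        · intro k _ hk
          exact hcross j k (Ne.symm hk)
        · simp
    _ ≤ ∑ j : Fin m, ((Fintype.piFinset S).card : ℝ) := by
        apply Finset.sum_le_sum
        intro j _
        rw [Finset.card_eq_sum_ones, Nat.cast_sum]
        apply Finset.sum_le_sum
        intro e he
        have := hg1 j (e j) (Fintype.mem_piFinset.1 he j)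
        have h2 := abs_mul_abs_self (g j (e j))
        have := abs_nonneg (g j (e j))
        push_cast
        nlinarith
    _ = _ := by simp

theorem cheb (S : ∀ j, Finset (κ j)) (g : ∀ j, κ j → ℝ)
    (hg0 : ∀ j, ∑ x ∈ S j, g j x = 0) (hg1 : ∀ j, ∀ x ∈ S j, |g j x| ≤ 1) (ε : ℝ) (hε : 0 < ε)
    (hm : 0 < m) :
    (((Fintype.piFinset S).filter (fun e => ∑ j, g j (e j) < - (ε * m))).card : ℝ) * (ε ^ 2 * m)
      ≤ (Fintype.piFinset S).card := by
  have h := sum_sq_pi S g hg0 hg1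
  have hm' : (0 : ℝ) < m := by exact_mod_cast hm
  have h2 : (((Fintype.piFinset S).filter (fun e => ∑ j, g j (e j) < - (ε * m))).card : ℝ) *
      (ε * m) ^ 2 ≤ ∑ e ∈ Fintype.piFinset S, (∑ j, g j (e j)) ^ 2 := by
    rw [← nsmul_eq_mul]
    refine (Finset.card_nsmul_le_sum _ _ _ ?_).trans
      (Finset.sum_le_sum_of_subset_of_nonneg (Finset.filter_subset _ _) fun _ _ _ => sq_nonneg _)
    intro e he
    have := (Finset.mem_filter.1 he).2
    have : 0 < ε * m := by positivity
    nlinarith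
  have := h2.trans h
  rw [show (ε * m) ^ 2 = m * (ε ^ 2 * m) by ring] at this
  nlinarith
end cheb

section simplex
variable {n : ℕ}

/-- exponents of total degree `r` -/
def Simp (n r : ℕ) : Finset (Fin n → ℕ) := Finset.piAntidiag Finset.univ r

theorem mem_Simp {r : ℕ} {e : Fin n → ℕ} : e ∈ Simp n r ↔ ∑ i, e i = r := by
  simp [Simp]

theorem Simp_le {r : ℕ} {e : Fin n → ℕ} (h : e ∈ Simp n r) (i : Fin n) : e i ≤ r := by
  rw [mem_Simp] at h
  rw [← h]
  exact Finset.single_le_sum (fun _ _ => Nat.zero_le _) (Finset.mem_univ i)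

theorem card_Simp_le (r : ℕ) : (Simp n r).card ≤ 2 ^ (n * r) := by
  have : Simp n r ⊆ Fintype.piFinset (fun _ : Fin n => Finset.range (r + 1)) := by
    intro e he
    rw [Fintype.mem_piFinset]
    intro i
    rw [Finset.mem_range]
    have := Simp_le he i
    omega
  refine (Finset.card_le_card this).trans ?_
  rw [Fintype.card_piFinset]
  simp only [Finset.card_range, Finset.prod_const, Finset.card_univ, Fintype.card_fin]
  rw [mul_comm, pow_mul]
  gcongr
  exact Nat.lt_two_pow_self

theorem sum_Simp (r : ℕ) (i k : Fin n) : ∑ e ∈ Simp n r, e i = ∑ e ∈ Simp n r, e k := by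
  apply Finset.sum_bij' (fun e _ => e ∘ Equiv.swap i k) (fun e _ => e ∘ Equiv.swap i k)
  · intro e he
    rw [mem_Simp] at he ⊢
    rw [← he]
    exact Equiv.sum_comp (Equiv.swap i k) e
  · intro e he
    rw [mem_Simp] at he ⊢
    rw [← he]
    exact Equiv.sum_comp (Equiv.swap i k) e
  · intro e _
    ext x
    simp
  · intro e _
    ext x
    simp
  · intro e _
    simp

theorem mean_Simp (r : ℕ) (hr : 0 < r) (i : Fin n) :
    ∑ e ∈ Simp n r, ((e i : ℝ) / r - 1 / n) = 0 := by
  have hn : (0 : ℝ) < n := by exact_mod_cast i.pos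
  have h1 : ∑ k : Fin n, ∑ e ∈ Simp n r, e k = r * (Simp n r).card := by
    rw [Finset.sum_comm]
    rw [Finset.sum_congr rfl (fun e he => mem_Simp.1 he)]
    simp [mul_comm]
  rw [Finset.sum_congr rfl (fun k _ => sum_Simp r k i)] at h1
  simp only [Finset.sum_const, Finset.card_univ, Fintype.card_fin, smul_eq_mul] at h1
  have h2 : (n : ℝ) * ∑ e ∈ Simp n r, (e i : ℝ) = r * (Simp n r).card := by exact_mod_cast h1
  have hr' : (0 : ℝ) < r := by exact_mod_cast hr
  rw [Finset.sum_sub_distrib, ← Finset.sum_div, Finset.sum_const, nsmul_eq_mul]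
  field_simp
  linarith

/-- exponents of multidegree `r` -/
def MS (n : ℕ) {m : ℕ} (r : Fin m → ℕ) : Finset (Fin m → Fin n → ℕ) :=
  Fintype.piFinset fun j => Simp n (r j)

theorem mem_MS {m : ℕ} {r : Fin m → ℕ} {e : Fin m → Fin n → ℕ} :
    e ∈ MS n r ↔ ∀ j, ∑ i, e j i = r j := by
  simp [MS, mem_Simp]

theorem card_MS_le {m : ℕ} (r : Fin m → ℕ) : (MS n r).card ≤ 2 ^ (n * ∑ j, r j) := by
  rw [MS, Fintype.card_piFinset, Finset.mul_sum, ← Finset.prod_pow_eq_pow_sum]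
  exact Finset.prod_le_prod' fun j _ => card_Simp_le (r j)

theorem card_MS_pos {m : ℕ} (hn : 0 < n) (r : Fin m → ℕ) : 0 < (MS n r).card := by
  rw [Finset.card_pos]
  refine ⟨fun j => Pi.single ⟨0, hn⟩ (r j), ?_⟩
  rw [mem_MS]
  intro j
  simp

theorem card_bad {m : ℕ} (hm : 0 < m) (hn : 0 < n) (r : Fin m → ℕ) (hr : ∀ j, 0 < r j) (ε : ℝ)
    (hε : 0 < ε) :
    (((MS n r).filter (fun e => ∃ i, ∑ j, (e j i : ℝ) / r j < (1 / n - ε) * m)).card : ℝ) *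
      (ε ^ 2 * m) ≤ n * (MS n r).card := by
  have hn' : (1 : ℝ) ≤ n := by exact_mod_cast hn
  have h1 : ∀ i : Fin n, (((MS n r).filter
      (fun e => ∑ j, (e j i : ℝ) / r j < (1 / n - ε) * m)).card : ℝ) * (ε ^ 2 * m)
      ≤ (MS n r).card := by
    intro i
    have := cheb (fun j => Simp n (r j)) (fun j e => (e i : ℝ) / r j - 1 / n)
      (fun j => mean_Simp (r j) (hr j) i) ?_ ε hε hm
    · unfold MS
      convert this using 5
      rw [Finset.sum_sub_distrib]
      simp only [Finset.sum_const, Finset.card_univ, Fintype.card_fin, nsmul_eq_mul]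
      constructor <;> intro h <;> linarith
    · intro j e he
      have hr' : (0 : ℝ) < r j := by exact_mod_cast hr j
      have h2 : (e i : ℝ) ≤ r j := by exact_mod_cast Simp_le he i
      have h3 : (e i : ℝ) / r j ≤ 1 := by rw [div_le_one hr']; exact h2
      have h4 : 0 ≤ (e i : ℝ) / r j := by positivity
      have h5 : 1 / (n : ℝ) ≤ 1 := by rw [div_le_one] <;> linarith
      have h6 : 0 ≤ 1 / (n : ℝ) := by positivity
      rw [abs_le]
      constructor <;> linarith
  have h2 : (MS n r).filter (fun e => ∃ i, ∑ j, (e j i : ℝ) / r j < (1 / n - ε) * m) ⊆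
      Finset.univ.biUnion fun i => (MS n r).filter
      (fun e => ∑ j, (e j i : ℝ) / r j < (1 / n - ε) * m) := by
    intro e he
    obtain ⟨h, i, hi⟩ := Finset.mem_filter.1 he
    exact Finset.mem_biUnion.2 ⟨i, Finset.mem_univ _, Finset.mem_filter.2 ⟨h, hi⟩⟩
  have h3 := (Finset.card_le_card h2).trans Finset.card_biUnion_le
  have h4 : ((((MS n r).filter
      (fun e => ∃ i, ∑ j, (e j i : ℝ) / r j < (1 / n - ε) * m)).card : ℕ) : ℝ) ≤ ∑ i, (((MS n r).filter
      (fun e => ∑ j, (e j i : ℝ) / r j < (1 / n - ε) * m)).card : ℝ) := by exact_mod_cast h3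
  have h5 : (0 : ℝ) ≤ ε ^ 2 * m := by positivity
  calc _ ≤ (∑ i, (((MS n r).filter
      (fun e => ∑ j, (e j i : ℝ) / r j < (1 / n - ε) * m)).card : ℝ)) * (ε ^ 2 * m) := by gcongr
    _ ≤ ∑ i : Fin n, ((MS n r).card : ℝ) := by
      rw [Finset.sum_mul]
      exact Finset.sum_le_sum fun i _ => h1 i
    _ = _ := by simp
end simplex
end ABT
end

section
namespace ABT
open MvPolynomial
set_option linter.unusedSectionVars false
set_option linter.unusedSimpArgs false

section sub
variable {n m : ℕ} {R : Type*} [CommRing R]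

/-- weights for multihomogeneity -/
def bw (n m : ℕ) : Fin m × Fin n → (Fin m → ℕ) := fun p => Pi.single p.1 1

theorem weight_bw (f : Fin m × Fin n →₀ ℕ) (j : Fin m) :
    Finsupp.weight (bw n m) f j = ∑ i, f (j, i) := by
  rw [Finsupp.weight_apply, Finsupp.sum_fintype _ _ (by simp), Finset.sum_apply,
    Fintype.sum_prod_type, Finset.sum_eq_single j]
  · simp [bw]
  · intro k _ hk
    simp [bw, hk]
  · simp

/-- multihomogeneous of degree `r` -/
def BH (r : Fin m → ℕ) (P : MvPolynomial (Fin m × Fin n) R) : Prop :=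
  ∀ f, coeff f P ≠ 0 → ∀ j, ∑ i, f (j, i) = r j

theorem BH_iff (r : Fin m → ℕ) (P : MvPolynomial (Fin m × Fin n) R) :
    BH r P ↔ IsWeightedHomogeneous (bw n m) P r := by
  unfold BH IsWeightedHomogeneous
  simp only [funext_iff, weight_bw]

/-- exponent as a finitely supported function -/
noncomputable def toF (e : Fin m → Fin n → ℕ) : Fin m × Fin n →₀ ℕ :=
  Finsupp.equivFunOnFinite.symm fun p => e p.1 p.2

@[simp] theorem toF_apply (e : Fin m → Fin n → ℕ) (p : Fin m × Fin n) : toF e p = e p.1 p.2 := rfl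

theorem toF_inj : Function.Injective (toF : (Fin m → Fin n → ℕ) → _) := by
  intro e f h
  ext j i
  exact DFunLike.congr_fun h (j, i)

theorem exists_toF (f : Fin m × Fin n →₀ ℕ) : ∃ e, f = toF e :=
  ⟨fun j i => f (j, i), by ext p; rfl⟩

/-- the blockwise linear substitution -/
noncomputable def lsub (b : Fin n → Fin n → R) :
    MvPolynomial (Fin m × Fin n) ℤ →ₐ[ℤ] MvPolynomial (Fin m × Fin n) R :=
  aeval fun p => ∑ l, C (b p.2 l) * X (p.1, l)

theorem lsub_monomial (b : Fin n → Fin n → R) (e : Fin m → Fin n → ℕ) (c : ℤ) :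
    lsub b (monomial (toF e) c) =
      C (c : R) * ∏ p : Fin m × Fin n, (∑ l, C (b p.2 l) * X (p.1, l)) ^ e p.1 p.2 := by
  rw [lsub, aeval_monomial, Finsupp.prod_fintype _ _ (by simp)]
  simp

theorem BH_lsub (b : Fin n → Fin n → R) (e : Fin m → Fin n → ℕ) (r : Fin m → ℕ) (he : e ∈ MS n r)
    (c : ℤ) : BH r (lsub b (monomial (toF e) c)) := by
  rw [BH_iff, lsub_monomial]
  apply IsWeightedHomogeneous.C_mul
  have : r = ∑ p : Fin m × Fin n, e p.1 p.2 • bw n m p := by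
    rw [mem_MS] at he
    ext j
    rw [← he j, Finset.sum_apply, Fintype.sum_prod_type, Finset.sum_eq_single j]
    · simp [bw]
    · intro k _ hk
      simp [bw, hk]
    · simp
  rw [this]
  apply IsWeightedHomogeneous.prod
  intro p _
  apply IsWeightedHomogeneous.pow
  apply IsWeightedHomogeneous.sum
  intro l _
  apply IsWeightedHomogeneous.C_mul
  exact isWeightedHomogeneous_X R (bw n m) (p.1, l)

theorem nrm_lsub (N : RingSeminorm R) (hN : N 1 ≤ 1) (b : Fin n → Fin n → R) (K : ℝ)
    (hb : ∀ i, ∑ l, N (b i l) ≤ K) (e : Fin m → Fin n → ℕ) (r : Fin m → ℕ)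
    (he : e ∈ MS n r) : nrm N (lsub b (monomial (toF e) 1)) ≤ K ^ (∑ j, r j) := by
  rw [lsub_monomial]
  simp only [Int.cast_one, C_1, one_mul]
  refine (nrm_prod N hN _ _).trans ?_
  have h1 : ∀ p : Fin m × Fin n, nrm N ((∑ l, C (b p.2 l) * X (p.1, l) :
      MvPolynomial (Fin m × Fin n) R) ^ e p.1 p.2) ≤ K ^ (e p.1 p.2) := by
    intro p
    refine (nrm_pow N hN _ _).trans ?_
    apply pow_le_pow_left₀ (nrm_nonneg _ _)
    refine ((nrm_sum N _ _).trans (Finset.sum_le_sum fun l _ => ?_)).trans (hb p.2)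
    refine (nrm_mul N _ _).trans ?_
    rw [nrm_C, nrm_X]
    exact mul_le_of_le_one_right (apply_nonneg _ _) hN
  refine (Finset.prod_le_prod (fun _ _ => nrm_nonneg _ _) fun p _ => h1 p).trans ?_
  rw [Finset.prod_pow_eq_pow_sum, Fintype.sum_prod_type]
  rw [mem_MS] at he
  simp only [he]
  exact le_rfl
end sub

section rep
attribute [local instance] Matrix.linftyOpNormedRing

/-- seminorm from an integral matrix representation -/
noncomputable def repN {R : Type*} [CommRing R] {d : ℕ} (ρ : R →+* Matrix (Fin d) (Fin d) ℤ) :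
    RingSeminorm R where
  toFun x := ‖ρ x‖
  map_zero' := by simp
  add_le' x y := by rw [map_add]; exact norm_add_le _ _
  neg' x := by rw [map_neg, norm_neg]
  mul_le' x y := by rw [map_mul]; exact norm_mul_le _ _

theorem repN_one {R : Type*} [CommRing R] {d : ℕ} (ρ : R →+* Matrix (Fin d) (Fin d) ℤ) :
    repN ρ 1 ≤ 1 := by
  change ‖ρ 1‖ ≤ 1
  rw [map_one]
  rcases isEmpty_or_nonempty (Fin d) with h | h
  · rw [Subsingleton.elim (1 : Matrix (Fin d) (Fin d) ℤ) 0]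
    simp
  · rw [norm_one]

theorem le_repN {R : Type*} [CommRing R] {d : ℕ} (ρ : R →+* Matrix (Fin d) (Fin d) ℤ) (x : R)
    (u v : Fin d) : |(ρ x u v : ℝ)| ≤ repN ρ x := by
  change _ ≤ ‖ρ x‖
  rw [Matrix.linfty_opNorm_def, ← Int.norm_eq_abs, ← coe_nnnorm, NNReal.coe_le_coe]
  refine le_trans ?_ (Finset.le_sup (Finset.mem_univ u))
  exact Finset.single_le_sum (f := fun j => ‖ρ x u j‖₊) (fun _ _ => zero_le) (Finset.mem_univ v)
end rep

theorem aux_core {n d : ℕ} (hn : 0 < n) {R : Type*} [CommRing R]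
    (ρ : R →+* Matrix (Fin d) (Fin d) ℤ) (hρ : Function.Injective ρ) (b : Fin n → Fin n → R)
    (ε : ℝ) (hε : 0 < ε) : ∃ m : ℕ, 0 < m ∧ ∃ K : ℝ, 1 ≤ K ∧ ∀ r : Fin m → ℕ, (∀ j, 0 < r j) →
      ∃ P : MvPolynomial (Fin m × Fin n) ℤ, P ≠ 0 ∧ BH r P ∧ nrm NZ P ≤ K ^ (∑ j, r j) ∧
        ∀ f, coeff f (lsub b P) ≠ 0 → (∀ j, ∑ i, f (j, i) = r j) ∧
          ∀ i, (1 / n - ε) * m ≤ ∑ j, (f (j, i) : ℝ) / r j := by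
  classical
  obtain ⟨m, hm⟩ := exists_nat_gt (2 * n * d ^ 2 / ε ^ 2 : ℝ)
  have hn' : (0 : ℝ) < n := by exact_mod_cast hn
  have hm0 : (0 : ℝ) < m := lt_of_le_of_lt (by positivity) hm
  have hm1 : 0 < m := by exact_mod_cast hm0
  have hm2 : (2 * n * d ^ 2 : ℝ) ≤ ε ^ 2 * m := by
    rw [div_lt_iff₀ (by positivity)] at hm
    linarith
  set N := repN ρ
  set K₀ : ℝ := 1 + ∑ i, ∑ l, N (b i l) with hK₀
  have hK₀1 : 1 ≤ K₀ := by
    have : 0 ≤ ∑ i, ∑ l, N (b i l) :=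
      Finset.sum_nonneg fun _ _ => Finset.sum_nonneg fun _ _ => apply_nonneg _ _
    linarith
  have hbK : ∀ i, ∑ l, N (b i l) ≤ K₀ := by
    intro i
    have := Finset.single_le_sum (f := fun i => ∑ l, N (b i l))
      (fun _ _ => Finset.sum_nonneg fun _ _ => apply_nonneg _ _) (Finset.mem_univ i)
    linarith
  refine ⟨m, hm1, 2 ^ n * 2 ^ n * K₀, ?_, ?_⟩
  · have : (1 : ℝ) ≤ 2 ^ n := one_le_pow₀ (by norm_num)
    have h2 : (1 : ℝ) ≤ 2 ^ n * 2 ^ n := by nlinarith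
    nlinarith
  intro r hr
  set Sb := (MS n r).filter (fun e => ∃ i, ∑ j, (e j i : ℝ) / r j < (1 / n - ε) * m) with hSb
  have hbad := card_bad hm1 hn r hr ε hε
  rw [← hSb] at hbad
  have hcard : 2 * (Sb.card * (d * d)) ≤ (MS n r).card := by
    have h1 : (Sb.card : ℝ) * (2 * n * d ^ 2) ≤ n * (MS n r).card :=
      (mul_le_mul_of_nonneg_left hm2 (Nat.cast_nonneg _)).trans hbad
    have h2 : (2 * (Sb.card * (d * d)) : ℝ) ≤ (MS n r).card := by
      apply le_of_mul_le_mul_left _ hn'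
      calc _ = (Sb.card : ℝ) * (2 * n * d ^ 2) := by ring
        _ ≤ _ := h1
    exact_mod_cast h2
  obtain ⟨t, ht0, ht, htn⟩ := siegel (α := Sb × Fin d × Fin d) (β := MS n r)
    (fun x e => ρ (coeff (toF x.1.1) (lsub b (monomial (toF e.1) 1))) x.2.1 x.2.2)
    (K₀ ^ (∑ j, r j)) (one_le_pow₀ hK₀1) (by
      intro x e
      refine (le_repN ρ _ _ _).trans ?_
      exact (coeff_le_nrm N _ _).trans (nrm_lsub N (repN_one ρ) b K₀ hbK e.1 r e.2))
    (by simpa using hcard) (by simpa using card_MS_pos hn r)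
  simp only [Fintype.card_coe] at htn
  set P : MvPolynomial (Fin m × Fin n) ℤ := ∑ e : MS n r, monomial (toF e.1) (t e) with hP
  have hcoefP : ∀ e : MS n r, coeff (toF e.1) P = t e := by
    intro e
    rw [hP, coeff_sum, Finset.sum_eq_single e]
    · simp
    · intro e' _ hne
      rw [coeff_monomial, if_neg]
      intro h
      exact hne (Subtype.ext (toF_inj h))
    · simp
  have hlsub : lsub b P = ∑ e : MS n r, t e • lsub b (monomial (toF e.1) 1) := by
    rw [hP, map_sum]
    apply Finset.sum_congr rfl
    intro e _
    rw [← map_smul, smul_monomial]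
    simp
  refine ⟨P, ?_, ?_, ?_, ?_⟩
  · obtain ⟨e, he⟩ := Function.ne_iff.1 ht0
    intro h
    rw [h] at hcoefP
    exact he (by rw [← hcoefP e]; simp)
  · rw [BH_iff, hP]
    apply IsWeightedHomogeneous.sum
    intro e _
    apply isWeightedHomogeneous_monomial
    ext j
    rw [weight_bw]
    exact mem_MS.1 e.2 j
  · refine (nrm_sum NZ _ _).trans ?_
    have h2 : ((MS n r).card : ℝ) ≤ (2 ^ n) ^ (∑ j, r j) := by
      rw [← pow_mul]
      exact_mod_cast card_MS_le r
    calc _ ≤ ∑ e : MS n r, ((MS n r).card : ℝ) * K₀ ^ (∑ j, r j) := by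
          apply Finset.sum_le_sum
          intro e _
          rw [nrm_monomial, NZ_apply]
          exact htn e
      _ = ((MS n r).card : ℝ) * (MS n r).card * K₀ ^ (∑ j, r j) := by
          simp [mul_assoc]
      _ ≤ (2 ^ n) ^ (∑ j, r j) * (2 ^ n) ^ (∑ j, r j) * K₀ ^ (∑ j, r j) := by gcongr
      _ = _ := by rw [mul_pow, mul_pow]
  · intro f hf
    have hfr : ∀ j, ∑ i, f (j, i) = r j := by
      rw [hlsub, coeff_sum] at hf
      obtain ⟨e, _, he⟩ := Finset.exists_ne_zero_of_sum_ne_zero hf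
      apply BH_lsub b e.1 r e.2 1 f
      intro h
      apply he
      rw [coeff_smul, h, smul_zero]
    refine ⟨hfr, ?_⟩
    by_contra hcon
    push Not at hcon
    obtain ⟨e, rfl⟩ := exists_toF f
    have heS : e ∈ Sb := by
      rw [hSb, Finset.mem_filter, mem_MS]
      exact ⟨hfr, hcon⟩
    apply hf
    apply hρ
    rw [map_zero]
    ext u v
    have := ht (⟨e, heS⟩, u, v)
    rw [hlsub, coeff_sum, map_sum, Matrix.sum_apply]
    simp only [Matrix.zero_apply]
    rw [← this]
    apply Finset.sum_congr rfl
    intro e' _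
    rw [coeff_smul, map_zsmul, Matrix.smul_apply, smul_eq_mul, mul_comm]

theorem auxPoly {n : ℕ} (hn : 0 < n) (B : Fin n → Fin n → ℝ) (hB : ∀ i l, IsIntegral ℤ (B i l))
    (ε : ℝ) (hε : 0 < ε) : ∃ m : ℕ, 0 < m ∧ ∃ K : ℝ, 1 ≤ K ∧ ∀ r : Fin m → ℕ, (∀ j, 0 < r j) →
      ∃ P : MvPolynomial (Fin m × Fin n) ℤ, P ≠ 0 ∧ BH r P ∧ nrm NZ P ≤ K ^ (∑ j, r j) ∧
        ∀ f, coeff f (lsub B P) ≠ 0 → (∀ j, ∑ i, f (j, i) = r j) ∧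
          ∀ i, (1 / n - ε) * m ≤ ∑ j, (f (j, i) : ℝ) / r j := by
  classical
  set s : Set ℝ := Set.range fun p : Fin n × Fin n => B p.1 p.2
  set O : Subalgebra ℤ ℝ := Algebra.adjoin ℤ s
  have hfin : Module.Finite ℤ O := by
    have : (Subalgebra.toSubmodule O).FG := fg_adjoin_of_finite (Set.finite_range _) (by
      rintro x ⟨p, rfl⟩
      exact hB _ _)
    exact Module.Finite.iff_fg.2 this
  have htf : Module.Free ℤ O := inferInstance
  let bas := Module.finBasis ℤ O
  let ρ := (Algebra.leftMulMatrix bas).toRingHom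
  have hρ : Function.Injective ρ := Algebra.leftMulMatrix_injective bas
  let b : Fin n → Fin n → O := fun i l => ⟨B i l, Algebra.subset_adjoin ⟨(i, l), rfl⟩⟩
  obtain ⟨m, hm, K, hK, h⟩ := aux_core hn ρ hρ b ε hε
  refine ⟨m, hm, K, hK, fun r hr => ?_⟩
  obtain ⟨P, hP0, hPr, hPn, hPf⟩ := h r hr
  refine ⟨P, hP0, hPr, hPn, fun f hf => hPf f fun h0 => hf ?_⟩
  have : lsub B P = MvPolynomial.map (algebraMap O ℝ) (lsub b P) := by
    have h1 : (lsub B : MvPolynomial (Fin m × Fin n) ℤ →ₐ[ℤ] _).toRingHom =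
        (MvPolynomial.map (algebraMap O ℝ)).comp (lsub b).toRingHom := by
      apply MvPolynomial.ringHom_ext
      · intro c
        simp [lsub]
      · intro p
        simp [lsub, b]
    exact RingHom.congr_fun h1 P
  rw [this, coeff_map, h0, map_zero]
end ABT
end

section
namespace ABT
open MvPolynomial
set_option linter.unusedSectionVars false
set_option linter.unusedSimpArgs false

section gen
variable {σ τ R S : Type*} [Fintype σ] [Fintype τ] [CommRing R] [CommRing S]

theorem idx_X (ρ : σ → ℝ) (s : σ) : IdxGE ρ (ρ s) (X s : MvPolynomial σ R) := by
  classical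
  intro J hJ
  rw [coeff_X] at hJ
  have : J = Finsupp.single s 1 := by
    by_contra h
    exact hJ (if_neg fun h' => h h'.symm)
  rw [this, wt, Finset.sum_eq_single s]
  · simp
  · intro b _ hb
    simp [Finsupp.single_apply, Ne.symm hb]
  · simp

theorem idx_C (ρ : σ → ℝ) (c : R) : IdxGE ρ 0 (C c : MvPolynomial σ R) := by
  classical
  intro J hJ
  rw [coeff_C] at hJ
  have : J = 0 := by
    by_contra h
    exact hJ (if_neg fun h' => h h'.symm)
  simp [this, wt]

theorem idx_pow {ρ : σ → ℝ} {θ : ℝ} {P : MvPolynomial σ R} (h : IdxGE ρ θ P) (k : ℕ) :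
    IdxGE ρ (k * θ) (P ^ k) := by
  have := IdxGE.prod (Finset.range k) (fun _ => P) (fun _ => θ) (fun _ _ => h)
  simpa using this

theorem idx_sub {ρ : σ → ℝ} {θ : ℝ} {P Q : MvPolynomial σ R} (h : IdxGE ρ θ P) (h' : IdxGE ρ θ Q) :
    IdxGE ρ θ (P - Q) := by
  rw [sub_eq_add_neg]
  exact h.add h'.neg

theorem idx_C_mul {ρ : σ → ℝ} {θ : ℝ} {P : MvPolynomial σ R} (c : R) (h : IdxGE ρ θ P) :
    IdxGE ρ θ (C c * P) := by
  have := (idx_C ρ c).mul h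
  rwa [zero_add] at this

theorem idx_prod_pow {ρ : σ → ℝ} {ρ' : τ → ℝ} (Z : τ → MvPolynomial σ R)
    (hZ : ∀ s, IdxGE ρ (ρ' s) (Z s)) (f : τ →₀ ℕ) : IdxGE ρ (wt ρ' f) (∏ s, Z s ^ f s) :=
  IdxGE.prod _ _ _ fun s _ => idx_pow (hZ s) (f s)

theorem idx_aeval {ρ : σ → ℝ} {ρ' : τ → ℝ} {θ : ℝ} (Z : τ → MvPolynomial σ R)
    (hZ : ∀ s, IdxGE ρ (ρ' s) (Z s)) (P : MvPolynomial τ R) (hP : IdxGE ρ' θ P) :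
    IdxGE ρ θ (aeval Z P) := by
  rw [aeval_def, eval₂_eq']
  apply IdxGE.sum
  intro f hf
  rw [algebraMap_eq]
  exact idx_C_mul _ ((idx_prod_pow Z hZ f).mono (hP f (mem_support_iff.1 hf)))

theorem nrm_eval (N : RingSeminorm R) (N' : RingSeminorm S) (hN' : N' 1 ≤ 1)
    (φ : R →+* MvPolynomial σ S) (hφ : ∀ c, nrm N' (φ c) ≤ N c) (Z : τ → MvPolynomial σ S)
    (P : MvPolynomial τ R) (B : τ → ℝ) (hB : ∀ s, nrm N' (Z s) ≤ B s) (M : ℝ)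
    (hM : ∀ f, coeff f P ≠ 0 → ∏ s, B s ^ f s ≤ M) :
    nrm N' (eval₂ φ Z P) ≤ nrm N P * M := by
  rw [eval₂_eq']
  refine (nrm_sum N' _ _).trans ?_
  rw [nrm, Finset.sum_mul]
  apply Finset.sum_le_sum
  intro f hf
  refine (nrm_mul N' _ _).trans ?_
  refine mul_le_mul (hφ _) ?_ (nrm_nonneg _ _) (apply_nonneg _ _)
  refine le_trans ?_ (hM f (mem_support_iff.1 hf))
  refine (nrm_prod N' hN' _ _).trans ?_
  apply Finset.prod_le_prod (fun _ _ => nrm_nonneg _ _)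
  intro s _
  refine (nrm_pow N' hN' _ _).trans ?_
  exact pow_le_pow_left₀ (nrm_nonneg _ _) (hB s) _

theorem coeff_scale (s : σ → R) (F : MvPolynomial σ R) (g : σ →₀ ℕ) :
    coeff g (aeval (fun p => C (s p) * X p) F) = coeff g F * ∏ p, s p ^ g p := by
  classical
  induction F using MvPolynomial.induction_on' with
  | monomial u c =>
    rw [aeval_monomial, Finsupp.prod_fintype _ _ (by simp)]
    simp only [mul_pow, Finset.prod_mul_distrib]
    have h1 : ∏ x, (X x : MvPolynomial σ R) ^ u x = monomial u 1 := by
      rw [monomial_eq, Finsupp.prod_fintype _ _ (by simp)]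
      simp
    rw [h1, algebraMap_eq]
    simp only [← C_pow, ← map_prod]
    rw [C_mul_monomial, C_mul_monomial, coeff_monomial, coeff_monomial]
    split_ifs with h
    · rw [h]; ring
    · simp
  | add p q hp hq => rw [map_add, coeff_add, coeff_add, hp, hq, add_mul]
end gen

section alg
variable {n m : ℕ}

/-- the substitution moving to the hyperplane -/
noncomputable def psi (a : Fin m → Fin n) (κ : Fin m → Fin n → ℚ) :
    MvPolynomial (Fin m × Fin n) ℚ →ₐ[ℚ] MvPolynomial (Fin m × Fin n) ℚ :=
  aeval fun p => if p.2 = a p.1 then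
    X p - ∑ i ∈ Finset.univ.erase (a p.1), C (κ p.1 i) * X (p.1, i) else X p

theorem alg_core (P : MvPolynomial (Fin m × Fin n) ℤ) (hP : P ≠ 0) (r : Fin m → ℕ)
    (hPr : BH r P) (a b : Fin m → Fin n) (hab : ∀ j, a j ≠ b j)
    (κ : Fin m → Fin n → ℚ) (θ : ℝ)
    (hidx : IdxGE (fun p : Fin m × Fin n => if p.2 = a p.1 then 1 / (r p.1 : ℝ) else 0) θ
      (psi a κ (MvPolynomial.map (Int.castRingHom ℚ) P))) :
    ∃ p : MvPolynomial (Fin m) ℤ, p ≠ 0 ∧ (∀ j, degreeOf j p ≤ r j) ∧ nrm NZ p ≤ nrm NZ P ∧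
      IdxGE (fun j => 1 / (r j : ℝ)) θ
        (shift (fun j => - κ j (b j)) (MvPolynomial.map (Int.castRingHom ℚ) p)) := by
  classical
  set ρ : Fin m × Fin n → ℝ := fun p => if p.2 = a p.1 then 1 / (r p.1 : ℝ) else 0 with hρ
  set g : Fin m × Fin n → ℝ := fun p => if p.2 = a p.1 ∨ p.2 = b p.1 then 0 else 1 with hg
  let ot : (Fin m × Fin n →₀ ℕ) → Fin m × Fin n → ℕ := fun f p =>
    if p.2 = a p.1 ∨ p.2 = b p.1 then 0 else f p
  have hot : ∀ f f', ot f = ot f' → wt g f = wt g f' := by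
    intro f f' h
    unfold wt
    apply Finset.sum_congr rfl
    intro p _
    have := congrFun h p
    simp only [ot] at this
    simp only [hg]
    split_ifs with h1
    · simp
    · rw [if_neg h1, if_neg h1] at this
      rw [this]
  obtain ⟨f0, hf0, hmin⟩ := Finset.exists_min_image P.support (wt g)
    (Finset.nonempty_of_ne_empty (by simpa using hP))
  set T := P.support.filter (fun f => ot f = ot f0) with hT
  let Jf : (Fin m × Fin n →₀ ℕ) → (Fin m →₀ ℕ) := fun f =>
    Finsupp.equivFunOnFinite.symm fun j => f (j, a j)
  have hJinj : ∀ f ∈ T, ∀ f' ∈ T, Jf f = Jf f' → f = f' := by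
    intro f hf f' hf' h
    rw [hT, Finset.mem_filter, mem_support_iff] at hf hf'
    have h1 : ∀ j, f (j, a j) = f' (j, a j) := fun j => DFunLike.congr_fun h j
    have h2 : ∀ j i, i ≠ a j → i ≠ b j → f (j, i) = f' (j, i) := by
      intro j i hi hi'
      have := congrFun (hf.2.trans hf'.2.symm) (j, i)
      simpa [ot, hi, hi'] using this
    have h3 : ∀ j, f (j, b j) = f' (j, b j) := by
      intro j
      have e1 := hPr f hf.1 j
      have e2 := hPr f' hf'.1 j
      rw [← Finset.add_sum_erase _ _ (Finset.mem_univ (b j))] at e1 e2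
      have e3 : ∑ i ∈ Finset.univ.erase (b j), f (j, i) =
          ∑ i ∈ Finset.univ.erase (b j), f' (j, i) := by
        apply Finset.sum_congr rfl
        intro i hi
        by_cases hia : i = a j
        · rw [hia, h1]
        · exact h2 j i hia (Finset.ne_of_mem_erase hi)
      omega
    ext ⟨j, i⟩
    by_cases hia : i = a j
    · rw [hia, h1]
    · by_cases hib : i = b j
      · rw [hib, h3]
      · exact h2 j i hia hib
  set p : MvPolynomial (Fin m) ℤ := ∑ f ∈ T, monomial (Jf f) (coeff f P) with hp
  have hpT : ∀ J, coeff J p ≠ 0 → ∃ f ∈ T, J = Jf f := by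
    intro J hJ
    rw [hp, coeff_sum] at hJ
    obtain ⟨f, hf, h⟩ := Finset.exists_ne_zero_of_sum_ne_zero hJ
    refine ⟨f, hf, ?_⟩
    by_contra h'
    rw [coeff_monomial, if_neg (Ne.symm h')] at h
    exact h rfl
  refine ⟨p, ?_, ?_, ?_, ?_⟩
  · intro h0
    have hf0T : f0 ∈ T := by rw [hT, Finset.mem_filter]; exact ⟨hf0, rfl⟩
    have : coeff (Jf f0) p = coeff f0 P := by
      rw [hp, coeff_sum, Finset.sum_eq_single f0]
      · simp
      · intro f hf hne
        rw [coeff_monomial, if_neg]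
        intro h
        exact hne (hJinj f hf f0 hf0T h)
      · intro h; exact absurd hf0T h
    rw [h0] at this
    exact mem_support_iff.1 hf0 (by rw [← this]; simp)
  · intro j
    rw [degreeOf_le_iff]
    intro J hJ
    obtain ⟨f, hf, rfl⟩ := hpT J (mem_support_iff.1 hJ)
    rw [hT, Finset.mem_filter, mem_support_iff] at hf
    rw [← hPr f hf.1 j]
    exact Finset.single_le_sum (f := fun i => f (j, i)) (fun _ _ => Nat.zero_le _)
      (Finset.mem_univ (a j))
  · refine (nrm_sum NZ _ _).trans ?_
    simp only [nrm_monomial]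
    exact Finset.sum_le_sum_of_subset_of_nonneg (Finset.filter_subset _ _)
      fun _ _ _ => apply_nonneg _ _
  · let Z : Fin m × Fin n → MvPolynomial (Fin m × Fin n) ℚ := fun p => if p.2 = a p.1 then
      X p - ∑ i ∈ Finset.univ.erase (a p.1), C (κ p.1 i) * X (p.1, i) else X p
    let Z0 : Fin m × Fin n → MvPolynomial (Fin m × Fin n) ℚ := fun p => if p.2 = a p.1 then
      X p - C (κ p.1 (b p.1)) * X (p.1, b p.1) else X p
    have hg0 : ∀ s, 0 ≤ g s := by
      intro s; simp only [hg]; split_ifs <;> norm_num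
    have hXg : ∀ s, IdxGE g 0 (X s : MvPolynomial (Fin m × Fin n) ℚ) := fun s =>
      (idx_X g s).mono (hg0 s)
    have hZ : ∀ s, IdxGE g (g s) (Z s) := by
      intro s
      simp only [Z]
      split_ifs with h
      · have : g s = 0 := by simp [hg, h]
        rw [this]
        exact idx_sub (hXg s) (IdxGE.sum _ _ fun i _ => idx_C_mul _ (hXg _))
      · exact idx_X g s
    have hZ0 : ∀ s, IdxGE g (g s) (Z0 s) := by
      intro s
      simp only [Z0]
      split_ifs with h
      · have : g s = 0 := by simp [hg, h]
        rw [this]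
        exact idx_sub (hXg s) (idx_C_mul _ (hXg _))
      · exact idx_X g s
    have hZZ0 : ∀ s, IdxGE g (g s + 1) (Z s - Z0 s) := by
      intro s
      simp only [Z, Z0]
      split_ifs with h
      · have : g s = 0 := by simp [hg, h]
        rw [this, zero_add]
        have hb : b s.1 ∈ Finset.univ.erase (a s.1) := by simp [(hab s.1).symm]
        rw [← Finset.add_sum_erase _ _ hb]
        have : ∀ u v w : MvPolynomial (Fin m × Fin n) ℚ, u - (v + w) - (u - v) = - w := by
          intros; ring
        rw [this]
        apply IdxGE.neg
        apply IdxGE.sum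
        intro i hi
        simp only [Finset.mem_erase, Finset.mem_univ, and_true] at hi
        have h1 : g (s.1, i) = 1 := by simp [hg, hi.1, hi.2]
        have := idx_X (R := ℚ) g (s.1, i)
        rw [h1] at this
        exact idx_C_mul _ this
      · rw [sub_self]; exact IdxGE.zero
    have hpow : ∀ (s) (k : ℕ), IdxGE g (k * g s + 1) (Z s ^ k - Z0 s ^ k) := by
      intro s k
      induction k with
      | zero => simp only [pow_zero, sub_self]; exact IdxGE.zero
      | succ k ih =>
        have : Z s ^ (k+1) - Z0 s ^ (k+1) = (Z s ^ k - Z0 s ^ k) * Z s + Z0 s ^ k * (Z s - Z0 s) := by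
          ring
        rw [this]
        refine IdxGE.add ((ih.mul (hZ s)).mono ?_) (((idx_pow (hZ0 s) k).mul (hZZ0 s)).mono ?_) <;>
        · push_cast; linarith
    have hprod : ∀ (f : Fin m × Fin n →₀ ℕ) (s : Finset (Fin m × Fin n)),
        IdxGE g (∑ p ∈ s, f p * g p + 1) (∏ p ∈ s, Z p ^ f p - ∏ p ∈ s, Z0 p ^ f p) := by
      intro f s
      induction s using Finset.induction_on with
      | empty => simp only [Finset.prod_empty, sub_self]; exact IdxGE.zero
      | insert q s hq ih =>
        rw [Finset.prod_insert hq, Finset.prod_insert hq, Finset.sum_insert hq]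
        have : ∀ u v w x : MvPolynomial (Fin m × Fin n) ℚ, u * v - w * x = (u - w) * v + w * (v - x) := by
          intros; ring
        rw [this]
        have h1 : IdxGE g (∑ p ∈ s, f p * g p) (∏ p ∈ s, Z p ^ f p) :=
          IdxGE.prod _ _ _ fun p _ => idx_pow (hZ p) _
        refine IdxGE.add (((hpow q (f q)).mul h1).mono ?_) (((idx_pow (hZ0 q) (f q)).mul ih).mono ?_) <;>
        · linarith
    have hZ0ot : ∀ f f', coeff f' (∏ p, Z0 p ^ f p) ≠ 0 → ot f' = ot f := by
      intro f f' h
      ext q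
      simp only [ot]
      split_ifs with hq
      · rfl
      push Not at hq
      have hsg : ∀ c : ℝ, c * f q ≤ c * f' q := by
        intro c
        have hs : ∀ (e : Fin m × Fin n →₀ ℕ), wt (fun s => if s = q then c else 0) e = c * e q := by
          intro e
          simp [wt, mul_comm]
        rw [← hs, ← hs]
        refine idx_prod_pow Z0 ?_ f f' h
        intro s
        have e1 := idx_X (R := ℚ) (fun s => if s = q then c else 0) s
        have e2 := idx_X (R := ℚ) (fun s => if s = q then c else 0) (s.1, b s.1)
        simp only [Z0]
        by_cases h1 : s.2 = a s.1
        · rw [if_pos h1]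
          have h2 : s ≠ q := by intro h2; rw [h2] at h1; exact hq.1 h1
          have h3 : (s.1, b s.1) ≠ q := by intro h3; apply hq.2; rw [← h3]
          rw [if_neg h2] at e1 ⊢
          rw [if_neg h3] at e2
          exact idx_sub e1 (idx_C_mul _ e2)
        · rw [if_neg h1]
          exact e1
      have e1 := hsg 1
      have e2 := hsg (-1)
      have : (f' q : ℝ) = f q := by linarith
      exact_mod_cast this
    have hcoef : ∀ f', ot f' = ot f0 → coeff f' (psi a κ (MvPolynomial.map (Int.castRingHom ℚ) P)) =
        ∑ f ∈ T, ((coeff f P : ℤ) : ℚ) * coeff f' (∏ p, Z0 p ^ f p) := by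
      intro f' hf'
      have h1 : psi a κ (MvPolynomial.map (Int.castRingHom ℚ) P) =
          ∑ f ∈ P.support, C ((coeff f P : ℤ) : ℚ) * ∏ p, Z p ^ f p := by
        rw [psi, aeval_def, eval₂_map, eval₂_eq']
        rfl
      rw [h1, coeff_sum]
      rw [hT, Finset.sum_filter]
      apply Finset.sum_congr rfl
      intro f hf
      rw [coeff_C_mul]
      have h2 : coeff f' (∏ p, Z p ^ f p) = coeff f' (∏ p, Z0 p ^ f p) := by
        by_contra hne
        have := hprod f Finset.univ f' (by rw [coeff_sub]; exact sub_ne_zero.2 hne)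
        have h3 := hmin f hf
        rw [← hot f' f0 hf'] at h3
        have h4 : wt g f + 1 ≤ wt g f' := this
        linarith
      rw [h2]
      split_ifs with h3
      · rfl
      · by_cases h4 : coeff f' (∏ p, Z0 p ^ f p) = 0
        · rw [h4, mul_zero]
        · exact absurd ((hZ0ot f f' h4).symm.trans hf') h3
    set W : MvPolynomial (Fin m × Fin n) ℚ :=
      ∑ f ∈ T, C ((coeff f P : ℤ) : ℚ) * ∏ p, Z0 p ^ f p with hW
    have hWidx : IdxGE ρ θ W := by
      intro f' hf'
      have h1 : ot f' = ot f0 := by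
        rw [hW, coeff_sum] at hf'
        obtain ⟨f, hf, h⟩ := Finset.exists_ne_zero_of_sum_ne_zero hf'
        rw [coeff_C_mul] at h
        rw [hZ0ot f f' (right_ne_zero_of_mul h)]
        exact (Finset.mem_filter.1 hf).2
      apply hidx f'
      rw [hcoef f' h1]
      rw [hW, coeff_sum] at hf'
      simpa only [coeff_C_mul] using hf'
    have hev := idx_aeval (R := ℚ) (ρ := fun j => 1 / (r j : ℝ)) (ρ' := ρ)
      (fun p : Fin m × Fin n => if p.2 = a p.1 then (X p.1 : MvPolynomial (Fin m) ℚ) else 1) (by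
        intro s
        simp only [hρ]
        split_ifs with h
        · exact idx_X (fun j => 1 / (r j : ℝ)) s.1
        · have := idx_C (R := ℚ) (fun j : Fin m => 1 / (r j : ℝ)) 1
          rwa [C_1] at this) W hWidx
    convert hev using 1
    rw [hW, hp, map_sum, map_sum, map_sum]
    apply Finset.sum_congr rfl
    intro f _
    rw [map_monomial, shift, aeval_monomial, Finsupp.prod_fintype _ _ (by simp), map_mul,
      map_prod, algebraMap_eq]
    congr 1
    · rw [aeval_C]; rfl
    · rw [Fintype.prod_prod_type]
      apply Finset.prod_congr rfl
      intro j _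
      rw [Finset.prod_eq_single (a j)]
      · have h1 : b j ≠ a j := (hab j).symm
        have h2 : (Jf f) j = f (j, a j) := rfl
        simp only [Z0, if_true, map_pow, map_sub, map_mul, aeval_X, aeval_C, if_neg h1, algebraMap_eq,
          mul_one, map_neg]
        rw [h2, ← sub_eq_add_neg]
      · intro i _ hi
        simp [Z0, hi]
      · simp
end alg
end ABT
end

section
namespace ABT
open MvPolynomial
set_option linter.unusedSectionVars false
set_option linter.unusedSimpArgs false

/-- absolute value on the reals -/
noncomputable def NR : RingSeminorm ℝ := normRingSeminorm ℝ

theorem NR_apply (x : ℝ) : NR x = |x| := rfl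

theorem NR_one : NR 1 ≤ 1 := by rw [NR_apply]; simp

section
variable {n m : ℕ} {ι : Type*} [Fintype ι]

/-- restriction of `P` to parameters -/
noncomputable def FF (a : Fin m → Fin n) (x : Fin m → ι → Fin n → ℤ)
    (P : MvPolynomial (Fin m × Fin n) ℤ) : MvPolynomial (Fin m × Option ι) ℤ :=
  aeval (fun p => ∑ l, C (x p.1 l p.2) * X (p.1, some l) +
    if p.2 = a p.1 then X (p.1, none) else 0) P

/-- the linear forms in the parameters -/
noncomputable def YY (A : Matrix (Fin n) (Fin n) ℝ) (a : Fin m → Fin n)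
    (x : Fin m → ι → Fin n → ℤ) (p : Fin m × Fin n) : MvPolynomial (Fin m × Option ι) ℝ :=
  ∑ l, C (∑ k, A p.2 k * x p.1 l k) * X (p.1, some l) + C (A p.2 (a p.1)) * X (p.1, none)

theorem FF_eq (A B : Matrix (Fin n) (Fin n) ℝ) (hBA : B * A = 1) (a : Fin m → Fin n)
    (x : Fin m → ι → Fin n → ℤ) (P : MvPolynomial (Fin m × Fin n) ℤ) :
    MvPolynomial.map (Int.castRingHom ℝ) (FF a x P) = aeval (YY A a x) (lsub B P) := by
  have h1 : (MvPolynomial.map (Int.castRingHom ℝ)).comp (aeval (fun p : Fin m × Fin n =>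
      ∑ l, C (x p.1 l p.2) * X (p.1, some l) +
      if p.2 = a p.1 then X (p.1, none) else 0) : MvPolynomial (Fin m × Fin n) ℤ →ₐ[ℤ]
        MvPolynomial (Fin m × Option ι) ℤ).toRingHom =
      (aeval (YY A a x) : _ →ₐ[ℝ] MvPolynomial (Fin m × Option ι) ℝ).toRingHom.comp
        (lsub B : MvPolynomial (Fin m × Fin n) ℤ →ₐ[ℤ] _).toRingHom := by
    apply MvPolynomial.ringHom_ext
    · intro c
      simp [lsub]
    · intro p
      simp only [lsub, YY, RingHom.comp_apply, AlgHom.toRingHom_eq_coe, RingHom.coe_coe, aeval_X,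
        map_add, map_sum, map_mul, map_C, map_X, aeval_C, algebraMap_eq]
      have hBA' : ∀ i k, ∑ l, B i l * A l k = if i = k then 1 else 0 := by
        intro i k
        have := congrFun (congrFun hBA i) k
        rw [Matrix.mul_apply, Matrix.one_apply] at this
        exact this
      simp only [mul_add, Finset.sum_add_distrib, Finset.mul_sum]
      congr 1
      · rw [Finset.sum_comm]
        apply Finset.sum_congr rfl
        intro l _
        simp only [← mul_assoc, ← map_mul, ← map_sum]
        rw [← Finset.sum_mul, ← map_sum]
        congr 2
        simp only [← Finset.sum_mul, Finset.mul_sum, ← mul_assoc]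
        rw [Finset.sum_comm]
        simp only [← Finset.sum_mul, hBA']
        simp
      · simp only [← mul_assoc, ← map_mul]
        rw [← Finset.sum_mul, ← map_sum, hBA']
        split_ifs <;> simp
  exact RingHom.congr_fun h1 P

theorem coef_small (A B : Matrix (Fin n) (Fin n) ℝ) (hBA : B * A = 1) (a : Fin m → Fin n)
    (x : Fin m → ι → Fin n → ℤ) (P : MvPolynomial (Fin m × Fin n) ℤ) (r : Fin m → ℕ)
    (hPr : BH r P) (γ : Fin n → ℝ) (Γ : ℝ) (hΓ : ∀ i, - Γ ≤ γ i) (L : Fin m → ℝ)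
    (hL : ∀ j, 0 ≤ L j) (hx : ∀ j l i, |∑ k, A i k * x j l k| ≤ Real.exp (γ i * L j))
    (KB : ℝ) (hKB : ∀ i, ∑ l, |B i l| ≤ KB) (Ct : ℝ) (hCt : ∀ i k, Fintype.card ι + |A i k| ≤ Ct)
    (M : ℝ) (hM : ∀ f, coeff f (lsub B P) ≠ 0 →
      ∏ p : Fin m × Fin n, (Ct * Real.exp (γ p.2 * L p.1)) ^ f p ≤ M)
    (g : Fin m × Option ι →₀ ℕ) :
    |((coeff g (FF a x P) : ℤ) : ℝ)| * Real.exp (- (Γ * ∑ j, L j * g (j, none))) ≤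
      nrm NZ P * KB ^ (∑ j, r j) * M := by
  classical
  set s : Fin m × Option ι → ℝ := fun p => if p.2 = none then Real.exp (- (Γ * L p.1)) else 1 with hs
  have h1 := coeff_scale s (MvPolynomial.map (Int.castRingHom ℝ) (FF a x P)) g
  have h2 : ∏ p, s p ^ g p = Real.exp (- (Γ * ∑ j, L j * g (j, none))) := by
    rw [Fintype.prod_prod_type, Finset.mul_sum, ← Finset.sum_neg_distrib, Real.exp_sum]
    apply Finset.prod_congr rfl
    intro j _
    rw [Fintype.prod_option]
    simp only [hs, if_true, reduceCtorEq, if_false, one_pow, Finset.prod_const_one, mul_one]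
    rw [← Real.exp_nat_mul]
    congr 1
    ring
  rw [h2, coeff_map] at h1
  have h3 : aeval (fun p => C (s p) * X p) (MvPolynomial.map (Int.castRingHom ℝ) (FF a x P)) =
      aeval (fun q => aeval (fun p => C (s p) * X p) (YY A a x q)) (lsub B P) := by
    rw [FF_eq A B hBA]
    rw [← AlgHom.comp_apply, comp_aeval]
  rw [h3] at h1
  have h4 : |((coeff g (FF a x P) : ℤ) : ℝ)| * Real.exp (- (Γ * ∑ j, L j * g (j, none))) =
      NR ((Int.castRingHom ℝ) (coeff g (FF a x P)) * Real.exp (- (Γ * ∑ j, L j * g (j, none)))) := by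
    rw [NR_apply, abs_mul, Real.abs_exp]
    rfl
  rw [h4, ← h1]
  refine (coeff_le_nrm NR _ _).trans ?_
  have h5 : nrm NR (lsub B P) ≤ nrm NZ P * KB ^ (∑ j, r j) := by
    simp only [lsub]
    rw [aeval_def]
    refine nrm_eval NZ NR NR_one _ ?_ _ P (fun _ => KB) ?_ _ ?_
    · intro c
      have : (algebraMap ℤ (MvPolynomial (Fin m × Fin n) ℝ)) c = C (c : ℝ) := by simp
      rw [this, nrm_C, NR_apply, NZ_apply]
    · intro p
      refine ((nrm_sum NR _ _).trans (Finset.sum_le_sum fun l _ => ?_)).trans (hKB p.2)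
      refine (nrm_mul NR _ _).trans ?_
      rw [nrm_C, nrm_X, NR_apply]
      exact mul_le_of_le_one_right (abs_nonneg _) NR_one
    · intro f hf
      rw [Finset.prod_pow_eq_pow_sum, Fintype.sum_prod_type]
      simp only [hPr f hf]
      exact le_rfl
  have hM0 : 0 ≤ nrm NR (lsub B P) := nrm_nonneg _ _
  by_cases hz : lsub B P = 0
  · have hKB0 : P = 0 ∨ 0 ≤ KB ^ (∑ j, r j) := by
      by_cases hP : nrm NZ P ≤ 0
      · left
        ext f
        have := (coeff_le_nrm NZ P f).trans hP
        rw [NZ_apply] at this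
        have := abs_nonpos_iff.1 this
        rw [coeff_zero]
        exact_mod_cast this
      · right
        push Not at hP
        by_contra hneg
        push Not at hneg
        nlinarith
    by_cases hn : Nonempty (Fin n)
    · obtain ⟨i⟩ := hn
      rw [hz, map_zero, nrm_zero]
      by_cases hMn : 0 ≤ M
      · have : 0 ≤ KB := (Finset.sum_nonneg fun _ _ => abs_nonneg _).trans (hKB i)
        have := nrm_nonneg NZ P
        positivity
      · -- `P` vanishes, as `B` is invertible
        have h6 := FF_eq A B hBA a x P
        have h7 : P = 0 := by
          have : MvPolynomial.map (Int.castRingHom ℝ) P = aeval (fun p : Fin m × Fin n =>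
              ∑ k, C (A p.2 k) * X (p.1, k)) (lsub B P) := by
            have h8 : (MvPolynomial.map (Int.castRingHom ℝ) : MvPolynomial (Fin m × Fin n) ℤ →+* _) =
                (aeval (fun p : Fin m × Fin n => ∑ k, C (A p.2 k) * X (p.1, k)) :
                  _ →ₐ[ℝ] MvPolynomial (Fin m × Fin n) ℝ).toRingHom.comp
                (lsub B : MvPolynomial (Fin m × Fin n) ℤ →ₐ[ℤ] _).toRingHom := by
              apply MvPolynomial.ringHom_ext
              · intro c
                simp [lsub]
              · intro p
                simp only [lsub, RingHom.comp_apply, AlgHom.toRingHom_eq_coe, RingHom.coe_coe,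
                  aeval_X, map_sum, map_mul, map_X, aeval_C, algebraMap_eq, Finset.mul_sum]
                rw [Finset.sum_comm]
                have hBA' : ∀ i k, ∑ l, B i l * A l k = if i = k then 1 else 0 := by
                  intro i k
                  have := congrFun (congrFun hBA i) k
                  rw [Matrix.mul_apply, Matrix.one_apply] at this
                  exact this
                simp only [← mul_assoc, ← map_mul]
                simp only [← Finset.sum_mul, ← map_sum, hBA']
                simp
            exact RingHom.congr_fun h8 P
          rw [hz, map_zero] at this
          exact (map_injective _ (RingHom.injective_int _)) (by rw [this, map_zero])
        rw [h7, nrm_zero]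
        simp
    · have : IsEmpty (Fin m × Fin n) := by
        have : IsEmpty (Fin n) := not_nonempty_iff.1 hn
        infer_instance
      have hP0 : P = 0 := by
        rw [eq_C_of_isEmpty P] at hz ⊢
        simp only [lsub, algHom_C] at hz
        have : ((coeff 0 P : ℤ) : MvPolynomial (Fin m × Fin n) ℝ) = 0 := by simpa using hz
        rw [Int.cast_eq_zero.1 this, C_0]
      rw [hz, hP0, map_zero, nrm_zero, nrm_zero]
      simp
  obtain ⟨f1, hf1⟩ := ne_zero_iff.1 hz
  have hMpos : 0 ≤ M := by
    refine le_trans ?_ (hM f1 hf1)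
    apply Finset.prod_nonneg
    intro p _
    have h9 := hCt p.2 p.2
    have : 0 ≤ Ct := le_trans (by positivity) h9
    positivity
  refine le_trans ?_ (mul_le_mul_of_nonneg_right h5 hMpos)
  rw [aeval_def]
  refine nrm_eval NR NR NR_one _ ?_ _ _ (fun p => Ct * Real.exp (γ p.2 * L p.1)) ?_ M hM
  · intro c
    rw [algebraMap_eq, nrm_C]
  · intro p
    have e0 : aeval (fun p => C (s p) * X p) (YY A a x p) =
        (∑ l : ι, C (∑ k, A p.2 k * (x p.1 l k : ℝ)) *
        (C (s (p.1, some l)) * X (p.1, some l)) : MvPolynomial (Fin m × Option ι) ℝ) +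
        C (A p.2 (a p.1)) * (C (s (p.1, none)) * X (p.1, none)) := by
      simp [YY]
    rw [e0]
    refine (nrm_add NR _ _).trans ?_
    have e1 : nrm NR (∑ l : ι, C (∑ k, A p.2 k * (x p.1 l k : ℝ)) *
        (C (s (p.1, some l)) * X (p.1, some l)) : MvPolynomial (Fin m × Option ι) ℝ) ≤
        Fintype.card ι * Real.exp (γ p.2 * L p.1) := by
      refine (nrm_sum NR _ _).trans ?_
      calc _ ≤ ∑ l : ι, Real.exp (γ p.2 * L p.1) := by
            apply Finset.sum_le_sum
            intro l _
            have : s (p.1, some l) = 1 := by simp [hs]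
            rw [this, C_1, one_mul]
            refine (nrm_mul NR _ _).trans ?_
            rw [nrm_C, nrm_X, NR_apply]
            exact (mul_le_of_le_one_right (abs_nonneg _) NR_one).trans (hx _ _ _)
        _ = _ := by simp
    have e2 : nrm NR (C (A p.2 (a p.1)) * (C (s (p.1, none)) * X (p.1, none)) :
        MvPolynomial (Fin m × Option ι) ℝ) ≤ |A p.2 (a p.1)| * Real.exp (γ p.2 * L p.1) := by
      rw [← mul_assoc, ← map_mul]
      refine (nrm_mul NR _ _).trans ?_
      rw [nrm_C, nrm_X, NR_apply]
      refine (mul_le_of_le_one_right (abs_nonneg _) NR_one).trans ?_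
      rw [abs_mul]
      apply mul_le_mul_of_nonneg_left _ (abs_nonneg _)
      simp only [hs, if_true, Real.abs_exp]
      apply Real.exp_le_exp.2
      have := hΓ p.2
      have := hL p.1
      nlinarith
    have e3 := hCt p.2 (a p.1)
    have e4 := Real.exp_pos (γ p.2 * L p.1)
    nlinarith

theorem size_lemma (hn : 0 < n) (r : Fin m → ℕ) (hr : ∀ j, 0 < r j) (f : Fin m × Fin n →₀ ℕ)
    (hf : ∀ j, ∑ i, f (j, i) = r j) (ε : ℝ) (hε : 0 < ε) (hε1 : ε ≤ 1)
    (hf2 : ∀ i, (1 / n - ε) * m ≤ ∑ j, (f (j, i) : ℝ) / r j) (γ : Fin n → ℝ) (L : Fin m → ℝ)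
    (R : ℝ) (hR : 0 < R) (hL1 : ∀ j, R ≤ r j * L j) (hL2 : ∀ j, r j * L j ≤ (1 + ε) * R) :
    ∑ p : Fin m × Fin n, f p * (γ p.2 * L p.1) ≤
      R * m * ((∑ i, γ i) / n + 3 * n * ε * ∑ i, |γ i|) := by
  have hn' : (1 : ℝ) ≤ n := by exact_mod_cast hn
  have hm' : (0 : ℝ) ≤ m := Nat.cast_nonneg _
  have hr' : ∀ j, (0 : ℝ) < r j := fun j => by exact_mod_cast hr j
  set φ : Fin n → ℝ := fun i => ∑ j, (f (j, i) : ℝ) / r j with hφ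
  have hsum : ∑ i, φ i = m := by
    simp only [hφ]
    rw [Finset.sum_comm]
    have : ∀ j : Fin m, ∑ i, (f (j, i) : ℝ) / r j = 1 := by
      intro j
      rw [← Finset.sum_div, div_eq_one_iff_eq (hr' j).ne']
      exact_mod_cast hf j
    simp [this]
  have hup : ∀ i, φ i ≤ (1 / n + n * ε) * m := by
    intro i
    have h1 : ∑ k ∈ Finset.univ.erase i, ((1 / n - ε) * m : ℝ) ≤ ∑ k ∈ Finset.univ.erase i, φ k :=
      Finset.sum_le_sum fun k _ => hf2 k
    rw [Finset.sum_const, Finset.card_erase_of_mem (Finset.mem_univ i), Finset.card_univ,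
      Fintype.card_fin, nsmul_eq_mul, Nat.cast_sub hn, Nat.cast_one] at h1
    have h2 := Finset.add_sum_erase Finset.univ φ (Finset.mem_univ i)
    rw [hsum] at h2
    have h3 : ((n : ℝ) - 1) * ((1 / n - ε) * m) = m - 1 / n * m - n * ε * m + ε * m := by
      field_simp
      ring
    have : 0 ≤ ε * m := by positivity
    nlinarith
  have hψ : ∀ i, |∑ j, (f (j, i) : ℝ) * L j - R * m / n| ≤ R * m * (3 * n * ε) := by
    intro i
    have e0 : ∀ j, (f (j, i) : ℝ) * L j = (f (j, i) : ℝ) / r j * (r j * L j) := by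
      intro j
      have := (hr' j).ne'
      field_simp
    have e1 : φ i * R ≤ ∑ j, (f (j, i) : ℝ) * L j := by
      simp only [hφ, Finset.sum_mul]
      apply Finset.sum_le_sum
      intro j _
      rw [e0]
      exact mul_le_mul_of_nonneg_left (hL1 j) (div_nonneg (Nat.cast_nonneg _) (hr' j).le)
    have e2 : ∑ j, (f (j, i) : ℝ) * L j ≤ φ i * ((1 + ε) * R) := by
      simp only [hφ, Finset.sum_mul]
      apply Finset.sum_le_sum
      intro j _
      rw [e0]
      exact mul_le_mul_of_nonneg_left (hL2 j) (div_nonneg (Nat.cast_nonneg _) (hr' j).le)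
    have e3 : φ i * R ≥ (1 / n - ε) * m * R := mul_le_mul_of_nonneg_right (hf2 i) hR.le
    have e4 : φ i * ((1 + ε) * R) ≤ (1 / n + n * ε) * m * ((1 + ε) * R) :=
      mul_le_mul_of_nonneg_right (hup i) (by positivity)
    have hRm : 0 ≤ R * m := by positivity
    have e5 : 1 / (n : ℝ) ≤ 1 := by rw [div_le_one] <;> linarith
    have e6 : 0 ≤ 1 / (n : ℝ) := by positivity
    rw [abs_le]
    constructor
    · have : ε ≤ 3 * n * ε := by nlinarith
      have : R * m * ε ≤ R * m * (3 * n * ε) := mul_le_mul_of_nonneg_left this hRm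
      have : (1 / n - ε) * m * R = R * m / n - R * m * ε := by ring
      linarith
    · have h1 : (1 / n + n * ε) * m * ((1 + ε) * R) = R * m / n +
          R * m * (n * ε + 1 / n * ε + n * ε * ε) := by ring
      have h2 : n * ε + 1 / n * ε + n * ε * ε ≤ 3 * n * ε := by
        have : 1 / n * ε ≤ n * ε := by nlinarith
        have : n * ε * ε ≤ n * ε := by nlinarith [mul_pos (by linarith : (0:ℝ) < n) hε]
        linarith
      have := mul_le_mul_of_nonneg_left h2 hRm
      linarith
  calc ∑ p : Fin m × Fin n, f p * (γ p.2 * L p.1) = ∑ i, γ i * ∑ j, (f (j, i) : ℝ) * L j := by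
        rw [Fintype.sum_prod_type, Finset.sum_comm]
        apply Finset.sum_congr rfl
        intro i _
        rw [Finset.mul_sum]
        apply Finset.sum_congr rfl
        intro j _
        ring
    _ ≤ ∑ i, (γ i * (R * m / n) + |γ i| * (R * m * (3 * n * ε))) := by
        apply Finset.sum_le_sum
        intro i _
        have h1 : γ i * (∑ j, (f (j, i) : ℝ) * L j - R * m / n) ≤
            |γ i| * (R * m * (3 * n * ε)) := by
          refine (le_abs_self _).trans ?_
          rw [abs_mul]
          exact mul_le_mul_of_nonneg_left (hψ i) (abs_nonneg _)
        linarith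
    _ = _ := by
        rw [Finset.sum_add_distrib, ← Finset.sum_mul, ← Finset.sum_mul]
        ring
end
end ABT
end

section
namespace ABT
open MvPolynomial
set_option linter.unusedSectionVars false
set_option linter.unusedSimpArgs false

section
variable {n m : ℕ} {ι : Type*} [Fintype ι]

theorem idx_psi (P : MvPolynomial (Fin m × Fin n) ℤ) (r : Fin m → ℕ) (a : Fin m → Fin n)
    (x : Fin m → ι → Fin n → ℤ) (h : Fin m → Fin n → ℤ) (ha : ∀ j, h j (a j) ≠ 0)
    (hsp : ∀ j, ∀ v : Fin n → ℚ, ∑ i, (h j i : ℚ) * v i = 0 →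
      v ∈ Submodule.span ℚ (Set.range (fun l i => (x j l i : ℚ)))) (θ : ℝ)
    (hF : IdxGE (fun p : Fin m × Option ι => if p.2 = none then 1 / (r p.1 : ℝ) else 0) θ
      (FF a x P)) :
    IdxGE (fun p => if p.2 = a p.1 then 1 / (r p.1 : ℝ) else 0) θ
      (psi a (fun j i => (h j i : ℚ) / h j (a j)) (MvPolynomial.map (Int.castRingHom ℚ) P)) := by
  classical
  have hμ : ∀ j i, ∃ μ : ι → ℚ, i ≠ a j → ∀ k, ∑ l, μ l * (x j l k : ℚ) =
      (if k = i then 1 else 0) - (if k = a j then (h j i : ℚ) / h j (a j) else 0) := by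
    intro j i
    have hm := hsp j (fun k => (if k = i then 1 else 0) -
      (if k = a j then (h j i : ℚ) / h j (a j) else 0)) (by
        have : (h j (a j) : ℚ) ≠ 0 := by exact_mod_cast ha j
        simp only [mul_sub, Finset.sum_sub_distrib, mul_ite, mul_one, mul_zero,
          Finset.sum_ite_eq', Finset.mem_univ, if_true]
        field_simp
        ring)
    obtain ⟨μ, hμ⟩ := (Submodule.mem_span_range_iff_exists_fun ℚ).1 hm
    refine ⟨μ, fun _ k => ?_⟩
    have := congrFun hμ k
    simpa [Finset.sum_apply] using this
  choose μ hμ using hμ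
  set Z : Fin m × Option ι → MvPolynomial (Fin m × Fin n) ℚ := fun p =>
    match p.2 with
    | none => X (p.1, a p.1)
    | some l => ∑ i ∈ Finset.univ.erase (a p.1), C (μ p.1 i l) * X (p.1, i) with hZ
  have hcomp : psi a (fun j i => (h j i : ℚ) / h j (a j)) (MvPolynomial.map (Int.castRingHom ℚ) P) =
      aeval Z (MvPolynomial.map (Int.castRingHom ℚ) (FF a x P)) := by
    have h1 : (psi a (fun j i => (h j i : ℚ) / h j (a j))).toRingHom.comp
        (MvPolynomial.map (Int.castRingHom ℚ)) =
        (aeval Z : _ →ₐ[ℚ] MvPolynomial (Fin m × Fin n) ℚ).toRingHom.comp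
        ((MvPolynomial.map (Int.castRingHom ℚ)).comp (aeval (fun p : Fin m × Fin n =>
      ∑ l, C (x p.1 l p.2) * X (p.1, some l) +
      if p.2 = a p.1 then X (p.1, none) else 0) : MvPolynomial (Fin m × Fin n) ℤ →ₐ[ℤ]
        MvPolynomial (Fin m × Option ι) ℤ).toRingHom) := by
      apply MvPolynomial.ringHom_ext
      · intro c
        simp [psi]
      · rintro ⟨j, i⟩
        simp only [psi, RingHom.comp_apply, AlgHom.toRingHom_eq_coe, RingHom.coe_coe, aeval_X,
          map_add, map_sum, map_mul, map_C, map_X, aeval_C, algebraMap_eq, hZ]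
        have e1 : ∑ l, C ((Int.castRingHom ℚ) (x j l i)) *
            ∑ i' ∈ Finset.univ.erase (a j), C (μ j i' l) * X (j, i') =
            ∑ i' ∈ Finset.univ.erase (a j), (C ((if i = i' then 1 else 0) -
              (if i = a j then (h j i' : ℚ) / h j (a j) else 0)) * X (j, i') :
              MvPolynomial (Fin m × Fin n) ℚ) := by
          simp only [Finset.mul_sum]
          rw [Finset.sum_comm]
          apply Finset.sum_congr rfl
          intro i' hi'
          rw [← hμ j i' (Finset.ne_of_mem_erase hi') i, map_sum, Finset.sum_mul]
          apply Finset.sum_congr rfl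
          intro l _
          rw [← mul_assoc, ← map_mul]
          congr 2
          simp [mul_comm]
        rw [e1]
        by_cases hi : i = a j
        · simp only [hi, if_true, map_X]
          rw [sub_eq_add_neg, add_comm, ← Finset.sum_neg_distrib]
          congr 1
          · apply Finset.sum_congr rfl
            intro i' hi'
            rw [if_neg (Finset.ne_of_mem_erase hi').symm]
            simp
          · simp
        · simp only [hi, if_false, map_zero, sub_zero, add_zero]
          have : ∀ i', (C (if i = i' then (1:ℚ) else 0) * X (j, i') :
              MvPolynomial (Fin m × Fin n) ℚ) = if i = i' then X (j, i') else 0 := by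
            intro i'
            split_ifs <;> simp
          simp only [this]
          rw [Finset.sum_ite_eq, if_pos (Finset.mem_erase.2 ⟨hi, Finset.mem_univ _⟩)]
    exact RingHom.congr_fun h1 P
  rw [hcomp]
  refine idx_aeval Z ?_ _ ?_ (ρ' := fun p : Fin m × Option ι => if p.2 = none then 1 / (r p.1 : ℝ) else 0)
  · rintro ⟨j, _ | l⟩
    · simp only [hZ, if_true]
      have := idx_X (R := ℚ) (fun p : Fin m × Fin n => if p.2 = a p.1 then 1 / (r p.1 : ℝ) else 0)
        (j, a j)
      simpa using this
    · intro J _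
      simp only [reduceCtorEq, if_false]
      apply Finset.sum_nonneg
      intro p _
      dsimp only
      split_ifs <;> positivity
  · intro J hJ
    rw [coeff_map] at hJ
    apply hF J
    intro h0
    rw [h0] at hJ
    simp at hJ

/-- the bad data, with `L = log Q` -/
def Bad (ι : Type*) [Fintype ι] (A : Matrix (Fin n) (Fin n) ℝ) (γ : Fin n → ℝ) (c L : ℝ) : Prop :=
  ∃ (x : ι → Fin n → ℤ) (h : Fin n → ℤ) (a b : Fin n) (s q : ℤ),
    (∀ v : Fin n → ℚ, ∑ i, (h i : ℚ) * v i = 0 →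
      v ∈ Submodule.span ℚ (Set.range (fun l i => (x l i : ℚ)))) ∧
    (∀ l i, |∑ k, A i k * x l k| ≤ Real.exp (γ i * L)) ∧ a ≠ b ∧ h a ≠ 0 ∧ 0 < q ∧
    IsCoprime s q ∧ (h b : ℚ) / h a = s / q ∧ Real.exp (c * L) ≤ q

theorem exists_chain (p : ℝ → Prop) (hp : ∀ L0, ∃ L, L0 ≤ L ∧ p L) (Lmin lam : ℝ) (m : ℕ) :
    ∃ L : Fin m → ℝ, (∀ j, Lmin ≤ L j) ∧ (∀ j, p (L j)) ∧ ∀ i j, i < j → lam * L j ≤ L i := by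
  induction m with
  | zero => exact ⟨fun _ => 0, fun j => j.elim0, fun j => j.elim0, fun i => i.elim0⟩
  | succ m ih =>
    obtain ⟨L, h1, h2, h3⟩ := ih
    obtain ⟨L0, hL0, hp0⟩ := hp (max Lmin (∑ j, |lam * L j|))
    refine ⟨Fin.cons L0 L, ?_, ?_, ?_⟩
    · intro j
      refine Fin.cases ?_ (fun j => ?_) j
      · exact (le_max_left _ _).trans hL0
      · exact h1 j
    · intro j
      refine Fin.cases ?_ (fun j => ?_) j
      · exact hp0
      · exact h2 j
    · intro i j
      refine Fin.cases ?_ (fun j => ?_) j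
      · intro h; exact absurd h (Fin.not_lt_zero _)
      · refine Fin.cases ?_ (fun i => ?_) i
        · intro _
          simp only [Fin.cons_succ, Fin.cons_zero]
          refine le_trans ?_ ((le_max_right _ _).trans hL0)
          exact (le_abs_self _).trans (Finset.single_le_sum (f := fun j => |lam * L j|)
            (fun _ _ => abs_nonneg _) (Finset.mem_univ j))
        · intro h
          simp only [Fin.cons_succ]
          exact h3 i j (Fin.succ_lt_succ_iff.1 h)


set_option maxHeartbeats 2000000 in
theorem thmA_int (hn : 0 < n) (A B : Matrix (Fin n) (Fin n) ℝ) (hBA : B * A = 1)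
    (hB : ∀ i l, IsIntegral ℤ (B i l)) (γ : Fin n → ℝ) (hγ : ∑ i, γ i < 0) (c : ℝ) (hc : 0 < c) :
    ∃ L0, ∀ L, L0 ≤ L → ¬ Bad ι A γ c L := by
  by_contra hcon
  push Not at hcon
  have hn' : (0 : ℝ) < n := by exact_mod_cast hn
  set δ : ℝ := - ∑ i, γ i with hδ
  have hδ0 : 0 < δ := by linarith
  set G : ℝ := ∑ i, |γ i| with hG
  have hG0 : 0 ≤ G := Finset.sum_nonneg fun _ _ => abs_nonneg _
  set ε : ℝ := min 1 (δ / (12 * n * n * (G + 1))) with hε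
  have hε0 : 0 < ε := lt_min one_pos (by positivity)
  have hε1 : ε ≤ 1 := min_le_left _ _
  have hεG : 3 * n * ε * G ≤ δ / (4 * n) := by
    have h1 : ε ≤ δ / (12 * n * n * (G + 1)) := min_le_right _ _
    rw [le_div_iff₀ (by positivity)] at h1 ⊢
    nlinarith [mul_pos (mul_pos hn' hn') hε0]
  set Γ : ℝ := G + 1 with hΓ
  have hΓ0 : 0 < Γ := by positivity
  have hΓγ : ∀ i, - Γ ≤ γ i := by
    intro i
    have h1 : |γ i| ≤ G := Finset.single_le_sum (f := fun i => |γ i|)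
      (fun _ _ => abs_nonneg _) (Finset.mem_univ i)
    have := neg_abs_le (γ i)
    linarith
  obtain ⟨m, hm, K, hK, haux⟩ := auxPoly hn B hB ε hε0
  have hm' : (0 : ℝ) < m := by exact_mod_cast hm
  set θ : ℝ := δ * m / (8 * n * Γ) with hθ
  have hθ0 : 0 < θ := by positivity
  obtain ⟨ω, hω, hroth⟩ := roth m (θ / 2) (by positivity)
  set KB : ℝ := 1 + ∑ i, ∑ l, |B i l| with hKB
  have hKBi : ∀ i, ∑ l, |B i l| ≤ KB := by
    intro i
    have := Finset.single_le_sum (f := fun i => ∑ l, |B i l|)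
      (fun _ _ => Finset.sum_nonneg fun _ _ => abs_nonneg _) (Finset.mem_univ i)
    linarith
  have hKB1 : 1 ≤ KB := by
    have : 0 ≤ ∑ i, ∑ l, |B i l| :=
      Finset.sum_nonneg fun _ _ => Finset.sum_nonneg fun _ _ => abs_nonneg _
    linarith
  set Ct : ℝ := 1 + Fintype.card ι + ∑ i, ∑ l, |A i l| with hCt
  have hCti : ∀ i k, Fintype.card ι + |A i k| ≤ Ct := by
    intro i k
    have h1 := Finset.single_le_sum (f := fun i => ∑ l, |A i l|)
      (fun _ _ => Finset.sum_nonneg fun _ _ => abs_nonneg _) (Finset.mem_univ i)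
    have h2 := Finset.single_le_sum (f := fun l => |A i l|)
      (fun _ _ => abs_nonneg _) (Finset.mem_univ k)
    linarith
  have hCt1 : 1 ≤ Ct := by
    have : 0 ≤ ∑ i, ∑ l, |A i l| :=
      Finset.sum_nonneg fun _ _ => Finset.sum_nonneg fun _ _ => abs_nonneg _
    have : (0 : ℝ) ≤ Fintype.card ι := Nat.cast_nonneg _
    linarith
  set KK : ℝ := K * KB * Ct with hKK
  have hKK1 : 1 ≤ KK := by
    have := mul_le_mul hK hKB1 zero_le_one (by linarith)
    nlinarith
  set LK : ℝ := Real.log KK with hLK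
  have hLK0 : 0 ≤ LK := Real.log_nonneg hKK1
  have hKKe : KK = Real.exp LK := (Real.exp_log (by linarith)).symm
  have hKKK : K ≤ KK := by
    have : 1 ≤ KB * Ct := by nlinarith
    nlinarith
  set Lmin : ℝ := 1 + 4 * n * LK / δ + 2 / (ω * c) + 2 * m * LK / (ω * c) with hLmin
  have hA1 : 0 ≤ 4 * n * LK / δ := by positivity
  have hA2 : 0 ≤ 2 / (ω * c) := by positivity
  have hA3 : 0 ≤ 2 * m * LK / (ω * c) := by positivity
  have hLmin1 : 1 ≤ Lmin := by linarith
  obtain ⟨L, hL1, hL2, hL3⟩ := exists_chain (fun L => Bad ι A γ c L) hcon Lmin (2 / ω) m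
  have hL0 : ∀ j, 0 < L j := fun j => by linarith [hL1 j]
  choose x h a b s q hsp hx hab hha hq hsq hfrac hqL using hL2
  set R : ℝ := 1 + ∑ j, L j / ε with hR
  have hLR : ∀ j, L j ≤ ε * R := by
    intro j
    have := Finset.single_le_sum (f := fun j => L j / ε)
      (fun j _ => (div_pos (hL0 j) hε0).le) (Finset.mem_univ j)
    have h2 : L j / ε ≤ R := by linarith
    rw [div_le_iff₀ hε0] at h2
    linarith
  have hR0 : 0 < R := by
    have : 0 ≤ ∑ j, L j / ε := Finset.sum_nonneg fun j _ => (div_pos (hL0 j) hε0).le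
    linarith
  set r : Fin m → ℕ := fun j => ⌈R / L j⌉₊ with hr
  have hr0 : ∀ j, 0 < r j := fun j => Nat.ceil_pos.2 (div_pos hR0 (hL0 j))
  have hr0' : ∀ j, (0 : ℝ) < r j := fun j => by exact_mod_cast hr0 j
  have hr1 : ∀ j, R ≤ r j * L j := by
    intro j
    have := Nat.le_ceil (R / L j)
    rwa [div_le_iff₀ (hL0 j)] at this
  have hr2 : ∀ j, r j * L j ≤ (1 + ε) * R := by
    intro j
    have h1 := (Nat.ceil_lt_add_one (div_pos hR0 (hL0 j)).le).le
    have h2 := mul_le_mul_of_nonneg_right h1 (hL0 j).le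
    rw [add_mul, div_mul_cancel₀ _ (hL0 j).ne'] at h2
    have := hLR j
    simp only [hr]
    linarith
  have hr3 : ∀ j, r j * L j ≤ 2 * R := by
    intro j
    have := hr2 j
    nlinarith
  have hr4 : ∀ j, r j * Lmin ≤ 2 * R := fun j =>
    (mul_le_mul_of_nonneg_left (hL1 j) (hr0' j).le).trans (hr3 j)
  have hrsum : (∑ j, (r j : ℝ)) * Lmin ≤ m * (2 * R) := by
    rw [Finset.sum_mul]
    refine (Finset.sum_le_sum fun j _ => hr4 j).trans ?_
    simp
  have hrs0 : 0 ≤ ∑ j, (r j : ℝ) := Finset.sum_nonneg fun j _ => (hr0' j).le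
  have hB1 : (∑ j, (r j : ℝ)) * LK < R * m * δ / (2 * n) := by
    have h1 : (∑ j, (r j : ℝ)) * (1 + 4 * n * LK / δ) ≤ m * (2 * R) := by
      refine le_trans (mul_le_mul_of_nonneg_left ?_ hrs0) hrsum
      linarith
    have h2 : 0 < ∑ j, (r j : ℝ) := by
      apply Finset.sum_pos (fun j _ => hr0' j)
      exact ⟨⟨0, hm⟩, Finset.mem_univ _⟩
    have h3 : (∑ j, (r j : ℝ)) * (4 * n * LK / δ) < m * (2 * R) := by linarith
    have h4 : (∑ j, (r j : ℝ)) * LK = (∑ j, (r j : ℝ)) * (4 * n * LK / δ) * (δ / (4 * n)) := by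
      field_simp
    rw [h4]
    have h5 := mul_lt_mul_of_pos_right h3 (show 0 < δ / (4 * n) by positivity)
    refine h5.trans_eq ?_
    field_simp
    ring
  have hB2 : ∀ j, (r j : ℝ) ≤ ω * (c * R) := by
    intro j
    have h1 : r j * (2 / (ω * c)) ≤ 2 * R :=
      (mul_le_mul_of_nonneg_left (by linarith) (hr0' j).le).trans (hr4 j)
    have h2 : (r j : ℝ) = r j * (2 / (ω * c)) * (ω * c / 2) := by field_simp
    rw [h2]
    have h5 := mul_le_mul_of_nonneg_right h1 (show 0 ≤ ω * c / 2 by positivity)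
    refine h5.trans_eq ?_
    ring
  have hB3 : (∑ j, (r j : ℝ)) * LK ≤ ω * (c * R) := by
    have h1 : (∑ j, (r j : ℝ)) * (2 * m * LK / (ω * c)) ≤ m * (2 * R) := by
      refine le_trans (mul_le_mul_of_nonneg_left ?_ hrs0) hrsum
      linarith
    have h4 : (∑ j, (r j : ℝ)) * LK =
        (∑ j, (r j : ℝ)) * (2 * m * LK / (ω * c)) * (ω * c / (2 * m)) := by
      field_simp
    rw [h4]
    have h5 := mul_le_mul_of_nonneg_right h1 (show 0 ≤ ω * c / (2 * m) by positivity)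
    refine h5.trans_eq ?_
    field_simp
  obtain ⟨P, hP0, hPBH, hPn, hPc⟩ := haux r hr0
  -- the coefficients of small weight vanish
  have hF : IdxGE (fun p : Fin m × Option ι => if p.2 = none then 1 / (r p.1 : ℝ) else 0) θ
      (FF a x P) := by
    intro g hg
    by_contra hlt
    push Not at hlt
    have hwt : wt (fun p : Fin m × Option ι => if p.2 = none then 1 / (r p.1 : ℝ) else 0) g =
        ∑ j, (g (j, none) : ℝ) / r j := by
      unfold wt
      rw [Fintype.sum_prod_type]
      apply Finset.sum_congr rfl
      intro j _
      rw [Fintype.sum_option]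
      simp [div_eq_mul_inv]
    rw [hwt] at hlt
    have hsz : ∑ j, L j * (g (j, none) : ℝ) ≤ 2 * R * θ := by
      calc ∑ j, L j * (g (j, none) : ℝ) = ∑ j, (r j * L j) * ((g (j, none) : ℝ) / r j) := by
            apply Finset.sum_congr rfl
            intro j _
            have := (hr0' j).ne'
            field_simp
        _ ≤ ∑ j, (2 * R) * ((g (j, none) : ℝ) / r j) := by
            apply Finset.sum_le_sum
            intro j _
            apply mul_le_mul_of_nonneg_right (hr3 j)
            have := hr0' j
            positivity
        _ = 2 * R * ∑ j, (g (j, none) : ℝ) / r j := by rw [Finset.mul_sum]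
        _ ≤ _ := mul_le_mul_of_nonneg_left hlt.le (by positivity)
    set M : ℝ := Ct ^ (∑ j, r j) * Real.exp (- (3 * R * m * δ / (4 * n))) with hM
    have hMM : ∀ f, coeff f (lsub B P) ≠ 0 →
        ∏ p : Fin m × Fin n, (Ct * Real.exp (γ p.2 * L p.1)) ^ f p ≤ M := by
      intro f hf
      obtain ⟨hf1, hf2⟩ := hPc f hf
      have h1 := size_lemma hn r hr0 f hf1 ε hε0 hε1 hf2 γ L R hR0 hr1 hr2
      simp only [mul_pow]
      rw [Finset.prod_mul_distrib, Finset.prod_pow_eq_pow_sum, Fintype.sum_prod_type]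
      simp only [hf1]
      apply mul_le_mul_of_nonneg_left _ (by positivity)
      simp only [← Real.exp_nat_mul]
      rw [← Real.exp_sum]
      apply Real.exp_le_exp.2
      refine h1.trans ?_
      have h2 : (∑ i, γ i) / n + 3 * n * ε * G ≤ - (3 * δ / (4 * n)) := by
        have h3 : (∑ i, γ i) / n = - (δ / n) := by rw [hδ]; ring
        rw [h3]
        have h4 : - (3 * δ / (4 * n)) = - (δ / n) + δ / (4 * n) := by
          field_simp
          ring
        linarith
      have h5 := mul_le_mul_of_nonneg_left h2 (show 0 ≤ R * m by positivity)
      refine h5.trans_eq ?_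
      ring
    have hcs := coef_small A B hBA a x P r hPBH γ Γ hΓγ L (fun j => (hL0 j).le) hx KB hKBi Ct hCti
      M hMM g
    have h1 : (1 : ℝ) ≤ |((coeff g (FF a x P) : ℤ) : ℝ)| := by
      have := Int.one_le_abs hg
      exact_mod_cast this
    have h2 : Real.exp (- (R * δ * m / (4 * n))) ≤
        Real.exp (- (Γ * ∑ j, L j * (g (j, none) : ℝ))) := by
      apply Real.exp_le_exp.2
      have h3 := mul_le_mul_of_nonneg_left hsz hΓ0.le
      have h4 : Γ * (2 * R * θ) = R * δ * m / (4 * n) := by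
        rw [hθ]
        field_simp
        ring
      linarith
    have h3 : nrm NZ P * KB ^ (∑ j, r j) * M ≤
        Real.exp ((∑ j, (r j : ℝ)) * LK - 3 * R * m * δ / (4 * n)) := by
      rw [sub_eq_add_neg, Real.exp_add, hM, ← mul_assoc]
      apply mul_le_mul_of_nonneg_right _ (Real.exp_pos _).le
      have h5 : Real.exp ((∑ j, (r j : ℝ)) * LK) = KK ^ (∑ j, r j) := by
        rw [hKKe, ← Real.exp_nat_mul]
        simp
      rw [h5, hKK, mul_pow, mul_pow]
      apply mul_le_mul_of_nonneg_right _ (by positivity)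
      exact mul_le_mul_of_nonneg_right hPn (by positivity)
    have h4 : Real.exp ((∑ j, (r j : ℝ)) * LK - 3 * R * m * δ / (4 * n)) <
        Real.exp (- (R * δ * m / (4 * n))) := by
      apply Real.exp_lt_exp.2
      have : R * m * δ / (2 * n) = 3 * R * m * δ / (4 * n) - R * δ * m / (4 * n) := by
        field_simp
        ring
      linarith
    have h5 := Real.exp_pos (- (Γ * ∑ j, L j * (g (j, none) : ℝ)))
    nlinarith
  have hpsi := idx_psi P r a x h hha hsp θ hF
  obtain ⟨p, hp0, hpd, hpn, hpi⟩ := alg_core P hP0 r hPBH a b hab _ θ hpsi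
  obtain ⟨J, hJ1, hJ2⟩ := hroth r (c * R) (fun j => - s j) q hr0 hq (fun j => (hsq j).neg_left) (by
      intro j
      have h1 : c * L j ≤ Real.log (q j) := by
        rw [Real.le_log_iff_exp_le (by exact_mod_cast hq j)]
        exact hqL j
      calc c * R ≤ c * (r j * L j) := mul_le_mul_of_nonneg_left (hr1 j) hc.le
        _ = r j * (c * L j) := by ring
        _ ≤ _ := mul_le_mul_of_nonneg_left h1 (hr0' j).le) hB2 (by
      intro i j hij
      have h1 := hL3 i j hij
      have h2 : 2 * L j ≤ ω * L i := by
        have := mul_le_mul_of_nonneg_left h1 hω.le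
        have e : ω * (2 / ω * L j) = 2 * L j := by field_simp
        linarith
      have h3 : (r i : ℝ) * L i ≤ (ω * r j) * L i := by
        calc (r i : ℝ) * L i ≤ 2 * R := hr3 i
          _ ≤ 2 * (r j * L j) := by linarith [hr1 j]
          _ = r j * (2 * L j) := by ring
          _ ≤ r j * (ω * L i) := mul_le_mul_of_nonneg_left h2 (hr0' j).le
          _ = _ := by ring
      exact le_of_mul_le_mul_right h3 (hL0 i)) p hp0 hpd (by
      refine (hpn.trans hPn).trans ?_
      calc K ^ (∑ j, r j) ≤ KK ^ (∑ j, r j) := pow_le_pow_left₀ (by linarith) hKKK _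
        _ = Real.exp ((∑ j, (r j : ℝ)) * LK) := by
            rw [hKKe, ← Real.exp_nat_mul]
            simp
        _ ≤ _ := Real.exp_le_exp.2 hB3)
  have hκ : (fun j => (((- s j : ℤ)) : ℚ) / q j) = fun j => - ((h j (b j) : ℚ) / h j (a j)) := by
    funext j
    rw [hfrac j]
    push_cast
    ring
  rw [hκ] at hJ1
  have := hpi J hJ1
  linarith

theorem thmA (hn : 0 < n) (A B : Matrix (Fin n) (Fin n) ℝ) (hBA : B * A = 1)
    (hB : ∀ i l, IsAlgebraic ℤ (B i l)) (γ : Fin n → ℝ) (hγ : ∑ i, γ i < 0) (c : ℝ) (hc : 0 < c) :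
    ∃ L0, ∀ L, L0 ≤ L → ¬ Bad ι A γ c L := by
  have h1 : ∀ i l, ∃ y : ℤ, y ≠ 0 ∧ IsIntegral ℤ (y • B i l) := fun i l =>
    (hB i l).exists_integral_multiple
  choose y hy0 hy using h1
  set D : ℤ := ∏ p : Fin n × Fin n, y p.1 p.2 with hD
  have hD0 : D ≠ 0 := Finset.prod_ne_zero_iff.2 fun p _ => hy0 _ _
  have hD0' : (D : ℝ) ≠ 0 := by exact_mod_cast hD0
  have hDB : ∀ i l, IsIntegral ℤ (((D : ℝ) • B) i l) := by
    intro i l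
    obtain ⟨k, hk⟩ := Finset.dvd_prod_of_mem (fun p : Fin n × Fin n => y p.1 p.2)
      (Finset.mem_univ (i, l))
    have : ((D : ℝ) • B) i l = k • (y i l • B i l) := by
      rw [Matrix.smul_apply, hD, hk]
      simp
      ring
    rw [this]
    exact (hy i l).smul k
  obtain ⟨L0, hL0⟩ := thmA_int (ι := ι) hn ((D : ℝ)⁻¹ • A) ((D : ℝ) • B) (by
    rw [Matrix.smul_mul, Matrix.mul_smul, smul_smul, mul_inv_cancel₀ hD0', one_smul, hBA]) hDB γ hγ
    c hc
  refine ⟨L0, fun L hL hbad => hL0 L hL ?_⟩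
  obtain ⟨x, h, a, b, s, q, h1, h2, h3⟩ := hbad
  refine ⟨x, h, a, b, s, q, h1, fun l i => ?_, h3⟩
  refine le_trans ?_ (h2 l i)
  have : ∑ k, ((D : ℝ)⁻¹ • A) i k * x l k = (D : ℝ)⁻¹ * ∑ k, A i k * x l k := by
    rw [Finset.mul_sum]
    apply Finset.sum_congr rfl
    intro k _
    rw [Matrix.smul_apply, smul_eq_mul, mul_assoc]
  rw [this, abs_mul]
  apply mul_le_of_le_one_left (abs_nonneg _)
  rw [abs_inv]
  apply inv_le_one_of_one_le₀
  exact_mod_cast Int.one_le_abs hD0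

end
end ABT
end

section
namespace ABT
set_option linter.unusedSectionVars false
set_option linter.unusedSimpArgs false

/-- transference in rank at most `k`, with constant `C` -/
def TransfProp (k : ℕ) (C : ℝ) : Prop :=
  ∀ (M : Type) [AddCommGroup M] [Module.Free ℤ M] [Module.Finite ℤ M],
    Module.finrank ℤ M ≤ k →
    ∀ (e : M →ₗ[ℤ] EuclideanSpace ℝ (Fin 3)) (lam : ℝ), 0 < lam →
    (∀ D : ℝ, {v | ‖e v‖ ≤ D}.Finite) → (∀ v, v ≠ 0 → lam ≤ ‖e v‖) →
    ∃ y : Fin k → (M →ₗ[ℤ] ℤ), (∀ i v, |((y i v : ℤ) : ℝ)| ≤ C / lam * ‖e v‖) ∧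
      ∀ (F : Type) [CommRing F] (f : M →ₗ[ℤ] F), ∃ c : Fin k → F,
        ∀ v, f v = ∑ i, c i * ((y i v : ℤ) : F)

/-- orthogonal projection along `p` -/
noncomputable def projAlong {M : Type} [AddCommGroup M] (e : M →ₗ[ℤ] EuclideanSpace ℝ (Fin 3))
    (p : M) : M →ₗ[ℤ] EuclideanSpace ℝ (Fin 3) :=
  AddMonoidHom.toIntLinearMap
  { toFun := fun v => e v - (inner ℝ (e p) (e v) / ‖e p‖ ^ 2) • e p
    map_zero' := by simp
    map_add' := by
      intro u v
      rw [map_add, inner_add_right, add_div, add_smul]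
      abel }

theorem projAlong_apply {M : Type} [AddCommGroup M] (e : M →ₗ[ℤ] EuclideanSpace ℝ (Fin 3))
    (p v : M) : projAlong e p v = e v - (inner ℝ (e p) (e v) / ‖e p‖ ^ 2) • e p := rfl

theorem projAlong_sq {M : Type} [AddCommGroup M] (e : M →ₗ[ℤ] EuclideanSpace ℝ (Fin 3))
    (p v : M) (hp : e p ≠ 0) : ‖projAlong e p v‖ ^ 2 =
      ‖e v‖ ^ 2 - (inner ℝ (e p) (e v) / ‖e p‖ ^ 2) ^ 2 * ‖e p‖ ^ 2 := by
  have hp' : ‖e p‖ ≠ 0 := norm_ne_zero_iff.2 hp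
  rw [projAlong_apply, norm_sub_sq_real, inner_smul_right, norm_smul, mul_pow, Real.norm_eq_abs,
    sq_abs, real_inner_comm]
  field_simp
  ring

theorem projAlong_le {M : Type} [AddCommGroup M] (e : M →ₗ[ℤ] EuclideanSpace ℝ (Fin 3))
    (p v : M) (hp : e p ≠ 0) : ‖projAlong e p v‖ ≤ ‖e v‖ := by
  have := projAlong_sq e p v hp
  apply le_of_sq_le_sq _ (norm_nonneg _)
  have : 0 ≤ (inner ℝ (e p) (e v) / ‖e p‖ ^ 2) ^ 2 * ‖e p‖ ^ 2 := by positivity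
  linarith

theorem projAlong_self {M : Type} [AddCommGroup M] (e : M →ₗ[ℤ] EuclideanSpace ℝ (Fin 3))
    (p : M) (hp : e p ≠ 0) : projAlong e p p = 0 := by
  have hp' : ‖e p‖ ≠ 0 := norm_ne_zero_iff.2 hp
  rw [projAlong_apply, real_inner_self_eq_norm_sq, div_self (pow_ne_zero 2 hp'), one_smul, sub_self]

/-- size reduction -/
theorem exists_reduced {M : Type} [AddCommGroup M] (e : M →ₗ[ℤ] EuclideanSpace ℝ (Fin 3))
    (p v : M) (hp : e p ≠ 0) : ∃ k : ℤ, projAlong e p (v - k • p) = projAlong e p v ∧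
      ‖e (v - k • p)‖ ^ 2 ≤ ‖projAlong e p v‖ ^ 2 + ‖e p‖ ^ 2 / 4 := by
  set t := inner ℝ (e p) (e v) / ‖e p‖ ^ 2 with ht
  have hp' : ‖e p‖ ≠ 0 := norm_ne_zero_iff.2 hp
  have h0 : projAlong e p (v - round t • p) = projAlong e p v := by
    rw [map_sub, map_smul, projAlong_self e p hp, smul_zero, sub_zero]
  refine ⟨round t, h0, ?_⟩
  have h1 := projAlong_sq e p (v - round t • p) hp
  rw [h0] at h1
  have h2 : inner ℝ (e p) (e (v - round t • p)) / ‖e p‖ ^ 2 = t - round t := by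
    rw [map_sub, map_smul, inner_sub_right, ← Int.cast_smul_eq_zsmul ℝ, inner_smul_right,
      real_inner_self_eq_norm_sq, sub_div, mul_div_assoc, div_self (pow_ne_zero 2 hp'), mul_one]
  rw [h2] at h1
  have h3 := abs_sub_round t
  have h4 : (t - round t) ^ 2 ≤ 1 / 4 := by
    rw [← sq_abs]
    nlinarith [abs_nonneg (t - round t)]
  have : 0 ≤ ‖e p‖ ^ 2 := by positivity
  nlinarith

theorem transf_quot {k : ℕ} {C : ℝ} (hC : 0 < C) (hT : TransfProp k C) (M : Type) [AddCommGroup M]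
    [Module.Free ℤ M] [Module.Finite ℤ M] (hk : Module.finrank ℤ M ≤ k + 1)
    (e : M →ₗ[ℤ] EuclideanSpace ℝ (Fin 3)) (lam : ℝ) (hlam : 0 < lam)
    (hfin : ∀ D : ℝ, {v | ‖e v‖ ≤ D}.Finite) (p : M) (hp : e p ≠ 0) (hpl : ‖e p‖ ≤ lam)
    (hprim : ∀ (n : ℤ) v, n ≠ 0 → n • v ∈ Submodule.span ℤ {p} → v ∈ Submodule.span ℤ {p})
    (hmin : ∀ v, v ∉ Submodule.span ℤ {p} → lam ≤ ‖e v‖) :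
    ∃ y : Fin k → (M →ₗ[ℤ] ℤ), (∀ i v, |((y i v : ℤ) : ℝ)| ≤ 2 * C / lam * ‖e v‖) ∧
      (∀ i, y i p = 0) ∧
      ∀ (F : Type) [CommRing F] (f : M →ₗ[ℤ] F), f p = 0 → ∃ c : Fin k → F,
        ∀ v, f v = ∑ i, c i * ((y i v : ℤ) : F) := by
  set N := Submodule.span ℤ {p} with hN
  have hp0 : p ≠ 0 := fun h => hp (by rw [h, map_zero])
  have : Module.IsTorsionFree ℤ (M ⧸ N) := by
    refine ⟨fun r hr => ?_⟩
    have hr0 : r ≠ 0 := hr.ne_zero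
    rw [isSMulRegular_iff_right_eq_zero_of_smul]
    intro x hx
    obtain ⟨v, rfl⟩ := N.mkQ_surjective x
    rw [← map_smul, Submodule.mkQ_apply, Submodule.Quotient.mk_eq_zero] at hx
    rw [Submodule.mkQ_apply, Submodule.Quotient.mk_eq_zero]
    exact hprim r v hr0 hx
  have hfr : Module.finrank ℤ (M ⧸ N) ≤ k := by
    have h1 := Submodule.finrank_quotient_add_finrank N
    have h2 : Module.finrank ℤ N = 1 := by
      rw [← (LinearEquiv.toSpanNonzeroSingleton ℤ M p hp0).finrank_eq, Module.finrank_self]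
    omega
  have hker : N ≤ LinearMap.ker (projAlong e p) := by
    rw [hN, Submodule.span_singleton_le_iff_mem, LinearMap.mem_ker]
    exact projAlong_self e p hp
  set e' : (M ⧸ N) →ₗ[ℤ] EuclideanSpace ℝ (Fin 3) := N.liftQ (projAlong e p) hker with he'
  have he'mk : ∀ v, e' (N.mkQ v) = projAlong e p v := fun v => rfl
  have hmkred : ∀ v (j : ℤ), N.mkQ (v - j • p) = N.mkQ v := by
    intro v j
    rw [map_sub, map_smul]
    have : N.mkQ p = 0 := by
      rw [Submodule.mkQ_apply, Submodule.Quotient.mk_eq_zero]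
      exact Submodule.mem_span_singleton_self p
    rw [this, smul_zero, sub_zero]
  obtain ⟨y, hy1, hy2⟩ := hT (M ⧸ N) hfr e' (lam / 2) (by positivity) (by
    intro D
    apply ((hfin (|D| + ‖e p‖)).image N.mkQ).subset
    intro x hx
    obtain ⟨v, rfl⟩ := N.mkQ_surjective x
    obtain ⟨j, hj1, hj2⟩ := exists_reduced e p v hp
    refine ⟨v - j • p, ?_, hmkred v j⟩
    simp only [Set.mem_ofPred_eq] at hx ⊢
    rw [he'mk] at hx
    apply le_of_sq_le_sq _ (by positivity)
    have h1 : ‖projAlong e p v‖ ^ 2 ≤ |D| ^ 2 :=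
      pow_le_pow_left₀ (norm_nonneg _) (hx.trans (le_abs_self D)) 2
    have h2 : 0 ≤ |D| * ‖e p‖ := by positivity
    have h3 : 0 ≤ ‖e p‖ ^ 2 := by positivity
    nlinarith) (by
    intro x hx
    obtain ⟨v, rfl⟩ := N.mkQ_surjective x
    obtain ⟨j, hj1, hj2⟩ := exists_reduced e p v hp
    rw [he'mk]
    have h1 : v - j • p ∉ N := by
      intro h
      apply hx
      rw [← hmkred v j, Submodule.mkQ_apply, Submodule.Quotient.mk_eq_zero]
      exact h
    have h2 := hmin _ h1
    apply le_of_sq_le_sq _ (norm_nonneg _)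
    have h3 : lam ^ 2 ≤ ‖e (v - j • p)‖ ^ 2 := pow_le_pow_left₀ hlam.le h2 2
    have h4 : ‖e p‖ ^ 2 ≤ lam ^ 2 := pow_le_pow_left₀ (norm_nonneg _) hpl 2
    nlinarith [sq_nonneg lam])
  refine ⟨fun i => (y i).comp N.mkQ, ?_, ?_, ?_⟩
  · intro i v
    have h1 := hy1 i (N.mkQ v)
    rw [he'mk] at h1
    refine h1.trans ?_
    have h2 : C / (lam / 2) = 2 * C / lam := by field_simp
    rw [h2]
    exact mul_le_mul_of_nonneg_left (projAlong_le e p v hp) (by positivity)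
  · intro i
    have := hmkred p 1
    rw [one_smul, sub_self, map_zero] at this
    rw [LinearMap.comp_apply, ← this, map_zero]
  · intro F _ f hf
    have hk2 : N ≤ LinearMap.ker f := by
      rw [hN, Submodule.span_singleton_le_iff_mem, LinearMap.mem_ker]
      exact hf
    obtain ⟨c, hc⟩ := hy2 F (N.liftQ f hk2)
    exact ⟨c, fun v => hc (N.mkQ v)⟩

/-- a functional taking the value one at a primitive vector -/
theorem exists_functional (M : Type) [AddCommGroup M] [Module.Free ℤ M] [Module.Finite ℤ M] (p : M)
    (hp0 : p ≠ 0)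
    (hprim : ∀ (n : ℤ) v, n ≠ 0 → n • v ∈ Submodule.span ℤ {p} → v ∈ Submodule.span ℤ {p}) :
    ∃ y : M →ₗ[ℤ] ℤ, y p = 1 := by
  set N := Submodule.span ℤ {p} with hN
  have : Module.IsTorsionFree ℤ (M ⧸ N) := by
    refine ⟨fun r hr => ?_⟩
    have hr0 : r ≠ 0 := hr.ne_zero
    rw [isSMulRegular_iff_right_eq_zero_of_smul]
    intro x hx
    obtain ⟨v, rfl⟩ := N.mkQ_surjective x
    rw [← map_smul, Submodule.mkQ_apply, Submodule.Quotient.mk_eq_zero] at hx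
    rw [Submodule.mkQ_apply, Submodule.Quotient.mk_eq_zero]
    exact hprim r v hr0 hx
  obtain ⟨σ, hσ⟩ := N.mkQ.exists_rightInverse_of_surjective (LinearMap.range_eq_top.2 N.mkQ_surjective)
  have hmem : ∀ v, (LinearMap.id - σ.comp N.mkQ : M →ₗ[ℤ] M) v ∈ N := by
    intro v
    rw [← Submodule.Quotient.mk_eq_zero, ← Submodule.mkQ_apply]
    have := LinearMap.congr_fun hσ (N.mkQ v)
    simp only [LinearMap.comp_apply, LinearMap.id_apply] at this
    simp only [LinearMap.sub_apply, LinearMap.id_apply, LinearMap.comp_apply, map_sub, this, sub_self]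
  refine ⟨(LinearEquiv.toSpanNonzeroSingleton ℤ M p hp0).symm.toLinearMap.comp
    (LinearMap.codRestrict N _ hmem), ?_⟩
  rw [LinearMap.comp_apply, LinearEquiv.coe_coe, LinearEquiv.symm_apply_eq]
  apply Subtype.ext
  have : N.mkQ p = 0 := by
    rw [Submodule.mkQ_apply, Submodule.Quotient.mk_eq_zero]
    exact Submodule.mem_span_singleton_self p
  simp [LinearMap.codRestrict_apply, this]

theorem transf (k : ℕ) : ∃ C : ℝ, 0 < C ∧ TransfProp k C := by
  induction k with
  | zero =>
    refine ⟨1, one_pos, ?_⟩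
    intro M _ _ _ hk e lam hlam hfin hmin
    have h0 : Module.finrank ℤ M = 0 := by omega
    have hsub : Subsingleton M := Module.finrank_zero_iff.1 h0
    refine ⟨fun _ => 0, fun i => i.elim0, fun F _ f => ⟨fun _ => 0, fun v => ?_⟩⟩
    rw [Subsingleton.elim v 0]
    simp
  | succ k ih =>
    obtain ⟨C, hC, hT⟩ := ih
    refine ⟨1 + (k + 1) * (2 * C), by positivity, ?_⟩
    intro M _ _ _ hk e lam hlam hfin hmin
    by_cases hsub : Subsingleton M
    · refine ⟨fun _ => 0, fun i v => ?_, fun F _ f => ⟨fun _ => 0, fun v => ?_⟩⟩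
      · simp only [LinearMap.zero_apply, Int.cast_zero, abs_zero]
        positivity
      · rw [Subsingleton.elim v 0]
        simp
    rw [not_subsingleton_iff_nontrivial] at hsub
    obtain ⟨v1, hv1⟩ := exists_ne (0 : M)
    -- a shortest vector
    obtain ⟨p, hpm, hpmin⟩ := Set.exists_min_image ({v | ‖e v‖ ≤ ‖e v1‖} \ {0}) (fun v => ‖e v‖)
      ((hfin ‖e v1‖).subset Set.sdiff_subset) ⟨v1, by simp, hv1⟩
    have hp0 : p ≠ 0 := hpm.2
    have hpmin' : ∀ v, v ≠ 0 → ‖e p‖ ≤ ‖e v‖ := by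
      intro v hv
      by_cases h : ‖e v‖ ≤ ‖e v1‖
      · exact hpmin v ⟨h, hv⟩
      · exact hpm.1.trans (not_le.1 h).le
    have hlp := hmin p hp0
    have hep0 : 0 < ‖e p‖ := hlam.trans_le hlp
    have hep : e p ≠ 0 := norm_pos_iff.1 hep0
    have hprim : ∀ (n : ℤ) v, n ≠ 0 → n • v ∈ Submodule.span ℤ {p} →
        v ∈ Submodule.span ℤ {p} := by
      intro n v hn hv
      obtain ⟨c, hc⟩ := Submodule.mem_span_singleton.1 hv
      have h1 : projAlong e p v = 0 := by
        have : n • projAlong e p v = 0 := by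
          rw [← map_smul, ← hc, map_smul, projAlong_self e p hep, smul_zero]
        rw [← Int.cast_smul_eq_zsmul ℝ] at this
        exact (smul_eq_zero.1 this).resolve_left (by exact_mod_cast hn)
      obtain ⟨j, hj1, hj2⟩ := exists_reduced e p v hep
      rw [h1, norm_zero] at hj2
      have h2 : v - j • p = 0 := by
        by_contra hne
        have h3 := hpmin' _ hne
        have h4 := pow_le_pow_left₀ hep0.le h3 2
        have : 0 < ‖e p‖ ^ 2 := by positivity
        nlinarith
      rw [sub_eq_zero.1 h2]
      exact Submodule.smul_mem _ _ (Submodule.mem_span_singleton_self p)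
    obtain ⟨y, hy1, hy2, hy3⟩ := transf_quot hC hT M hk e ‖e p‖ hep0 hfin p hep le_rfl hprim (by
      intro v hv
      apply hpmin'
      rintro rfl
      exact hv (Submodule.zero_mem _))
    obtain ⟨y0, hy0⟩ := exists_functional M p hp0 hprim
    set φ : M →ₗ[ℤ] ℝ := AddMonoidHom.toIntLinearMap
      { toFun := fun v => inner ℝ (e p) (e v) / ‖e p‖ ^ 2
        map_zero' := by simp
        map_add' := by
          intro u v
          rw [map_add, inner_add_right, add_div] } with hφ
    have hφa : ∀ v, φ v = inner ℝ (e p) (e v) / ‖e p‖ ^ 2 := fun v => rfl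
    set y0' : M →ₗ[ℤ] ℝ := (Int.castAddHom ℝ).toIntLinearMap.comp y0 with hy0'
    have hy0a : ∀ v, y0' v = ((y0 v : ℤ) : ℝ) := fun v => rfl
    obtain ⟨c, hc⟩ := hy3 ℝ (y0' - φ) (by
      rw [LinearMap.sub_apply, hφa, hy0a, hy0, real_inner_self_eq_norm_sq, div_self (by positivity)]
      simp)
    set z : M →ₗ[ℤ] ℤ := y0 - ∑ i, ⌊c i⌋ • y i with hz
    have hzp : z p = 1 := by
      simp [hz, hy0, hy2, LinearMap.sum_apply]
    have hyl : ∀ i v, |((y i v : ℤ) : ℝ)| ≤ 2 * C / lam * ‖e v‖ := by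
      intro i v
      refine (hy1 i v).trans (mul_le_mul_of_nonneg_right ?_ (norm_nonneg _))
      exact div_le_div_of_nonneg_left (by positivity) hlam hlp
    refine ⟨Fin.cons z y, ?_, ?_⟩
    · intro i v
      refine Fin.cases ?_ (fun i => ?_) i
      · simp only [Fin.cons_zero]
        have h1 : ((z v : ℤ) : ℝ) = φ v + ∑ i, Int.fract (c i) * ((y i v : ℤ) : ℝ) := by
          have h2 := hc v
          rw [LinearMap.sub_apply, hy0a] at h2
          have h3 : ((z v : ℤ) : ℝ) = ((y0 v : ℤ) : ℝ) - ∑ i, (⌊c i⌋ : ℝ) * ((y i v : ℤ) : ℝ) := by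
            simp [hz, LinearMap.sum_apply]
          have h4 : ∑ i, c i * ((y i v : ℤ) : ℝ) = ∑ i, (⌊c i⌋ : ℝ) * ((y i v : ℤ) : ℝ) +
              ∑ i, Int.fract (c i) * ((y i v : ℤ) : ℝ) := by
            rw [← Finset.sum_add_distrib]
            apply Finset.sum_congr rfl
            intro i _
            rw [← add_mul, Int.floor_add_fract]
          linarith
        rw [h1]
        have h5 : |φ v| ≤ 1 / lam * ‖e v‖ := by
          rw [hφa, abs_div, abs_of_pos (by positivity : 0 < ‖e p‖ ^ 2), div_le_iff₀ (by positivity)]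
          refine (abs_real_inner_le_norm _ _).trans ?_
          have h6 : ‖e p‖ * 1 ≤ ‖e p‖ * (1 / lam * ‖e p‖) := by
            apply mul_le_mul_of_nonneg_left _ hep0.le
            rw [one_div, inv_mul_eq_div, le_div_iff₀ hlam]
            linarith
          have h7 := mul_le_mul_of_nonneg_right h6 (norm_nonneg (e v))
          calc _ ≤ ‖e p‖ * 1 * ‖e v‖ := by rw [mul_one]
            _ ≤ _ := h7
            _ = _ := by ring
        have h8 : |∑ i, Int.fract (c i) * ((y i v : ℤ) : ℝ)| ≤ k * (2 * C / lam * ‖e v‖) := by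
          refine (Finset.abs_sum_le_sum_abs _ _).trans ?_
          calc _ ≤ ∑ i : Fin k, (2 * C / lam * ‖e v‖) := by
                apply Finset.sum_le_sum
                intro i _
                rw [abs_mul, abs_of_nonneg (Int.fract_nonneg _)]
                exact (mul_le_of_le_one_left (abs_nonneg _) (Int.fract_lt_one _).le).trans (hyl i v)
            _ = _ := by simp
        refine (abs_add_le _ _).trans ((add_le_add h5 h8).trans ?_)
        have h9 : 0 ≤ 2 * C / lam * ‖e v‖ := by positivity
        calc _ ≤ 1 / lam * ‖e v‖ + k * (2 * C / lam * ‖e v‖) + 2 * C / lam * ‖e v‖ := by linarith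
          _ = _ := by ring
      · simp only [Fin.cons_succ]
        refine (hyl i v).trans (mul_le_mul_of_nonneg_right ?_ (norm_nonneg _))
        apply div_le_div_of_nonneg_right _ hlam.le
        have : 0 ≤ (k : ℝ) * (2 * C) := by positivity
        linarith
    · intro F _ f
      set g : M →ₗ[ℤ] F := f - ((AddMonoidHom.mulLeft (f p)).toIntLinearMap).comp
        ((Int.castAddHom F).toIntLinearMap.comp z) with hg
      have hga : ∀ v, g v = f v - f p * ((z v : ℤ) : F) := fun v => rfl
      obtain ⟨d, hd⟩ := hy3 F g (by rw [hga, hzp]; simp)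
      refine ⟨Fin.cons (f p) d, fun v => ?_⟩
      rw [Fin.sum_univ_succ]
      simp only [Fin.cons_zero, Fin.cons_succ]
      rw [← hd v, hga]
      ring

end ABT
end

section
namespace ABT
set_option linter.unusedSectionVars false
set_option linter.unusedSimpArgs false

section
variable {n : ℕ} {ι : Type*} [Fintype ι]

theorem exp_absorb (C : ℝ) {a b : ℝ} (hab : a < b) :
    ∃ L0 : ℝ, ∀ L, L0 ≤ L → C * Real.exp (a * L) ≤ Real.exp (b * L) := by
  have hd : 0 < b - a := by linarith
  refine ⟨(|C|) / (b - a), fun L hL => ?_⟩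
  have h1 : |C| ≤ (b - a) * L := by
    rw [div_le_iff₀ hd] at hL
    linarith
  have h2 : C ≤ Real.exp ((b - a) * L) := by
    have := Real.add_one_le_exp ((b - a) * L)
    have := le_abs_self C
    linarith
  calc C * Real.exp (a * L) ≤ Real.exp ((b - a) * L) * Real.exp (a * L) :=
        mul_le_mul_of_nonneg_right h2 (Real.exp_pos _).le
    _ = _ := by rw [← Real.exp_add]; congr 1; ring

theorem thmA' (hn : 0 < n) (A B : Matrix (Fin n) (Fin n) ℝ) (hBA : B * A = 1)
    (hB : ∀ i l, IsAlgebraic ℤ (B i l)) (γ : Fin n → ℝ) (hγ : ∑ i, γ i < 0) (c : ℝ) (hc : 0 < c)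
    (C : ℝ) :
    ∃ L0, ∀ L, L0 ≤ L → ∀ (x : ι → Fin n → ℤ) (h : Fin n → ℤ) (a b : Fin n),
    (∀ v : Fin n → ℚ, ∑ i, (h i : ℚ) * v i = 0 →
      v ∈ Submodule.span ℚ (Set.range (fun l i => (x l i : ℚ)))) →
    (∀ l i, |∑ k, A i k * x l k| ≤ C * Real.exp (γ i * L)) → a ≠ b → h a ≠ 0 →
    Real.exp (c * L) ≤ C * (|(h a : ℝ)| / Int.gcd (h a) (h b)) → False := by
  have hn' : (0 : ℝ) < n := by exact_mod_cast hn
  set η : ℝ := - (∑ i, γ i) / (2 * n) with hη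
  have hη0 : 0 < η := div_pos (by linarith) (by positivity)
  have hsum : ∑ i, (γ i + η) < 0 := by
    rw [Finset.sum_add_distrib]
    simp only [Finset.sum_const, Finset.card_univ, Fintype.card_fin, nsmul_eq_mul]
    have : n * η = - (∑ i, γ i) / 2 := by
      rw [hη]
      field_simp
    rw [this]
    linarith
  obtain ⟨L1, hL1⟩ := thmA (ι := ι) hn A B hBA hB (fun i => γ i + η) hsum (c / 2) (by positivity)
  have h2 : ∀ i, ∃ L0 : ℝ, ∀ L, L0 ≤ L → C * Real.exp (γ i * L) ≤ Real.exp ((γ i + η) * L) :=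
    fun i => exp_absorb C (by linarith)
  choose L2 hL2 using h2
  obtain ⟨L3, hL3⟩ := exp_absorb C (a := c / 2) (b := c) (by linarith)
  refine ⟨max L1 (max L3 (∑ i, |L2 i|)), ?_⟩
  intro L hL x h a b hsp hx hab hha hq
  have hLa : L1 ≤ L := (le_max_left _ _).trans hL
  have hLb : L3 ≤ L := (le_max_left _ _).trans ((le_max_right _ _).trans hL)
  have hLc : ∀ i, L2 i ≤ L := fun i => by
    refine le_trans ?_ ((le_max_right _ _).trans ((le_max_right _ _).trans hL))
    exact (le_abs_self _).trans (Finset.single_le_sum (f := fun j => |L2 j|)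
            (fun _ _ => abs_nonneg _) (Finset.mem_univ i))
  apply hL1 L hLa
  have hg0 : 0 < Int.gcd (h a) (h b) := Int.gcd_pos_of_ne_zero_left _ hha
  obtain ⟨a', ha'⟩ := Int.gcd_dvd_left (h a) (h b)
  obtain ⟨b', hb'⟩ := Int.gcd_dvd_right (h a) (h b)
  set g := Int.gcd (h a) (h b) with hg
  have hg0' : (g : ℤ) ≠ 0 := by exact_mod_cast hg0.ne'
  have ha'0 : a' ≠ 0 := by
    rintro rfl
    apply hha
    rw [ha', mul_zero]
  have hcop : IsCoprime b' a' := by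
    have h1 := Int.gcd_eq_gcd_ab (h a) (h b)
    rw [← hg] at h1
    refine ⟨Int.gcdB (h a) (h b), Int.gcdA (h a) (h b), ?_⟩
    have h3 : (g : ℤ) * (Int.gcdB (h a) (h b) * b' + Int.gcdA (h a) (h b) * a') = g * 1 := by
      calc _ = ((g : ℤ) * a') * Int.gcdA (h a) (h b) + (g * b') * Int.gcdB (h a) (h b) := by ring
        _ = _ := by rw [← ha', ← hb', mul_one, ← h1]
    exact mul_left_cancel₀ hg0' h3
  have hfr : (h b : ℚ) / h a = b' / a' := by
    rw [ha', hb']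
    push_cast
    have : (g : ℚ) ≠ 0 := by exact_mod_cast hg0.ne'
    rw [mul_div_mul_left _ _ this]
  have hC0 : 0 < C := by
    by_contra hneg
    have h3 : C * (|(h a : ℝ)| / g) ≤ 0 := mul_nonpos_of_nonpos_of_nonneg (not_lt.1 hneg) (by positivity)
    have := Real.exp_pos (c * L)
    linarith
  have hsz : Real.exp (c / 2 * L) ≤ |(a' : ℝ)| := by
    have h3 : |(h a : ℝ)| / g = |(a' : ℝ)| := by
      rw [ha']
      push_cast
      have h4 : (0 : ℝ) < g := by exact_mod_cast hg0
      rw [abs_mul, abs_of_pos h4]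
      field_simp
    rw [h3] at hq
    have h4 := (hL3 L hLb).trans hq
    exact le_of_mul_le_mul_left h4 hC0
  rcases lt_or_gt_of_ne ha'0 with hneg | hpos
  · refine ⟨x, h, a, b, - b', - a', hsp, fun l i => (hx l i).trans (hL2 i L (hLc i)), hab, hha,
      by omega, hcop.neg_neg, ?_, ?_⟩
    · rw [hfr]
      push_cast
      rw [neg_div_neg_eq]
    · rw [abs_of_neg (by exact_mod_cast hneg)] at hsz
      push_cast
      exact hsz
  · refine ⟨x, h, a, b, b', a', hsp, fun l i => (hx l i).trans (hL2 i L (hLc i)), hab, hha,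
      hpos, hcop, hfr, ?_⟩
    rw [abs_of_pos (by exact_mod_cast hpos)] at hsz
    exact hsz

theorem exists_gcd_le (h u : Fin 3 → ℤ) (hu : ∑ i, u i * h i = 1) (a : Fin 3) (ha : h a ≠ 0) :
    ∃ b, a ≠ b ∧ ((Int.gcd (h a) (h b) : ℕ) : ℤ) ^ 2 ≤ |h a| := by
  have key : ∀ b b' : Fin 3, a ≠ b → a ≠ b' → (u a * h a + u b * h b + u b' * h b' = 1) →
      ∃ b, a ≠ b ∧ ((Int.gcd (h a) (h b) : ℕ) : ℤ) ^ 2 ≤ |h a| := by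
    intro b b' hb hb' hs
    have hcop : IsCoprime ((Int.gcd (h a) (h b) : ℕ) : ℤ) ((Int.gcd (h a) (h b') : ℕ) : ℤ) := by
      rw [Int.isCoprime_iff_gcd_eq_one]
      have hd1 := Int.gcd_dvd_left ((Int.gcd (h a) (h b) : ℕ) : ℤ) ((Int.gcd (h a) (h b') : ℕ) : ℤ)
      have hd2 := Int.gcd_dvd_right ((Int.gcd (h a) (h b) : ℕ) : ℤ) ((Int.gcd (h a) (h b') : ℕ) : ℤ)
      have e1 := hd1.trans (Int.gcd_dvd_left (h a) (h b))
      have e2 := hd1.trans (Int.gcd_dvd_right (h a) (h b))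
      have e3 := hd2.trans (Int.gcd_dvd_right (h a) (h b'))
      have e4 := dvd_add (dvd_add (e1.mul_left (u a)) (e2.mul_left (u b))) (e3.mul_left (u b'))
      rw [hs] at e4
      have := Int.eq_one_of_dvd_one (by positivity) e4
      exact_mod_cast this
    have hdvd := hcop.mul_dvd (Int.gcd_dvd_left (h a) (h b)) (Int.gcd_dvd_left (h a) (h b'))
    have hle : ((Int.gcd (h a) (h b) : ℕ) : ℤ) * ((Int.gcd (h a) (h b') : ℕ) : ℤ) ≤ |h a| :=
      Int.le_of_dvd (abs_pos.2 ha) ((dvd_abs _ _).2 hdvd)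
    rcases le_total ((Int.gcd (h a) (h b) : ℕ) : ℤ) ((Int.gcd (h a) (h b') : ℕ) : ℤ) with hl | hl
    · refine ⟨b, hb, le_trans ?_ hle⟩
      rw [sq]
      exact mul_le_mul_of_nonneg_left hl (by positivity)
    · refine ⟨b', hb', le_trans ?_ hle⟩
      rw [sq]
      exact mul_le_mul_of_nonneg_right hl (by positivity)
  rw [Fin.sum_univ_three] at hu
  fin_cases a
  · exact key 1 2 (by decide) (by decide) (by simpa using hu)
  · exact key 0 2 (by decide) (by decide) (by simp; linarith)
  · exact key 0 1 (by decide) (by decide) (by simp; linarith)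

theorem thmA3 (A B : Matrix (Fin 3) (Fin 3) ℝ) (hBA : B * A = 1)
    (hB : ∀ i l, IsAlgebraic ℤ (B i l)) (γ : Fin 3 → ℝ) (hγ : ∑ i, γ i < 0) (c : ℝ) (hc : 0 < c)
    (C : ℝ) :
    ∃ L0, ∀ L, L0 ≤ L → ∀ (x : ι → Fin 3 → ℤ) (h u : Fin 3 → ℤ) (a : Fin 3),
    (∀ v : Fin 3 → ℚ, ∑ i, (h i : ℚ) * v i = 0 →
      v ∈ Submodule.span ℚ (Set.range (fun l i => (x l i : ℚ)))) →
    (∀ l i, |∑ k, A i k * x l k| ≤ C * Real.exp (γ i * L)) →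
    ∑ i, u i * h i = 1 → Real.exp (c * L) ≤ C * |(h a : ℝ)| → False := by
  obtain ⟨L0, hL0⟩ := thmA' (ι := ι) (by norm_num) A B hBA hB γ hγ (c / 2) (by positivity) (|C| + 1)
  refine ⟨L0, fun L hL x h u a hsp hx hu hq => ?_⟩
  have hha : h a ≠ 0 := by
    intro h0
    rw [h0] at hq
    have := Real.exp_pos (c * L)
    simp at hq
    linarith
  obtain ⟨b, hab, hb⟩ := exists_gcd_le h u hu a hha
  refine hL0 L hL x h a b hsp (fun l i => (hx l i).trans ?_) hab hha ?_
  · apply mul_le_mul_of_nonneg_right _ (Real.exp_pos _).le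
    linarith [le_abs_self C]
  · have hg0 : 0 < Int.gcd (h a) (h b) := Int.gcd_pos_of_ne_zero_left _ hha
    have hg0' : (0 : ℝ) < Int.gcd (h a) (h b) := by exact_mod_cast hg0
    have hb' : ((Int.gcd (h a) (h b) : ℕ) : ℝ) ^ 2 ≤ |(h a : ℝ)| := by exact_mod_cast hb
    rw [← mul_div_assoc, le_div_iff₀ hg0']
    apply le_of_sq_le_sq _ (by positivity)
    rw [mul_pow, ← Real.exp_nat_mul]
    have e1 : ((2 : ℕ) : ℝ) * (c / 2 * L) = c * L := by push_cast; ring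
    rw [e1, mul_pow]
    have h1 : Real.exp (c * L) ≤ (|C| + 1) ^ 2 * |(h a : ℝ)| := by
      refine hq.trans (mul_le_mul_of_nonneg_right ?_ (abs_nonneg _))
      nlinarith [abs_nonneg C, le_abs_self C]
    calc _ ≤ (|C| + 1) ^ 2 * |(h a : ℝ)| * |(h a : ℝ)| := by
          apply mul_le_mul h1 hb' (by positivity) (by positivity)
      _ = _ := by ring

end
end ABT
end

section
namespace ABT
set_option linter.unusedSectionVars false
set_option linter.unusedSimpArgs false

/-- value of the quadratic polynomial with coefficients `R` -/
def ev (α : ℝ) (R : Fin 3 → ℤ) : ℝ := R 0 + R 1 * α + R 2 * α ^ 2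

theorem ev_add (α : ℝ) (R S : Fin 3 → ℤ) : ev α (R + S) = ev α R + ev α S := by
  simp only [ev, Pi.add_apply]
  push_cast
  ring

theorem ev_zero (α : ℝ) : ev α 0 = 0 := by simp [ev]

/-- the weighted embedding -/
noncomputable def wemb (α A B : ℝ) : (Fin 3 → ℤ) →ₗ[ℤ] EuclideanSpace ℝ (Fin 3) :=
  AddMonoidHom.toIntLinearMap
  { toFun := fun R => WithLp.toLp 2 ![A * ev α R, B * R 1, B * R 2]
    map_zero' := by
      ext i
      fin_cases i <;> simp [ev_zero]
    map_add' := by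
      intro R S
      ext i
      fin_cases i <;> simp [ev_add, mul_add] }

theorem wemb_apply (α A B : ℝ) (R : Fin 3 → ℤ) :
    wemb α A B R = WithLp.toLp 2 ![A * ev α R, B * R 1, B * R 2] := rfl

theorem wemb_ge0 (α A B : ℝ) (R : Fin 3 → ℤ) : |A * ev α R| ≤ ‖wemb α A B R‖ := by
  have := PiLp.norm_apply_le (wemb α A B R) 0
  simpa [wemb_apply] using this

theorem wemb_ge1 (α A B : ℝ) (R : Fin 3 → ℤ) : |B * R 1| ≤ ‖wemb α A B R‖ := by
  have := PiLp.norm_apply_le (wemb α A B R) 1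
  simpa [wemb_apply] using this

theorem wemb_ge2 (α A B : ℝ) (R : Fin 3 → ℤ) : |B * R 2| ≤ ‖wemb α A B R‖ := by
  have := PiLp.norm_apply_le (wemb α A B R) 2
  simpa [wemb_apply] using this

theorem wemb_le (α A B : ℝ) (R : Fin 3 → ℤ) :
    ‖wemb α A B R‖ ≤ |A * ev α R| + |B * R 1| + |B * R 2| := by
  rw [EuclideanSpace.norm_eq]
  apply Real.sqrt_le_iff.2
  refine ⟨by positivity, ?_⟩
  simp only [wemb_apply, Fin.sum_univ_three, Real.norm_eq_abs]
  simp only [Matrix.cons_val_zero, Matrix.cons_val_one, Matrix.cons_val]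
  have h1 := abs_nonneg (A * ev α R)
  have h2 := abs_nonneg (B * (R 1 : ℝ))
  have h3 := abs_nonneg (B * (R 2 : ℝ))
  nlinarith [mul_nonneg h1 h2, mul_nonneg h1 h3, mul_nonneg h2 h3]

theorem wemb_finite (α A B : ℝ) (hA : 0 < A) (hB : 0 < B) (D : ℝ) :
    {R | ‖wemb α A B R‖ ≤ D}.Finite := by
  set K : ℤ := ⌈D / A + (D / B) * (1 + |α| + α ^ 2)⌉ with hK
  apply (Set.finite_Icc (fun _ : Fin 3 => - K) (fun _ => K)).subset
  intro R hR
  simp only [Set.mem_ofPred_eq] at hR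
  have hK' : D / A + (D / B) * (1 + |α| + α ^ 2) ≤ K := Int.le_ceil _
  have hD : 0 ≤ D := (norm_nonneg _).trans hR
  have hDA : 0 ≤ D / A := by positivity
  have hDB : 0 ≤ D / B := by positivity
  have h0 : |ev α R| ≤ D / A := by
    rw [le_div_iff₀ hA]
    have := (wemb_ge0 α A B R).trans hR
    rw [abs_mul, abs_of_pos hA] at this
    linarith
  have h1 : |(R 1 : ℝ)| ≤ D / B := by
    rw [le_div_iff₀ hB]
    have := (wemb_ge1 α A B R).trans hR
    rw [abs_mul, abs_of_pos hB] at this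
    linarith
  have h2 : |(R 2 : ℝ)| ≤ D / B := by
    rw [le_div_iff₀ hB]
    have := (wemb_ge2 α A B R).trans hR
    rw [abs_mul, abs_of_pos hB] at this
    linarith
  have h3 : |(R 0 : ℝ)| ≤ |ev α R| + |(R 1 : ℝ)| * |α| + |(R 2 : ℝ)| * α ^ 2 := by
    have : (R 0 : ℝ) = ev α R - R 1 * α - R 2 * α ^ 2 := by simp only [ev]; ring
    rw [this]
    refine (abs_sub _ _).trans ((add_le_add_left (abs_sub _ _) _).trans ?_)
    rw [abs_mul, abs_mul, abs_of_nonneg (sq_nonneg α)]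
  have e1 := mul_le_mul_of_nonneg_right h1 (abs_nonneg α)
  have e2 := mul_le_mul_of_nonneg_right h2 (sq_nonneg α)
  have e3 : 0 ≤ D / B * |α| := by positivity
  have e4 : 0 ≤ D / B * α ^ 2 := by positivity
  have hall : ∀ i, |(R i : ℝ)| ≤ K := by
    intro i
    fin_cases i
    · simp only [Fin.zero_eta]
      nlinarith
    · simp only [Fin.mk_one]
      nlinarith
    · simp only [Fin.reduceFinMk]
      nlinarith
  have hall' : ∀ i, |R i| ≤ K := fun i => by exact_mod_cast hall i
  exact ⟨fun i => (abs_le.1 (hall' i)).1, fun i => (abs_le.1 (hall' i)).2⟩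

theorem le_of_mul_nat {a b d : ℝ} (h : ∀ N : ℕ, 1 ≤ N → N * a ≤ N * b + d) : a ≤ b := by
  by_contra hlt
  push Not at hlt
  obtain ⟨N, hN⟩ := exists_nat_gt (d / (a - b))
  have hab : 0 < a - b := by linarith
  rw [div_lt_iff₀ hab] at hN
  have h1 := h (N + 1) (by omega)
  push_cast at h1
  nlinarith

/-- vectors read off from functionals on `ℤ³` with bounded weighted norm -/
theorem functional_bounds (α A B K : ℝ) (hA : 0 < A) (hB : 0 < B) (hK : 0 ≤ K)
    (y : (Fin 3 → ℤ) →ₗ[ℤ] ℤ) (hy : ∀ v, |((y v : ℤ) : ℝ)| ≤ K * ‖wemb α A B v‖) :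
    |((y (Pi.single 0 1) : ℤ) : ℝ)| ≤ K * A ∧
    |((y (Pi.single 1 1) : ℤ) : ℝ) - α * y (Pi.single 0 1)| ≤ K * B ∧
    |((y (Pi.single 2 1) : ℤ) : ℝ) - α ^ 2 * y (Pi.single 0 1)| ≤ K * B := by
  have key : ∀ (j : Fin 3) (β : ℝ), (∀ N : ℕ, ‖wemb α A B ((N : ℤ) • Pi.single j 1 -
      round (N * β) • Pi.single 0 1)‖ ≤ N * B + A) →
      |((y (Pi.single j 1) : ℤ) : ℝ) - β * y (Pi.single 0 1)| ≤ K * B := by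
    intro j β hN
    apply le_of_mul_nat (d := K * A + |((y (Pi.single 0 1) : ℤ) : ℝ)|)
    intro N _
    have h1 := (hy ((N : ℤ) • Pi.single j 1 - round (N * β) • Pi.single 0 1)).trans
      (mul_le_mul_of_nonneg_left (hN N) hK)
    rw [map_sub, map_smul, map_smul] at h1
    simp only [smul_eq_mul] at h1
    push_cast at h1
    have h2 : (N : ℝ) * (((y (Pi.single j 1) : ℤ) : ℝ) - β * y (Pi.single 0 1)) =
        (N * ((y (Pi.single j 1) : ℤ) : ℝ) - round (N * β) * ((y (Pi.single 0 1) : ℤ) : ℝ)) -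
        (N * β - round (N * β)) * ((y (Pi.single 0 1) : ℤ) : ℝ) := by ring
    have h3 : (N : ℝ) * |((y (Pi.single j 1) : ℤ) : ℝ) - β * y (Pi.single 0 1)| =
        |(N : ℝ) * (((y (Pi.single j 1) : ℤ) : ℝ) - β * y (Pi.single 0 1))| := by
      rw [abs_mul, Nat.abs_cast]
    rw [h3, h2]
    refine (abs_sub _ _).trans ?_
    have h4 : |(N * β - round (N * β)) * ((y (Pi.single 0 1) : ℤ) : ℝ)| ≤
        |((y (Pi.single 0 1) : ℤ) : ℝ)| := by
      rw [abs_mul]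
      apply mul_le_of_le_one_left (abs_nonneg _)
      have := abs_sub_round ((N : ℝ) * β)
      linarith
    nlinarith
  refine ⟨?_, ?_, ?_⟩
  · refine (hy _).trans (mul_le_mul_of_nonneg_left ?_ hK)
    refine (wemb_le α A B _).trans ?_
    simp [ev, abs_of_pos hA]
  · apply key 1 α
    intro N
    refine (wemb_le α A B _).trans ?_
    have h1 := abs_sub_round ((N : ℝ) * α)
    have h2 : ev α ((N : ℤ) • Pi.single 1 1 - round (N * α) • Pi.single 0 1) =
        N * α - round (N * α) := by
      simp [ev]
      ring
    rw [h2, abs_mul, abs_of_pos hA]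
    simp [abs_mul, abs_of_pos hB]
    nlinarith
  · apply key 2 (α ^ 2)
    intro N
    refine (wemb_le α A B _).trans ?_
    have h1 := abs_sub_round ((N : ℝ) * α ^ 2)
    have h2 : ev α ((N : ℤ) • Pi.single 2 1 - round (N * α ^ 2) • Pi.single 0 1) =
        N * α ^ 2 - round (N * α ^ 2) := by
      simp [ev]
      ring
    rw [h2, abs_mul, abs_of_pos hA]
    simp [abs_mul, abs_of_pos hB]
    nlinarith

theorem functional_eq {F : Type} [AddCommGroup F] (y : (Fin 3 → ℤ) →ₗ[ℤ] F) (v : Fin 3 → ℤ) :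
    y v = ∑ i, v i • y (Pi.single i 1) := by
  conv_lhs => rw [pi_eq_sum_univ' v]
  rw [map_sum]
  apply Finset.sum_congr rfl
  intro i _
  rw [map_smul]

/-- the functional given by a vector -/
noncomputable def vecFun (v : Fin 3 → ℚ) : (Fin 3 → ℤ) →ₗ[ℤ] ℚ :=
  AddMonoidHom.toIntLinearMap
  { toFun := fun R => ∑ i, (R i : ℚ) * v i
    map_zero' := by simp
    map_add' := by
      intro R S
      simp [add_mul, Finset.sum_add_distrib] }

theorem vecFun_apply (v : Fin 3 → ℚ) (R : Fin 3 → ℤ) : vecFun v R = ∑ i, (R i : ℚ) * v i := rfl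

theorem lam_bound (α A B : ℝ) (hB : 0 < B) (hAB : 1 ≤ A * B⁻¹) (R : Fin 3 → ℤ)
    (hR : (∃ i, B⁻¹ ≤ |(R i : ℝ)|) ∨ A⁻¹ ≤ |ev α R|) :
    1 / (1 + |α| + α ^ 2) ≤ ‖wemb α A B R‖ := by
  have hA : 0 < A := by
    by_contra hneg
    have : A * B⁻¹ ≤ 0 := mul_nonpos_of_nonpos_of_nonneg (not_lt.1 hneg) (by positivity)
    linarith
  have hden : 1 ≤ 1 + |α| + α ^ 2 := by nlinarith [abs_nonneg α, sq_nonneg α]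
  have hle1 : 1 / (1 + |α| + α ^ 2) ≤ 1 := by
    rw [div_le_one (by linarith)]
    exact hden
  have g0 := wemb_ge0 α A B R
  have g1 := wemb_ge1 α A B R
  have g2 := wemb_ge2 α A B R
  rw [abs_mul, abs_of_pos hA] at g0
  rw [abs_mul, abs_of_pos hB] at g1 g2
  rcases hR with ⟨i, hi⟩ | h
  · have hi' : 1 ≤ B * |(R i : ℝ)| := by
      have := mul_le_mul_of_nonneg_left hi hB.le
      rwa [mul_inv_cancel₀ hB.ne'] at this
    fin_cases i
    · simp only [Fin.zero_eta] at hi'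
      have h3 : |(R 0 : ℝ)| ≤ |ev α R| + |(R 1 : ℝ)| * |α| + |(R 2 : ℝ)| * α ^ 2 := by
        have : (R 0 : ℝ) = ev α R - R 1 * α - R 2 * α ^ 2 := by simp only [ev]; ring
        rw [this]
        refine (abs_sub _ _).trans ((add_le_add_left (abs_sub _ _) _).trans ?_)
        rw [abs_mul, abs_mul, abs_of_nonneg (sq_nonneg α)]
      have hBA : B ≤ A := by
        have := mul_le_mul_of_nonneg_right hAB hB.le
        rwa [mul_assoc, inv_mul_cancel₀ hB.ne', one_mul, mul_one] at this
      rw [div_le_iff₀ (by linarith)]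
      have e0 : B * |ev α R| ≤ ‖wemb α A B R‖ :=
        (mul_le_mul_of_nonneg_right hBA (abs_nonneg _)).trans g0
      have e1 := mul_le_mul_of_nonneg_right g1 (abs_nonneg α)
      have e2 := mul_le_mul_of_nonneg_right g2 (sq_nonneg α)
      have e3 := mul_le_mul_of_nonneg_left h3 hB.le
      nlinarith
    · simp only [Fin.mk_one] at hi'
      linarith
    · simp only [Fin.reduceFinMk] at hi'
      linarith
  · have := mul_le_mul_of_nonneg_left h hA.le
    rw [mul_inv_cancel₀ hA.ne'] at this
    linarith

end ABT
end

section
namespace ABT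
set_option linter.unusedSectionVars false
set_option linter.unusedSimpArgs false

/-- matrix of the dual forms -/
noncomputable def dA (α : ℝ) : Matrix (Fin 3) (Fin 3) ℝ :=
  !![1, 0, 0; -α, 1, 0; -α ^ 2, 0, 1]
noncomputable def dB (α : ℝ) : Matrix (Fin 3) (Fin 3) ℝ :=
  !![1, 0, 0; α, 1, 0; α ^ 2, 0, 1]

theorem dB_mul_dA (α : ℝ) : dB α * dA α = 1 := by
  ext i j
  fin_cases i <;> fin_cases j <;> simp [dA, dB, Matrix.mul_apply, Fin.sum_univ_three]

theorem dB_alg {α : ℝ} (hα : IsAlgebraic ℤ α) (i l : Fin 3) : IsAlgebraic ℤ (dB α i l) := by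
  fin_cases i <;> fin_cases l <;>
    simp [dB, hα, hα.pow 2, isAlgebraic_zero, isAlgebraic_one]

theorem prim_of_unit (P u : Fin 3 → ℤ) (hu : ∑ i, u i * P i = 1) (n : ℤ) (v : Fin 3 → ℤ)
    (hn : n ≠ 0) (h : n • v ∈ Submodule.span ℤ {P}) : v ∈ Submodule.span ℤ {P} := by
  rw [Submodule.mem_span_singleton] at h ⊢
  obtain ⟨c, hc⟩ := h
  refine ⟨∑ i, u i * v i, ?_⟩
  have h1 : n * ∑ i, u i * v i = c := by
    have : ∀ i, n * v i = c * P i := fun i => by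
      have := congrFun hc i
      simpa using this.symm
    calc n * ∑ i, u i * v i = ∑ i, u i * (n * v i) := by
          rw [Finset.mul_sum]; apply Finset.sum_congr rfl; intros; ring
      _ = c * ∑ i, u i * P i := by
          rw [Finset.mul_sum]; apply Finset.sum_congr rfl; intro i _; rw [this]; ring
      _ = c := by rw [hu, mul_one]
  ext i
  have h2 := congrFun hc i
  simp only [Pi.smul_apply, smul_eq_mul] at h2 ⊢
  apply mul_left_cancel₀ hn
  rw [← mul_assoc, h1, h2]

set_option maxHeartbeats 2000000 in
theorem dual_case (α : ℝ) (hα : IsAlgebraic ℤ α) (s ε : ℝ) (hs : 0 < s) (hε : 0 < ε)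
    (h1 : 1 - s - ε < 0) (h2 : 2 * s - ε - 5 / 2 < 0) :
    ∃ L0 : ℝ, ∀ L, L0 ≤ L → ∀ (P u : Fin 3 → ℤ) (a : Fin 3), ∑ i, u i * P i = 1 →
      (∀ i, |(P i : ℝ)| ≤ Real.exp L) → Real.exp L ≤ |(P a : ℝ)| →
      |ev α P| ≤ Real.exp (-(5 / 2) * L) →
      ∃ R : Fin 3 → ℤ, R ∉ Submodule.span ℤ {P} ∧ (∀ i, |(R i : ℝ)| ≤ Real.exp ((s + ε) * L)) ∧
        |ev α R| ≤ Real.exp ((-2 * s + ε) * L) := by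
  obtain ⟨C, hC, hT⟩ := transf 2
  set lam : ℝ := 1 / (1 + |α| + α ^ 2) with hlam
  have hlam0 : 0 < lam := by positivity
  set K : ℝ := 2 * C / lam with hK
  have hK0 : 0 < K := by positivity
  obtain ⟨L1, hL1⟩ := thmA3 (ι := Fin 2) (dA α) (dB α) (dB_mul_dA α) (dB_alg hα)
    ![2 * s - ε, -(s + ε), -(s + ε)] (by simp [Fin.sum_univ_three]; linarith) 1 one_pos (K + 1)
  obtain ⟨L2, hL2⟩ := exp_absorb (3 / lam) (a := 2 * s - ε - 5 / 2) (b := 0) h2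
  obtain ⟨L3, hL3⟩ := exp_absorb (3 / lam) (a := 1 - s - ε) (b := 0) h1
  refine ⟨max 0 (max L1 (max L2 L3)), ?_⟩
  intro L hL P u a hu hP ha hev
  simp only [max_le_iff] at hL
  obtain ⟨hL0, hLL1, hLL2, hLL3⟩ := hL
  by_contra hno
  push Not at hno
  set A := Real.exp ((2 * s - ε) * L) with hA
  set B := Real.exp (-(s + ε) * L) with hB
  have hA0 : 0 < A := Real.exp_pos _
  have hB0 : 0 < B := Real.exp_pos _
  have hAinv : A⁻¹ = Real.exp ((-2 * s + ε) * L) := by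
    rw [hA, ← Real.exp_neg]; congr 1; ring
  have hBinv : B⁻¹ = Real.exp ((s + ε) * L) := by
    rw [hB, ← Real.exp_neg]; congr 1; ring
  have hPne : P ≠ 0 := by
    rintro rfl
    simp at hu
  have hPa : P a ≠ 0 := by
    intro h
    rw [h] at ha
    simp at ha
    linarith [Real.exp_pos L]
  have hmin : ∀ v, v ∉ Submodule.span ℤ {P} → lam ≤ ‖wemb α A B v‖ := by
    intro v hv
    apply lam_bound α A B hB0
    · rw [hA, hBinv, ← Real.exp_add]
      apply Real.one_le_exp
      nlinarith [mul_nonneg hs.le hL0]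
    · by_cases hh : ∀ i, |(v i : ℝ)| ≤ Real.exp ((s + ε) * L)
      · right
        rw [hAinv]
        exact (hno v hv hh).le
      · left
        push Not at hh
        obtain ⟨i, hi⟩ := hh
        exact ⟨i, by rw [hBinv]; exact hi.le⟩
  have hsmall : ‖wemb α A B P‖ ≤ lam := by
    refine (wemb_le α A B P).trans ?_
    have e0 : |A * ev α P| ≤ lam / 3 := by
      rw [abs_mul, abs_of_pos hA0]
      have := mul_le_mul_of_nonneg_left hev hA0.le
      rw [hA, ← Real.exp_add] at this
      have h3 := hL2 L hLL2
      rw [zero_mul, Real.exp_zero, div_mul_eq_mul_div, div_le_one hlam0] at h3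
      rw [show (2 * s - ε) * L + -(5 / 2) * L = (2 * s - ε - 5 / 2) * L by ring] at this
      linarith
    have e1 : ∀ i, |B * P i| ≤ lam / 3 := by
      intro i
      rw [abs_mul, abs_of_pos hB0]
      have := mul_le_mul_of_nonneg_left (hP i) hB0.le
      rw [hB, ← Real.exp_add] at this
      have h3 := hL3 L hLL3
      rw [zero_mul, Real.exp_zero, div_mul_eq_mul_div, div_le_one hlam0] at h3
      rw [show -(s + ε) * L + L = (1 - s - ε) * L by ring] at this
      linarith
    linarith [e1 1, e1 2]
  have hne : wemb α A B P ≠ 0 := by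
    intro h0
    have g0 := wemb_ge0 α A B P
    have g1 := wemb_ge1 α A B P
    have g2 := wemb_ge2 α A B P
    rw [h0, norm_zero] at g0 g1 g2
    have f0 := abs_eq_zero.1 (le_antisymm g0 (abs_nonneg _))
    have f1 := abs_eq_zero.1 (le_antisymm g1 (abs_nonneg _))
    have f2 := abs_eq_zero.1 (le_antisymm g2 (abs_nonneg _))
    have f0' := (mul_eq_zero.1 f0).resolve_left hA0.ne'
    have f1' := (mul_eq_zero.1 f1).resolve_left hB0.ne'
    have f2' := (mul_eq_zero.1 f2).resolve_left hB0.ne'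
    rw [ev, f1', f2'] at f0'
    simp at f0'
    apply hPne
    ext i
    fin_cases i
    · exact f0'
    · exact_mod_cast f1'
    · exact_mod_cast f2'
  obtain ⟨y, hy1, hy2, hy3⟩ := transf_quot hC hT (Fin 3 → ℤ) (by simp) (wemb α A B) lam hlam0
    (wemb_finite α A B hA0 hB0) P hne hsmall (fun n v hn h => prim_of_unit P u hu n v hn h) hmin
  refine hL1 L hLL1 (fun l i => y l (Pi.single i 1)) P u a ?_ ?_ hu ?_
  · intro v hv
    obtain ⟨c, hc⟩ := hy3 ℚ (vecFun v) hv
    have : v = ∑ l, c l • (fun i => ((y l (Pi.single i 1) : ℤ) : ℚ)) := by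
      ext i
      have := hc (Pi.single i 1)
      rw [vecFun_apply] at this
      simp only [Finset.sum_apply, Pi.smul_apply, smul_eq_mul]
      rw [← this]
      rw [Finset.sum_eq_single i]
      · simp
      · intro j _ hj
        simp [hj]
      · simp
    rw [this]
    apply Submodule.sum_mem
    intro l _
    apply Submodule.smul_mem
    exact Submodule.subset_span ⟨l, rfl⟩
  · intro l i
    obtain ⟨b0, b1, b2⟩ := functional_bounds α A B K hA0 hB0 hK0.le (y l) (hy1 l)
    have hKA : K * A ≤ (K + 1) * A := by nlinarith
    have hKB : K * B ≤ (K + 1) * B := by nlinarith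
    fin_cases i
    · simp [dA, Fin.sum_univ_three]
      linarith
    · simp [dA, Fin.sum_univ_three]
      refine le_trans (le_of_eq ?_) (b1.trans (hKB.trans (le_of_eq ?_)))
      · congr 1; ring
      · rw [hB]; congr 2; ring
    · simp [dA, Fin.sum_univ_three]
      refine le_trans (le_of_eq ?_) (b2.trans (hKB.trans (le_of_eq ?_)))
      · congr 1; ring
      · rw [hB]; congr 2; ring
  · rw [one_mul]
    nlinarith [abs_nonneg (P a : ℝ)]

end ABT
end

section
namespace ABT
set_option linter.unusedSectionVars false
set_option linter.unusedSimpArgs false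

/-- cross product -/
def cr (P R : Fin 3 → ℤ) : Fin 3 → ℤ :=
  ![P 1 * R 2 - P 2 * R 1, P 2 * R 0 - P 0 * R 2, P 0 * R 1 - P 1 * R 0]

theorem exists_primitive (X : Fin 3 → ℤ) (hX : X ≠ 0) :
    ∃ (g : ℤ) (h v : Fin 3 → ℤ), g ≠ 0 ∧ (∀ i, X i = g * h i) ∧ ∑ i, v i * h i = 1 := by
  set I : Ideal ℤ := Ideal.span (Set.range X) with hI
  set g := Submodule.IsPrincipal.generator I with hg
  have hgen : ∀ i, g ∣ X i := by
    intro i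
    have h1 : X i ∈ I := Ideal.subset_span ⟨i, rfl⟩
    exact (Submodule.IsPrincipal.mem_iff_generator_dvd I).1 h1
  choose h hh using hgen
  have hgI : g ∈ I := Submodule.IsPrincipal.generator_mem I
  rw [hI, Ideal.mem_span_range_iff_exists_fun] at hgI
  obtain ⟨v, hv⟩ := hgI
  have hg0 : g ≠ 0 := by
    intro h0
    apply hX
    ext i
    rw [hh i, h0]
    simp
  refine ⟨g, h, v, hg0, hh, ?_⟩
  apply mul_left_cancel₀ hg0
  rw [mul_one, Finset.mul_sum]
  conv_rhs => rw [← hv]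
  apply Finset.sum_congr rfl
  intro i _
  rw [hh i]
  ring

theorem cr_par (X h v : Fin 3 → ℤ) (hv : ∑ i, v i * h i = 1) (hX : cr X h = 0) (i : Fin 3) :
    X i = (∑ j, v j * X j) * h i := by
  have e0 := congrFun hX 0
  have e1 := congrFun hX 1
  have e2 := congrFun hX 2
  simp [cr] at e0 e1 e2
  rw [Fin.sum_univ_three] at hv ⊢
  fin_cases i
  · simp only [Fin.zero_eta]
    linear_combination (-X 0) * hv - v 2 * e1 + v 1 * e2
  · simp only [Fin.mk_one]
    linear_combination (-X 1) * hv - v 0 * e2 + v 2 * e0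
  · simp only [Fin.reduceFinMk]
    linear_combination (-X 2) * hv - v 1 * e0 + v 0 * e1

theorem not_mem_cr (P u R : Fin 3 → ℤ) (hu : ∑ i, u i * P i = 1)
    (hR : R ∉ Submodule.span ℤ {P}) : cr P R ≠ 0 := by
  intro h
  apply hR
  rw [Submodule.mem_span_singleton]
  refine ⟨∑ j, u j * R j, ?_⟩
  ext i
  simp only [Pi.smul_apply, smul_eq_mul]
  refine (cr_par R P u hu ?_ i).symm
  have e0 := congrFun h 0
  have e1 := congrFun h 1
  have e2 := congrFun h 2
  simp [cr] at e0 e1 e2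
  ext j
  fin_cases j <;> simp [cr] <;> linarith

theorem liouville_rat (α : ℝ) (hα : IsAlgebraic ℤ α) (hirr : Irrational α) :
    ∃ (D : ℕ) (c : ℝ), 0 < c ∧ ∀ (q p : ℤ), q ≠ 0 →
      1 ≤ c * |(q : ℝ)| ^ D * |(p : ℝ) - α * q| := by
  obtain ⟨f, hf0, hf⟩ := hα
  obtain ⟨A, hA, hAA⟩ := Liouville.exists_pos_real_of_irrational_root hirr hf0
    (by rw [Polynomial.eval_map_algebraMap]; exact hf)
  refine ⟨f.natDegree, A, hA, ?_⟩
  have key : ∀ (q : ℕ) (p : ℤ), q ≠ 0 → 1 ≤ A * (q : ℝ) ^ f.natDegree * |(p : ℝ) - α * q| := by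
    intro q p hq
    obtain ⟨b, rfl⟩ := Nat.exists_eq_succ_of_ne_zero hq
    have h1 := hAA p b
    refine h1.trans ?_
    have hb : (0 : ℝ) < (b : ℝ) + 1 := by positivity
    have h2 : |α - p / (b + 1)| = |(p : ℝ) - α * ((b : ℝ) + 1)| / ((b : ℝ) + 1) := by
      rw [← abs_of_pos hb, ← abs_div, abs_of_pos hb, abs_sub_comm]
      congr 1
      field_simp
    rw [h2]
    push_cast
    have h3 : |(p : ℝ) - α * ((b : ℝ) + 1)| / ((b : ℝ) + 1) ≤ |(p : ℝ) - α * ((b : ℝ) + 1)| :=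
      div_le_self (abs_nonneg _) (by linarith [(Nat.cast_nonneg b : (0 : ℝ) ≤ b)])
    calc ((b : ℝ) + 1) ^ f.natDegree * (|(p : ℝ) - α * ((b : ℝ) + 1)| / ((b : ℝ) + 1) * A)
        ≤ ((b : ℝ) + 1) ^ f.natDegree * (|(p : ℝ) - α * ((b : ℝ) + 1)| * A) := by gcongr
      _ = _ := by ring
  intro q p hq
  rcases le_total 0 q with h | h
  · obtain ⟨n, rfl⟩ := Int.eq_ofNat_of_zero_le h
    have := key n p (by simpa using hq)
    simpa using this
  · obtain ⟨n, hn⟩ := Int.eq_ofNat_of_zero_le (neg_nonneg.2 h)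
    have hq' : q = -(n : ℤ) := by omega
    subst hq'
    have := key n (-p) (by simpa using hq)
    refine this.trans (le_of_eq ?_)
    push_cast
    rw [abs_neg, Nat.abs_cast, ← abs_neg]
    congr 2
    ring

theorem shift_small (r p : ℤ) (hp : p ≠ 0) : ∃ n : ℤ, |r + n * p| ≤ |p| := by
  refine ⟨-(r / p), ?_⟩
  have h1 := Int.emod_add_mul_ediv r p
  have h2 := Int.emod_nonneg r hp
  have h3 := Int.emod_lt_abs r hp
  have : r + -(r / p) * p = r % p := by linarith [mul_comm p (r / p)]
  rw [this, abs_of_nonneg h2]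
  exact h3.le

/-- Algebraic normalisation of the second vector. -/
theorem exists_normalized (P u R : Fin 3 → ℤ) (a : Fin 3) (hu : ∑ i, u i * P i = 1)
    (hPa : P a ≠ 0) (hR : R ∉ Submodule.span ℤ {P}) :
    ∃ (g : ℤ) (h v R' : Fin 3 → ℤ), g ≠ 0 ∧ (∀ i, cr P R i = g * h i) ∧ ∑ i, v i * h i = 1 ∧
      cr P R' = h ∧ |R' a| ≤ |P a| := by
  obtain ⟨g, h, v, hg, hh, hv⟩ := exists_primitive (cr P R) (not_mem_cr P u R hu hR)
  obtain ⟨n, hn⟩ := shift_small (cr h u a) (P a) hPa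
  have hPh : P 0 * h 0 + P 1 * h 1 + P 2 * h 2 = 0 := by
    apply mul_left_cancel₀ hg
    have e0 := hh 0
    have e1 := hh 1
    have e2 := hh 2
    simp [cr] at e0 e1 e2
    linear_combination (-P 0) * e0 - P 1 * e1 - P 2 * e2
  refine ⟨g, h, v, fun i => cr h u i + n * P i, hg, hh, hv, ?_, hn⟩
  rw [Fin.sum_univ_three] at hu
  ext i
  fin_cases i
  · simp [cr]
    linear_combination h 0 * hu - u 0 * hPh
  · simp [cr]
    linear_combination h 1 * hu - u 1 * hPh
  · simp [cr]
    linear_combination h 2 * hu - u 2 * hPh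

end ABT
end

section
namespace ABT
set_option linter.unusedSectionVars false
set_option linter.unusedSimpArgs false

noncomputable def pA (α : ℝ) : Matrix (Fin 3) (Fin 3) ℝ :=
  !![1, α, α ^ 2; 0, 1, 0; 0, 0, 1]
noncomputable def pB (α : ℝ) : Matrix (Fin 3) (Fin 3) ℝ :=
  !![1, -α, -α ^ 2; 0, 1, 0; 0, 0, 1]

theorem pB_mul_pA (α : ℝ) : pB α * pA α = 1 := by
  ext i j
  fin_cases i <;> fin_cases j <;> simp [pA, pB, Matrix.mul_apply, Fin.sum_univ_three]

theorem pB_alg {α : ℝ} (hα : IsAlgebraic ℤ α) (i l : Fin 3) : IsAlgebraic ℤ (pB α i l) := by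
  fin_cases i <;> fin_cases l <;>
    simp [pB, hα, hα.pow 2, isAlgebraic_zero, isAlgebraic_one, hα.neg, (hα.pow 2).neg]

theorem span_cr (P R : Fin 3 → ℤ) (h0 : cr P R ≠ 0) (v : Fin 3 → ℚ)
    (hv : ∑ i, (cr P R i : ℚ) * v i = 0) :
    v ∈ Submodule.span ℚ (Set.range (fun (l : Fin 2) i => ((![P, R] l i : ℤ) : ℚ))) := by
  set h := cr P R with hh
  have hN : ((h 0 : ℚ) ^ 2 + (h 1 : ℚ) ^ 2 + (h 2 : ℚ) ^ 2) ≠ 0 := by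
    intro h1
    apply h0
    have a0 := sq_nonneg (h 0 : ℚ)
    have a1 := sq_nonneg (h 1 : ℚ)
    have a2 := sq_nonneg (h 2 : ℚ)
    have b0 : (h 0 : ℚ) ^ 2 = 0 := by linarith
    have b1 : (h 1 : ℚ) ^ 2 = 0 := by linarith
    have b2 : (h 2 : ℚ) ^ 2 = 0 := by linarith
    ext i
    fin_cases i
    · simpa using b0
    · simpa using b1
    · simpa using b2
  have e0 : (h 0 : ℚ) = P 1 * R 2 - P 2 * R 1 := by rw [hh]; simp [cr]
  have e1 : (h 1 : ℚ) = P 2 * R 0 - P 0 * R 2 := by rw [hh]; simp [cr]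
  have e2 : (h 2 : ℚ) = P 0 * R 1 - P 1 * R 0 := by rw [hh]; simp [cr]
  rw [Fin.sum_univ_three] at hv
  have key : v = ((v 0 * (R 1 * h 2 - R 2 * h 1) + v 1 * (R 2 * h 0 - R 0 * h 2) +
        v 2 * (R 0 * h 1 - R 1 * h 0)) / ((h 0 : ℚ) ^ 2 + (h 1 : ℚ) ^ 2 + (h 2 : ℚ) ^ 2)) •
        (fun i => (P i : ℚ)) +
      ((v 0 * (h 1 * P 2 - h 2 * P 1) + v 1 * (h 2 * P 0 - h 0 * P 2) +
        v 2 * (h 0 * P 1 - h 1 * P 0)) / ((h 0 : ℚ) ^ 2 + (h 1 : ℚ) ^ 2 + (h 2 : ℚ) ^ 2)) •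
        (fun i => (R i : ℚ)) := by
    ext i
    simp only [Pi.add_apply, Pi.smul_apply, smul_eq_mul]
    rw [div_mul_eq_mul_div, div_mul_eq_mul_div, ← add_div, eq_div_iff hN]
    fin_cases i
    · simp only [Fin.zero_eta]
      rw [e0, e1, e2] at hv ⊢
      linear_combination (P 1 * R 2 - P 2 * R 1 : ℚ) * hv
    · simp only [Fin.mk_one]
      rw [e0, e1, e2] at hv ⊢
      linear_combination (P 2 * R 0 - P 0 * R 2 : ℚ) * hv
    · simp only [Fin.reduceFinMk]
      rw [e0, e1, e2] at hv ⊢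
      linear_combination (P 0 * R 1 - P 1 * R 0 : ℚ) * hv
  rw [key]
  apply Submodule.add_mem
  · exact Submodule.smul_mem _ _ (Submodule.subset_span ⟨0, rfl⟩)
  · exact Submodule.smul_mem _ _ (Submodule.subset_span ⟨1, rfl⟩)

theorem minor_le (P R : Fin 3 → ℤ) (H : ℝ) (hH : ∀ k, |(cr P R k : ℝ)| ≤ H) (a j : Fin 3) :
    |(P a : ℝ) * R j - P j * R a| ≤ H := by
  have h0 := hH 0
  have h1 := hH 1
  have h2 := hH 2
  have hH0 : 0 ≤ H := (abs_nonneg _).trans h0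
  simp [cr] at h0 h1 h2
  rw [abs_le] at h0 h1 h2 ⊢
  fin_cases a <;> fin_cases j <;> simp <;> (try constructor) <;> linarith [h0.1, h0.2, h1.1, h1.2, h2.1, h2.2]

theorem ev_minor (α : ℝ) (P R R3 : Fin 3 → ℤ) (k : ℤ) (hk : ∀ i, cr P R3 i = k * cr P R i)
    (a : Fin 3) : (P a : ℝ) * ev α R3 - R3 a * ev α P = k * (P a * ev α R - R a * ev α P) := by
  have e0 := hk 0
  have e1 := hk 1
  have e2 := hk 2
  simp [cr] at e0 e1 e2
  have f0 : (P 1 * R3 2 - P 2 * R3 1 : ℝ) = k * (P 1 * R 2 - P 2 * R 1) := by exact_mod_cast e0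
  have f1 : (P 2 * R3 0 - P 0 * R3 2 : ℝ) = k * (P 2 * R 0 - P 0 * R 2) := by exact_mod_cast e1
  have f2 : (P 0 * R3 1 - P 1 * R3 0 : ℝ) = k * (P 0 * R 1 - P 1 * R 0) := by exact_mod_cast e2
  simp only [ev]
  fin_cases a
  · simp only [Fin.zero_eta]
    linear_combination α * f2 - α ^ 2 * f1
  · simp only [Fin.mk_one]
    linear_combination α ^ 2 * f0 - f2
  · simp only [Fin.reduceFinMk]
    linear_combination f1 - α * f0

theorem det_bound (α : ℝ) (P R S : Fin 3 → ℤ) (p r s ep er es : ℝ) (hp : ∀ i, |(P i : ℝ)| ≤ p)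
    (hr : ∀ i, |(R i : ℝ)| ≤ r) (hs : ∀ i, |(S i : ℝ)| ≤ s) (hep : |ev α P| ≤ ep)
    (her : |ev α R| ≤ er) (hes : |ev α S| ≤ es)
    (hlt : 2 * (ep * (r * s)) + 2 * (er * (p * s)) + 2 * (es * (p * r)) < 1) :
    S 0 * cr P R 0 + S 1 * cr P R 1 + S 2 * cr P R 2 = 0 := by
  rw [← Int.abs_lt_one_iff]
  have h1 : ((S 0 * cr P R 0 + S 1 * cr P R 1 + S 2 * cr P R 2 : ℤ) : ℝ) =
      ev α P * (R 1 * S 2 - R 2 * S 1) - ev α R * (P 1 * S 2 - P 2 * S 1) +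
      ev α S * (P 1 * R 2 - P 2 * R 1) := by
    simp [cr, ev]
    ring
  have hp0 : 0 ≤ p := (abs_nonneg _).trans (hp 0)
  have hr0 : 0 ≤ r := (abs_nonneg _).trans (hr 0)
  have hs0 : 0 ≤ s := (abs_nonneg _).trans (hs 0)
  have aux : ∀ (e E x1 y2 x2 y1 X Y : ℝ), |e| ≤ E → |x1| ≤ X → |x2| ≤ X → |y1| ≤ Y → |y2| ≤ Y →
      0 ≤ X → 0 ≤ Y → |e * (x1 * y2 - x2 * y1)| ≤ 2 * (E * (X * Y)) := by
    intro e E x1 y2 x2 y1 X Y he h1 h2 h3 h4 hX hY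
    have hE : 0 ≤ E := (abs_nonneg _).trans he
    rw [abs_mul]
    have : |x1 * y2 - x2 * y1| ≤ 2 * (X * Y) := by
      refine (abs_sub _ _).trans ?_
      rw [abs_mul, abs_mul]
      have a1 := mul_le_mul h1 h4 (abs_nonneg _) hX
      have a2 := mul_le_mul h2 h3 (abs_nonneg _) hX
      linarith
    have := mul_le_mul he this (abs_nonneg _) hE
    linarith
  have h2 : |((S 0 * cr P R 0 + S 1 * cr P R 1 + S 2 * cr P R 2 : ℤ) : ℝ)| < 1 := by
    rw [h1]
    refine lt_of_le_of_lt ((abs_add_le _ _).trans (add_le_add_left (abs_sub _ _) _)) ?_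
    have a1 := aux (ev α P) ep (R 1) (S 2) (R 2) (S 1) r s hep (hr 1) (hr 2) (hs 1) (hs 2) hr0 hs0
    have a2 := aux (ev α R) er (P 1) (S 2) (P 2) (S 1) p s her (hp 1) (hp 2) (hs 1) (hs 2) hp0 hs0
    have a3 := aux (ev α S) es (P 1) (R 2) (P 2) (R 1) p r hes (hp 1) (hp 2) (hr 1) (hr 2) hp0 hr0
    linarith
  exact_mod_cast h2

end ABT
end

section
namespace ABT
set_option linter.unusedSectionVars false
set_option linter.unusedSimpArgs false

set_option maxHeartbeats 2000000 in
theorem quad_prim (α : ℝ) (hα : IsAlgebraic ℤ α) (hirr : Irrational α) :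
    ∃ L0 : ℝ, ∀ L, L0 ≤ L → ∀ (P u : Fin 3 → ℤ) (a : Fin 3), ∑ i, u i * P i = 1 →
      (∀ i, |(P i : ℝ)| ≤ Real.exp L) → Real.exp L ≤ |(P a : ℝ)| →
      |ev α P| ≤ Real.exp (-(5 / 2) * L) → False := by
  obtain ⟨D, c, hc, hliou⟩ := liouville_rat α hα hirr
  have hD : (0 : ℝ) < D + 1 := by positivity
  obtain ⟨L1, hL1⟩ := dual_case α hα 1.1 0.01 (by norm_num) (by norm_num) (by norm_num) (by norm_num)
  obtain ⟨L3, hL3⟩ := dual_case α hα 1.15 0.01 (by norm_num) (by norm_num) (by norm_num)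
    (by norm_num)
  obtain ⟨L4, hL4⟩ := thmA3 (ι := Fin 2) (pA α) (pB α) (pB_mul_pA α) (pB_alg hα)
    ![-2.29, 1.11, 1.11] (by simp [Fin.sum_univ_three]; norm_num) (1 / (D + 1)) (by positivity) 3
  obtain ⟨L5, hL5⟩ := exp_absorb 7 (a := -0.03) (b := 0) (by norm_num)
  obtain ⟨L6, hL6⟩ := exp_absorb 7 (a := -1.29) (b := 0) (by norm_num)
  obtain ⟨L7, hL7⟩ := exp_absorb (c * 7) (a := -0.29) (b := 0) (by norm_num)
  refine ⟨max 0 (max L1 (max L3 (max L4 (max L5 (max L6 L7))))), ?_⟩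
  intro L hL P u a hu hP ha hev
  simp only [max_le_iff] at hL
  obtain ⟨hL0, hLL1, hLL3, hLL4, hLL5, hLL6, hLL7⟩ := hL
  have hmul : ∀ x y : ℝ, Real.exp (x * L) * Real.exp (y * L) = Real.exp ((x + y) * L) := by
    intro x y
    rw [← Real.exp_add]; congr 1; ring
  have hmono : ∀ x y : ℝ, x ≤ y → Real.exp (x * L) ≤ Real.exp (y * L) := by
    intro x y hxy
    exact Real.exp_le_exp.2 (mul_le_mul_of_nonneg_right hxy hL0)
  have hpos : ∀ x : ℝ, 0 < Real.exp (x * L) := fun x => Real.exp_pos _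
  obtain ⟨R1, hR1, hR1b, hR1e⟩ := hL1 L hLL1 P u a hu hP ha hev
  obtain ⟨R3, hR3, hR3b, hR3e⟩ := hL3 L hLL3 P u a hu hP ha hev
  have hE1 : Real.exp L = Real.exp (1 * L) := by rw [one_mul]
  rw [hE1] at hP ha
  have t5 := hL5 L hLL5
  have t6 := hL6 L hLL6
  have t7 := hL7 L hLL7
  rw [zero_mul, Real.exp_zero] at t5 t6 t7
  rw [show (1.1 + 0.01 : ℝ) = 1.11 by norm_num] at hR1b
  rw [show (-2 * 1.1 + 0.01 : ℝ) = -2.19 by norm_num] at hR1e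
  rw [show (1.15 + 0.01 : ℝ) = 1.16 by norm_num] at hR3b
  rw [show (-2 * 1.15 + 0.01 : ℝ) = -2.29 by norm_num] at hR3e
  rw [show (-(5 / 2) : ℝ) = -2.5 by norm_num] at hev
  have hPa : P a ≠ 0 := by
    intro h
    rw [h] at ha
    simp at ha
    linarith [Real.exp_pos L]
  have hdet := det_bound α P R1 R3 _ _ _ _ _ _ hP hR1b hR3b hev hR1e hR3e (by
    simp only [hmul]
    have b1 := hmono (-2.5 + (1.11 + 1.16)) (-0.03) (by norm_num)
    have b2 := hmono (-2.19 + (1 + 1.16)) (-0.03) (by norm_num)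
    have b3 := hmono (-2.29 + (1 + 1.11)) (-0.03) (by norm_num)
    linarith [hpos (-0.03)])
  obtain ⟨g, h, v, R, hg, hgh, hv, hcr, hRa⟩ := exists_normalized P u R1 a hu hPa hR1
  -- parallel
  have hR3h : R3 0 * h 0 + R3 1 * h 1 + R3 2 * h 2 = 0 := by
    apply mul_left_cancel₀ hg
    rw [hgh 0, hgh 1, hgh 2] at hdet
    linarith
  have hPh : P 0 * h 0 + P 1 * h 1 + P 2 * h 2 = 0 := by
    rw [← hcr]
    simp [cr]
    ring
  have hpar : cr (cr P R3) h = 0 := by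
    ext i
    fin_cases i
    · simp [cr]
      linear_combination R3 0 * hPh - P 0 * hR3h
    · simp [cr]
      linear_combination R3 1 * hPh - P 1 * hR3h
    · simp [cr]
      linear_combination R3 2 * hPh - P 2 * hR3h
  have hk := cr_par (cr P R3) h v hv hpar
  set k := ∑ j, v j * cr P R3 j with hkdef
  have hk0 : k ≠ 0 := by
    intro h0
    apply not_mem_cr P u R3 hu hR3
    ext i
    rw [hk i, h0]
    simp
  have hk1 : (1 : ℝ) ≤ |(k : ℝ)| := by exact_mod_cast Int.one_le_abs hk0
  have hg1 : (1 : ℝ) ≤ |(g : ℝ)| := by exact_mod_cast Int.one_le_abs hg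
  -- size of h
  have hhb : ∀ i, |(h i : ℝ)| ≤ 2 * Real.exp (2.11 * L) := by
    intro i
    have b1 : |(cr P R1 i : ℝ)| ≤ 2 * Real.exp (2.11 * L) := by
      have aux : ∀ i j, |(P i : ℝ) * R1 j| ≤ Real.exp (2.11 * L) := by
        intro i j
        rw [abs_mul]
        have := mul_le_mul (hP i) (hR1b j) (abs_nonneg _) (hpos _).le
        rw [hmul] at this
        exact this.trans (hmono _ _ (by norm_num))
      have aux2 : ∀ i j i' j', |(P i : ℝ) * R1 j - P i' * R1 j'| ≤ 2 * Real.exp (2.11 * L) := by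
        intro i j i' j'
        refine (abs_sub _ _).trans ?_
        linarith [aux i j, aux i' j']
      fin_cases i
      · simpa [cr] using aux2 1 2 2 1
      · simpa [cr] using aux2 2 0 0 2
      · simpa [cr] using aux2 0 1 1 0
    rw [hgh i] at b1
    push_cast at b1
    rw [abs_mul] at b1
    nlinarith [abs_nonneg (h i : ℝ)]
  have hRa' : |(R a : ℝ)| ≤ Real.exp (1 * L) := by
    have : |(R a : ℝ)| ≤ |(P a : ℝ)| := by exact_mod_cast hRa
    exact this.trans (hP a)
  have hRb : ∀ j, |(R j : ℝ)| ≤ 3 * Real.exp (1.11 * L) := by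
    intro j
    have m := minor_le P R _ (fun k => by rw [hcr]; exact hhb k) a j
    have m1 : |(P a : ℝ) * R j| ≤ 3 * Real.exp (2.11 * L) := by
      have e : (P a : ℝ) * R j = (P a * R j - P j * R a) + P j * R a := by ring
      rw [e]
      refine (abs_add_le _ _).trans ?_
      have : |(P j : ℝ) * R a| ≤ Real.exp (2.11 * L) := by
        rw [abs_mul]
        have := mul_le_mul (hP j) hRa' (abs_nonneg _) (hpos _).le
        rw [hmul] at this
        exact this.trans (hmono _ _ (by norm_num))
      linarith
    rw [abs_mul] at m1
    have m2 := mul_le_mul_of_nonneg_right ha (abs_nonneg (R j : ℝ))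
    have m3 : Real.exp (2.11 * L) = Real.exp (1 * L) * Real.exp (1.11 * L) := by
      rw [hmul]; norm_num
    rw [m3] at m1
    have := hpos 1
    have m4 : Real.exp (1 * L) * |(R j : ℝ)| ≤ Real.exp (1 * L) * (3 * Real.exp (1.11 * L)) := by
      linarith
    exact le_of_mul_le_mul_left m4 this
  have hG3 : |(P a : ℝ) * ev α R3 - R3 a * ev α P| ≤ 2 * Real.exp (-1.29 * L) := by
    refine (abs_sub _ _).trans ?_
    rw [abs_mul, abs_mul]
    have b1 := mul_le_mul (hP a) hR3e (abs_nonneg _) (hpos _).le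
    have b2 := mul_le_mul (hR3b a) hev (abs_nonneg _) (hpos _).le
    rw [hmul] at b1 b2
    have b3 := hmono (1 + -2.29) (-1.29) (by norm_num)
    have b4 := hmono (1.16 + -2.5) (-1.29) (by norm_num)
    linarith
  have hG : |(P a : ℝ) * ev α R - R a * ev α P| ≤ 2 * Real.exp (-1.29 * L) := by
    rw [ev_minor α P R R3 k (by intro i; rw [hcr]; exact hk i) a, abs_mul] at hG3
    nlinarith [abs_nonneg ((P a : ℝ) * ev α R - R a * ev α P)]
  have hRev : |ev α R| ≤ 3 * Real.exp (-2.29 * L) := by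
    have m1 : |(P a : ℝ) * ev α R| ≤ 3 * Real.exp (-1.29 * L) := by
      have e : (P a : ℝ) * ev α R = (P a * ev α R - R a * ev α P) + R a * ev α P := by ring
      rw [e]
      refine (abs_add_le _ _).trans ?_
      have : |(R a : ℝ) * ev α P| ≤ Real.exp (-1.29 * L) := by
        rw [abs_mul]
        have := mul_le_mul hRa' hev (abs_nonneg _) (hpos _).le
        rw [hmul] at this
        exact this.trans (hmono _ _ (by norm_num))
      linarith
    rw [abs_mul] at m1
    have m2 := mul_le_mul_of_nonneg_right ha (abs_nonneg (ev α R))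
    have m3 : Real.exp (-1.29 * L) = Real.exp (1 * L) * Real.exp (-2.29 * L) := by
      rw [hmul]; norm_num
    rw [m3] at m1
    have := hpos 1
    have m4 : Real.exp (1 * L) * |ev α R| ≤ Real.exp (1 * L) * (3 * Real.exp (-2.29 * L)) := by
      linarith
    exact le_of_mul_le_mul_left m4 this
  have hPev : |ev α P| ≤ 3 * Real.exp (-2.29 * L) := by
    have := hmono (-2.5) (-2.29) (by norm_num)
    linarith [hpos (-2.29)]
  have hPb : ∀ j, |(P j : ℝ)| ≤ 3 * Real.exp (1.11 * L) := by
    intro j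
    have := hmono 1 1.11 (by norm_num)
    linarith [hpos 1.11, hP j]
  -- h is close to (1, α, α²)
  have hclose : ∀ i, |(P i : ℝ) * ev α R - R i * ev α P| ≤ 6 * Real.exp (-1.29 * L) := by
    intro i
    refine (abs_sub _ _).trans ?_
    rw [abs_mul, abs_mul]
    have b1 := mul_le_mul (hP i) hRev (abs_nonneg _) (hpos _).le
    have b2 := mul_le_mul (hRb i) hev (abs_nonneg _) (by positivity)
    have e1 : Real.exp (1 * L) * (3 * Real.exp (-2.29 * L)) = 3 * Real.exp (-1.29 * L) := by
      rw [mul_left_comm, hmul]; norm_num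
    have e2 : 3 * Real.exp (1.11 * L) * Real.exp (-2.5 * L) = 3 * Real.exp (-1.39 * L) := by
      rw [mul_assoc, hmul]; norm_num
    have := hmono (-1.39) (-1.29) (by norm_num)
    linarith
  have hh0 : (h 0 : ℝ) = P 1 * R 2 - P 2 * R 1 := by rw [← hcr]; simp [cr]
  have hh1 : (h 1 : ℝ) = P 2 * R 0 - P 0 * R 2 := by rw [← hcr]; simp [cr]
  have hh2 : (h 2 : ℝ) = P 0 * R 1 - P 1 * R 0 := by rw [← hcr]; simp [cr]
  have hc2 : |(h 1 : ℝ) - α * h 0| ≤ 6 * Real.exp (-1.29 * L) := by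
    refine le_trans (le_of_eq ?_) (hclose 2)
    rw [hh0, hh1]
    congr 1
    simp only [ev]
    ring
  have hc1 : |(h 2 : ℝ) - α ^ 2 * h 0| ≤ 6 * Real.exp (-1.29 * L) := by
    refine le_trans (le_of_eq ?_) (hclose 1)
    rw [hh0, hh2, ← abs_neg]
    congr 1
    simp only [ev]
    ring
  have hlt1 : 6 * Real.exp (-1.29 * L) < 1 := by linarith [hpos (-1.29)]
  have hh00 : h 0 ≠ 0 := by
    intro h0
    rw [h0] at hc1 hc2
    simp only [Int.cast_zero, mul_zero, sub_zero] at hc1 hc2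
    have d1 : h 1 = 0 := by
      rw [← Int.abs_lt_one_iff]
      exact_mod_cast lt_of_le_of_lt hc2 hlt1
    have d2 : h 2 = 0 := by
      rw [← Int.abs_lt_one_iff]
      exact_mod_cast lt_of_le_of_lt hc1 hlt1
    rw [Fin.sum_univ_three, h0, d1, d2] at hv
    simp at hv
  have hh0' : h ≠ 0 := by
    intro h0
    rw [h0] at hh00
    simp at hh00
  refine hL4 L hLL4 ![P, R] h v 0 ?_ ?_ hv ?_
  · intro w hw
    have := span_cr P R (by rw [hcr]; exact hh0') w (by rw [hcr]; exact hw)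
    exact this
  · intro l i
    fin_cases l
    · fin_cases i
      · refine le_trans (le_of_eq ?_) hPev
        simp [pA, Fin.sum_univ_three, ev]
        congr 1
        ring
      · refine le_trans (le_of_eq ?_) (hPb 1)
        simp [pA, Fin.sum_univ_three]
      · refine le_trans (le_of_eq ?_) (hPb 2)
        simp [pA, Fin.sum_univ_three]
    · fin_cases i
      · refine le_trans (le_of_eq ?_) hRev
        simp [pA, Fin.sum_univ_three, ev]
        congr 1
        ring
      · refine le_trans (le_of_eq ?_) (hRb 1)
        simp [pA, Fin.sum_univ_three]
      · refine le_trans (le_of_eq ?_) (hRb 2)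
        simp [pA, Fin.sum_univ_three]
  · by_contra hlt
    push Not at hlt
    have hlt' : |(h 0 : ℝ)| ≤ Real.exp (1 / ((D : ℝ) + 1) * L) := by
      linarith [abs_nonneg (h 0 : ℝ)]
    have hpw : |(h 0 : ℝ)| ^ D ≤ Real.exp (1 * L) := by
      refine (pow_le_pow_left₀ (abs_nonneg _) hlt' D).trans ?_
      rw [← Real.exp_nat_mul, ← mul_assoc]
      apply hmono
      rw [mul_one_div, div_le_one hD]
      linarith
    have := hliou (h 0) (h 1) hh00
    have f1 : c * |(h 0 : ℝ)| ^ D * |(h 1 : ℝ) - α * h 0| ≤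
        c * Real.exp (1 * L) * (6 * Real.exp (-1.29 * L)) := by
      apply mul_le_mul _ hc2 (abs_nonneg _) (by positivity)
      exact mul_le_mul_of_nonneg_left hpw hc.le
    have f2 : c * Real.exp (1 * L) * (6 * Real.exp (-1.29 * L)) = c * 6 * Real.exp (-0.29 * L) := by
      have : Real.exp (-0.29 * L) = Real.exp (1 * L) * Real.exp (-1.29 * L) := by
        rw [hmul]; norm_num
      rw [this]; ring
    have : 0 < c * Real.exp (-0.29 * L) := mul_pos hc (hpos _)
    linarith

/-- Proposition C. -/
theorem propC (α : ℝ) (hα : IsAlgebraic ℤ α) (hnq : ∀ R : Fin 3 → ℤ, R ≠ 0 → ev α R ≠ 0) :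
    ∃ L0 : ℝ, ∀ L, L0 ≤ L → ∀ R : Fin 3 → ℤ, R ≠ 0 → (∀ i, |(R i : ℝ)| ≤ Real.exp L) →
      Real.exp (-(5 / 2) * L) < |ev α R| := by
  have hirr : Irrational α := by
    rintro ⟨q, hq⟩
    apply hnq ![-q.num, q.den, 0]
    · intro h
      have := congrFun h 1
      simp at this
    · have hd : (q.den : ℝ) ≠ 0 := by exact_mod_cast q.den_nz
      simp only [ev]
      simp
      rw [← hq]
      rw [Rat.cast_def]
      field_simp
      ring
  obtain ⟨L1, hL1⟩ := quad_prim α hα hirr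
  -- finite set
  have hfin : {R : Fin 3 → ℤ | R ≠ 0 ∧ ∀ i, |(R i : ℝ)| ≤ Real.exp L1}.Finite := by
    apply (Set.finite_Icc (fun _ : Fin 3 => - ⌈Real.exp L1⌉) (fun _ => ⌈Real.exp L1⌉)).subset
    intro R hR
    simp only [Set.mem_ofPred_eq] at hR
    have : ∀ i, |R i| ≤ ⌈Real.exp L1⌉ := by
      intro i
      have := (hR.2 i).trans (Int.le_ceil _)
      exact_mod_cast this
    exact ⟨fun i => (abs_le.1 (this i)).1, fun i => (abs_le.1 (this i)).2⟩
  obtain ⟨δ, hδ, hδ'⟩ : ∃ δ : ℝ, 0 < δ ∧ ∀ R : Fin 3 → ℤ, R ≠ 0 →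
      (∀ i, |(R i : ℝ)| ≤ Real.exp L1) → δ ≤ |ev α R| := by
    by_cases hne : {R : Fin 3 → ℤ | R ≠ 0 ∧ ∀ i, |(R i : ℝ)| ≤ Real.exp L1}.Nonempty
    · obtain ⟨R0, hR0, hmin⟩ := Set.exists_min_image _ (fun R => |ev α R|) hfin hne
      simp only [Set.mem_ofPred_eq] at hR0 hmin
      exact ⟨|ev α R0|, abs_pos.2 (hnq R0 hR0.1), fun R h1 h2 => hmin R ⟨h1, h2⟩⟩
    · refine ⟨1, one_pos, fun R h1 h2 => absurd ⟨R, ?_⟩ hne⟩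
      simp only [Set.mem_ofPred_eq]
      exact ⟨h1, h2⟩
  obtain ⟨L2, hL2⟩ := exp_absorb (2 / δ) (a := -(5 / 2)) (b := 0) (by norm_num)
  refine ⟨L2, ?_⟩
  intro L hL R hR hRb
  obtain ⟨g, P, u, hg, hgP, hu⟩ := exists_primitive R hR
  have hg1 : (1 : ℝ) ≤ |(g : ℝ)| := by exact_mod_cast Int.one_le_abs hg
  have hevg : ev α R = g * ev α P := by
    simp only [ev, hgP]
    push_cast
    ring
  have hevle : |ev α P| ≤ |ev α R| := by
    rw [hevg, abs_mul]
    nlinarith [abs_nonneg (ev α P)]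
  have hPle : ∀ i, |(P i : ℝ)| ≤ |(R i : ℝ)| := by
    intro i
    rw [hgP i]
    push_cast
    rw [abs_mul]
    nlinarith [abs_nonneg (P i : ℝ)]
  have hP0 : P ≠ 0 := by
    rintro rfl
    simp at hu
  refine lt_of_lt_of_le ?_ hevle
  by_cases hsm : ∀ i, |(P i : ℝ)| ≤ Real.exp L1
  · refine lt_of_lt_of_le ?_ (hδ' P hP0 hsm)
    have := hL2 L hL
    rw [zero_mul, Real.exp_zero, div_mul_eq_mul_div, div_le_one hδ] at this
    linarith [Real.exp_pos (-(5 / 2) * L)]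
  · push Not at hsm
    obtain ⟨i0, hi0⟩ := hsm
    obtain ⟨a, -, ha⟩ := Finset.exists_max_image Finset.univ (fun i => |(P i : ℝ)|) ⟨i0, by simp⟩
    have hPa : Real.exp L1 < |(P a : ℝ)| := lt_of_lt_of_le hi0 (ha i0 (by simp))
    have hPa0 : 0 < |(P a : ℝ)| := (Real.exp_pos _).trans hPa
    have hexp : Real.exp (Real.log |(P a : ℝ)|) = |(P a : ℝ)| := Real.exp_log hPa0
    have hLL : L1 ≤ Real.log |(P a : ℝ)| := by
      rw [Real.le_log_iff_exp_le hPa0]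
      exact hPa.le
    by_contra hle
    push Not at hle
    refine hL1 _ hLL P u a hu ?_ ?_ ?_
    · intro i
      rw [hexp]
      exact ha i (by simp)
    · rw [hexp]
    · refine hle.trans (Real.exp_le_exp.2 ?_)
      have : Real.log |(P a : ℝ)| ≤ L := by
        rw [Real.log_le_iff_le_exp hPa0]
        exact (hPle a).trans (hRb a)
      linarith

end ABT
end

section
namespace ABT
set_option linter.unusedSectionVars false
set_option linter.unusedSimpArgs false

noncomputable def fA (α : ℝ) : Matrix (Fin 4) (Fin 4) ℝ :=
  !![0, α, 0, -1; α, 0, -1, 0; α, 1, 0, 0; 1, 0, 0, 0]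
noncomputable def fB (α : ℝ) : Matrix (Fin 4) (Fin 4) ℝ :=
  !![0, 0, 0, 1; 0, 0, 1, -α; 0, -1, 0, α; -1, 0, α, -α ^ 2]

theorem fB_mul_fA (α : ℝ) : fB α * fA α = 1 := by
  ext i j
  fin_cases i <;> fin_cases j <;> simp [fA, fB, Matrix.mul_apply, Fin.sum_univ_four] <;> ring

theorem fB_alg {α : ℝ} (hα : IsAlgebraic ℤ α) (i l : Fin 4) : IsAlgebraic ℤ (fB α i l) := by
  fin_cases i <;> fin_cases l <;>
    simp [fB, hα, hα.pow 2, isAlgebraic_zero, isAlgebraic_one, hα.neg, (hα.pow 2).neg,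
      (isAlgebraic_one : IsAlgebraic ℤ (1 : ℝ)).neg]

/-- dual basis supplied by Proposition C -/
theorem dual_basis (α : ℝ) (hα : IsAlgebraic ℤ α) (hnq : ∀ R : Fin 3 → ℤ, R ≠ 0 → ev α R ≠ 0) :
    ∃ (K L0 : ℝ), 0 < K ∧ 0 ≤ L0 ∧ ∀ L, L0 ≤ L → ∃ z : Fin 3 → Fin 3 → ℤ,
      (∀ l, |(z l 0 : ℝ)| ≤ K * Real.exp (5 / 2 * L) ∧
        |(z l 1 : ℝ) - α * z l 0| ≤ K * Real.exp (-L) ∧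
        |(z l 2 : ℝ) - α ^ 2 * z l 0| ≤ K * Real.exp (-L)) ∧
      ∀ v : Fin 3 → ℚ, ∃ c : Fin 3 → ℚ, ∀ i, v i = ∑ l, c l * (z l i : ℚ) := by
  obtain ⟨L1, hL1⟩ := propC α hα hnq
  obtain ⟨C, hC, hT⟩ := transf 3
  set lam : ℝ := 1 / (1 + |α| + α ^ 2) with hlam
  have hlam0 : 0 < lam := by positivity
  refine ⟨C / lam, max 0 L1, by positivity, le_max_left _ _, ?_⟩
  intro L hL
  have hL0 : 0 ≤ L := (le_max_left _ _).trans hL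
  have hLL1 : L1 ≤ L := (le_max_right _ _).trans hL
  set A := Real.exp (5 / 2 * L) with hA
  set B := Real.exp (-L) with hB
  have hA0 : 0 < A := Real.exp_pos _
  have hB0 : 0 < B := Real.exp_pos _
  have hBinv : B⁻¹ = Real.exp L := by rw [hB, ← Real.exp_neg, neg_neg]
  have hAinv : A⁻¹ = Real.exp (-(5 / 2) * L) := by rw [hA, ← Real.exp_neg]; congr 1; ring
  obtain ⟨y, hy1, hy2⟩ := hT (Fin 3 → ℤ) (by simp) (wemb α A B) lam hlam0
    (wemb_finite α A B hA0 hB0) (by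
      intro R hR
      apply lam_bound α A B hB0
      · rw [hA, hBinv, ← Real.exp_add]
        apply Real.one_le_exp
        linarith
      · by_cases hh : ∀ i, |(R i : ℝ)| ≤ Real.exp L
        · right
          rw [hAinv]
          exact (hL1 L hLL1 R hR hh).le
        · left
          push Not at hh
          obtain ⟨i, hi⟩ := hh
          exact ⟨i, by rw [hBinv]; exact hi.le⟩)
  refine ⟨fun l i => y l (Pi.single i 1), ?_, ?_⟩
  · intro l
    exact functional_bounds α A B (C / lam) hA0 hB0 (by positivity) (y l) (hy1 l)
  · intro v
    obtain ⟨c, hc⟩ := hy2 ℚ (vecFun v)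
    refine ⟨c, fun i => ?_⟩
    have := hc (Pi.single i 1)
    rw [vecFun_apply] at this
    rw [← this, Finset.sum_eq_single i]
    · simp
    · intro j _ hj
      simp [hj]
    · simp

set_option maxHeartbeats 2000000 in
theorem propD (α : ℝ) (hα : IsAlgebraic ℤ α) (hα1 : |α| ≤ 1)
    (hnq : ∀ R : Fin 3 → ℤ, R ≠ 0 → ev α R ≠ 0) (σ : ℝ) (hσ : 0 < σ) (C0 : ℝ) (hC0 : 0 ≤ C0) :
    ∃ L0 : ℝ, ∀ L, L0 ≤ L → ∀ p q p' q' δ : ℤ, (q : ℝ) = Real.exp L → |(q' : ℝ)| ≤ q →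
      q' * p - q * p' = δ → δ * δ = 1 → |(q' : ℝ) * α - p'| ≤ Real.exp (-L) →
      |(q : ℝ) * α - p + α * (q' * α - p')| ≤ C0 * Real.exp (-(7 / 2 * σ) * L) * Real.exp (-L) →
      False := by
  obtain ⟨K, L1, hK, hL1, hz⟩ := dual_basis α hα hnq
  obtain ⟨L2, hL2⟩ := thmA' (n := 4) (ι := Fin 3) (by norm_num) (fA α) (fB α) (fB_mul_fA α)
    (fB_alg hα) ![-1 - σ, -1 - σ, 1 - σ, 1 + 5 / 2 * σ]
    (by simp [Fin.sum_univ_four]; linarith) 1 one_pos (3 * K * (1 + C0) + 1)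
  refine ⟨max L2 (L1 / σ), ?_⟩
  intro L hL p q p' q' δ hq hq' hdet hδ hd' hD
  have hLL2 : L2 ≤ L := (le_max_left _ _).trans hL
  have hσL : L1 ≤ σ * L := by
    have := (le_max_right _ _).trans hL
    rw [div_le_iff₀ hσ] at this
    linarith
  obtain ⟨z, hzb, hzs⟩ := hz (σ * L) hσL
  have hq0 : (0 : ℝ) < q := by rw [hq]; exact Real.exp_pos _
  have hqz : q ≠ 0 := by
    intro h
    rw [h] at hq0
    simp at hq0
  set Q := Real.exp L with hQ
  set S := Real.exp (-(σ * L)) with hS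
  set U := Real.exp (5 / 2 * (σ * L)) with hU
  have hQi : Real.exp (-L) = Q⁻¹ := by rw [Real.exp_neg]
  have hQ0 : 0 < Q := Real.exp_pos _
  have hQi0 : 0 < Q⁻¹ := inv_pos.2 hQ0
  have hS0 : 0 < S := Real.exp_pos _
  have hU0 : 0 < U := Real.exp_pos _
  have hVU : Real.exp (-(7 / 2 * σ) * L) * U = S := by
    rw [hU, hS, ← Real.exp_add]; congr 1; ring
  have hSU : S ≤ U := by
    rw [hS, hU]
    apply Real.exp_le_exp.2
    linarith
  rw [hQi] at hd' hD
  have b1 : ∀ l, |(z l 1 : ℝ) - α * z l 0| ≤ K * S := fun l => (hzb l).2.1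
  have b0 : ∀ l, |(z l 0 : ℝ)| ≤ K * U := fun l => (hzb l).1
  have b2 : ∀ l, |(z l 2 : ℝ) - α * z l 1| ≤ 2 * K * S := by
    intro l
    have e : (z l 2 : ℝ) - α * z l 1 = (z l 2 - α ^ 2 * z l 0) - α * (z l 1 - α * z l 0) := by ring
    rw [e]
    refine (abs_sub _ _).trans ?_
    rw [abs_mul]
    have := mul_le_mul hα1 (b1 l) (abs_nonneg _) zero_le_one
    have h3 := (hzb l).2.2
    linarith
  have b3 : ∀ l, |(z l 1 : ℝ)| ≤ 2 * K * U := by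
    intro l
    have e : (z l 1 : ℝ) = (z l 1 - α * z l 0) + α * z l 0 := by ring
    rw [e]
    refine (abs_add_le _ _).trans ?_
    rw [abs_mul]
    have := mul_le_mul hα1 (b0 l) (abs_nonneg _) zero_le_one
    have h3 := b1 l
    have := mul_le_mul_of_nonneg_left hSU hK.le
    linarith
  set D := (q : ℝ) * α - p + α * (q' * α - p') with hDdef
  set V := Real.exp (-(7 / 2 * σ) * L) with hV
  have hV0 : 0 < V := Real.exp_pos _
  -- general bound
  have gb : ∀ x y X Y : ℝ, |x| ≤ X * S → |y| ≤ Y * U → 0 ≤ X → 0 ≤ Y →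
      |(q' * α - p') * x + D * y| ≤ (X + C0 * Y) * (Q⁻¹ * S) := by
    intro x y X Y hx hy hX hY
    refine (abs_add_le _ _).trans ?_
    rw [abs_mul, abs_mul]
    have m1 := mul_le_mul hd' hx (abs_nonneg _) hQi0.le
    have m2 := mul_le_mul hD hy (abs_nonneg _) (by positivity)
    have m3 : C0 * V * Q⁻¹ * (Y * U) = C0 * Y * (Q⁻¹ * S) := by
      rw [← hVU]; ring
    nlinarith
  set N : Fin 3 → Fin 4 → ℤ := fun l => ![q' * z l 1 + q * z l 0, -(q' * z l 2) - q * z l 1,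
    p' * z l 1 + p * z l 0, -(p' * z l 2) - p * z l 1] with hN
  refine hL2 L hLL2 N ![p, -p', -q, q'] 2 0 ?_ ?_ (by decide) (by simpa using hqz) ?_
  · intro v hv
    simp [Fin.sum_univ_four] at hv
    obtain ⟨c, hc⟩ := hzs ![(δ : ℚ) * (-p' * v 0 + q' * v 2), δ * (p * v 0 - q * v 2),
      -(δ * (p * v 1 - q * v 3))]
    have c0 := hc 0
    have c1 := hc 1
    have c2 := hc 2
    simp [Fin.sum_univ_three] at c0 c1 c2
    have hδ' : (δ : ℚ) * δ = 1 := by exact_mod_cast hδ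
    have hdet' : (q' : ℚ) * p - q * p' = δ := by exact_mod_cast hdet
    have key : v = ∑ l, c l • (fun i => (N l i : ℚ)) := by
      ext i
      simp only [Finset.sum_apply, Pi.smul_apply, smul_eq_mul, Fin.sum_univ_three]
      fin_cases i
      · simp [hN]
        linear_combination q' * c1 + q * c0 - v 0 * hδ' - v 0 * δ * hdet'
      · simp [hN]
        linear_combination -q' * c2 - q * c1 - v 1 * hδ' - v 1 * δ * hdet' + q * δ * hv
      · simp [hN]
        linear_combination p' * c1 + p * c0 - v 2 * hδ' - v 2 * δ * hdet'
      · simp [hN]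
        linear_combination -p' * c2 - p * c1 - v 3 * hδ' - v 3 * δ * hdet' + p * δ * hv
    rw [key]
    apply Submodule.sum_mem
    intro l _
    apply Submodule.smul_mem
    exact Submodule.subset_span ⟨l, rfl⟩
  · intro l i
    have e1 : Real.exp ((-1 - σ) * L) = Q⁻¹ * S := by
      rw [← hQi, hS, ← Real.exp_add]; congr 1; ring
    have e2 : Real.exp ((1 - σ) * L) = Q * S := by
      rw [hQ, hS, ← Real.exp_add]; congr 1; ring
    have e3 : Real.exp ((1 + 5 / 2 * σ) * L) = Q * U := by
      rw [hQ, hU, ← Real.exp_add]; congr 1; ring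
    have hqQ : |(q : ℝ)| ≤ Q := by rw [abs_of_pos hq0, hq]
    have hqQ' : |(q' : ℝ)| ≤ Q := by rw [← hq]; exact hq'
    have pKC : 0 ≤ K * C0 := mul_nonneg hK.le hC0
    fin_cases i
    · simp [fA, Fin.sum_univ_four, hN]
      rw [e1]
      have := gb _ _ _ _ (b2 l) (b3 l) (by positivity) (by positivity)
      rw [← abs_neg] at this
      have h2 : (2 * K + C0 * (2 * K)) * (Q⁻¹ * S) ≤ (3 * K * (1 + C0) + 1) * (Q⁻¹ * S) := by
        apply mul_le_mul_of_nonneg_right _ (by positivity)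
        nlinarith
      refine le_trans (le_of_eq ?_) (this.trans h2)
      congr 1
      rw [hDdef]
      ring
    · simp [fA, Fin.sum_univ_four, hN]
      rw [e1]
      have := gb _ _ _ _ (b1 l) (b0 l) (by positivity) (by positivity)
      have h2 : (K + C0 * K) * (Q⁻¹ * S) ≤ (3 * K * (1 + C0) + 1) * (Q⁻¹ * S) := by
        apply mul_le_mul_of_nonneg_right _ (by positivity)
        nlinarith
      refine le_trans (le_of_eq ?_) (this.trans h2)
      congr 1
      rw [hDdef]
      ring
    · simp [fA, Fin.sum_univ_four, hN]
      rw [e2]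
      have m1 := mul_le_mul hqQ' (b2 l) (abs_nonneg _) hQ0.le
      have m2 := mul_le_mul hqQ (b1 l) (abs_nonneg _) hQ0.le
      rw [← abs_mul] at m1 m2
      have m3 := abs_add_le ((q' : ℝ) * (z l 2 - α * z l 1)) (q * (z l 1 - α * z l 0))
      rw [← abs_neg] at m3
      have h2 : (3 * K) * (Q * S) ≤ (3 * K * (1 + C0) + 1) * (Q * S) := by
        apply mul_le_mul_of_nonneg_right _ (by positivity)
        nlinarith
      refine le_trans (le_of_eq ?_) (m3.trans (le_trans ?_ h2))
      · congr 1
        ring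
      · linarith
    · simp [fA, Fin.sum_univ_four, hN]
      rw [e3]
      have m1 := mul_le_mul hqQ' (b3 l) (abs_nonneg _) hQ0.le
      have m2 := mul_le_mul hqQ (b0 l) (abs_nonneg _) hQ0.le
      rw [← abs_mul] at m1 m2
      have m3 := abs_add_le ((q' : ℝ) * (z l 1)) (q * (z l 0))
      have h2 : (3 * K) * (Q * U) ≤ (3 * K * (1 + C0) + 1) * (Q * U) := by
        apply mul_le_mul_of_nonneg_right _ (by positivity)
        nlinarith
      refine m3.trans (le_trans ?_ h2)
      linarith
  · have hg : Int.gcd (-q) p = 1 := by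
      rw [Int.neg_gcd]
      rw [← Int.isCoprime_iff_gcd_eq_one]
      refine ⟨-δ * p', δ * q', ?_⟩
      linear_combination δ * hdet + hδ
    simp only [Matrix.cons_val, Matrix.cons_val_zero]
    rw [hg, one_mul]
    push_cast
    rw [abs_neg, abs_of_pos hq0, hq, div_one]
    have : 0 ≤ K * (1 + C0) := by positivity
    nlinarith

theorem propE (α : ℝ) (hirr : Irrational α) (hα1 : |α| ≤ 1)
    (R : Fin 3 → ℤ) (hR : R ≠ 0) (hRα : ev α R = 0) (σ : ℝ) (hσ : 0 < σ) (C0 : ℝ)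
    (hC0 : 0 ≤ C0) :
    ∃ L0 : ℝ, ∀ L, L0 ≤ L → ∀ p q p' q' : ℤ, (q : ℝ) = Real.exp L → |(q' : ℝ)| ≤ q →
      |(p : ℝ)| ≤ q → |(p' : ℝ)| ≤ q →
      |(q : ℝ) * α - p + α * (q' * α - p')| ≤ C0 * Real.exp (-(7 / 2 * σ) * L) * Real.exp (-L) →
      (q : ℝ) * α - p + α * (q' * α - p') = 0 := by
  set H : ℝ := |(R 0 : ℝ)| + |(R 1 : ℝ)| + |(R 2 : ℝ)| with hH
  have n0 := abs_nonneg (R 0 : ℝ)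
  have n1 := abs_nonneg (R 1 : ℝ)
  have n2 := abs_nonneg (R 2 : ℝ)
  have hH0 : 0 ≤ H := by positivity
  obtain ⟨L1, hL1⟩ := exp_absorb (2 * (H * C0 * (12 * H * H))) (a := -(7 / 2 * σ)) (b := 0)
    (by linarith)
  have hlin : ∀ u v : ℤ, (u : ℝ) * α + v = 0 → u = 0 ∧ v = 0 := by
    intro u v h
    have hu : u = 0 := by
      by_contra hu
      apply hirr
      refine ⟨-(v : ℚ) / u, ?_⟩
      push_cast
      have : (u : ℝ) ≠ 0 := by exact_mod_cast hu
      field_simp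
      linarith
    refine ⟨hu, ?_⟩
    rw [hu] at h
    simpa using h
  have hR2 : R 2 ≠ 0 := by
    intro h
    rw [ev, h] at hRα
    obtain ⟨h1, h0⟩ := hlin (R 1) (R 0) (by push_cast at hRα; linarith)
    apply hR
    ext i
    fin_cases i
    · exact h0
    · exact h1
    · exact h
  refine ⟨L1, ?_⟩
  intro L hL p q p' q' hq hq' hp hp' hD
  set D := (q : ℝ) * α - p + α * (q' * α - p') with hDdef
  have hq0 : (0 : ℝ) < q := by rw [hq]; exact Real.exp_pos _
  set u : ℤ := R 2 * (q - p') - q' * R 1 with hu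
  set v : ℤ := -(R 2 * p) - q' * R 0 with hv
  have huv : (u : ℝ) * α + v = R 2 * D := by
    rw [hu, hv, hDdef]
    push_cast
    rw [ev] at hRα
    linear_combination (-(q' : ℝ)) * hRα
  set E : ℤ := u ^ 2 * R 0 - u * v * R 1 + v ^ 2 * R 2 with hE
  have hEf : (E : ℝ) = (u * α + v) * (-(u * R 1) + R 2 * (v - u * α)) := by
    rw [hE]
    push_cast
    rw [ev] at hRα
    linear_combination (u : ℝ) ^ 2 * hRα
  have hR2' : (R 2 : ℝ) ≠ 0 := by exact_mod_cast hR2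
  by_cases hE0 : E = 0
  · rw [hE0] at hEf
    have : (u : ℝ) * α + v = 0 := by
      rcases mul_eq_zero.1 (hEf.symm.trans Int.cast_zero) with h | h
      · exact h
      · obtain ⟨h1, h2⟩ := hlin (-(R 2 * u)) (-(u * R 1) + R 2 * v) (by push_cast; linarith)
        have hu0 : u = 0 := by
          rcases mul_eq_zero.1 (neg_eq_zero.1 h1) with h | h
          · exact absurd h hR2
          · exact h
        rw [hu0] at h2
        simp [hR2] at h2
        rw [hu0, h2]
        simp
    rw [this] at huv
    exact (mul_eq_zero.1 huv.symm).resolve_left hR2'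
  · exfalso
    have h1 : (1 : ℝ) ≤ |(E : ℝ)| := by exact_mod_cast Int.one_le_abs hE0
    have a0 : |(R 0 : ℝ)| ≤ H := by rw [hH]; linarith
    have a1 : |(R 1 : ℝ)| ≤ H := by rw [hH]; linarith
    have a2 : |(R 2 : ℝ)| ≤ H := by rw [hH]; linarith
    have mb : ∀ x y X Y : ℝ, |x| ≤ X → |y| ≤ Y → |x * y| ≤ X * Y := by
      intro x y X Y hx hy
      rw [abs_mul]
      exact mul_le_mul hx hy (abs_nonneg _) ((abs_nonneg _).trans hx)
    have hub : |(u : ℝ)| ≤ 3 * H * q := by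
      have e : (u : ℝ) = R 2 * q - R 2 * p' - q' * R 1 := by rw [hu]; push_cast; ring
      rw [e]
      refine (abs_sub _ _).trans ((add_le_add_left (abs_sub _ _) _).trans ?_)
      have := mb _ _ _ _ a2 (le_of_eq (abs_of_pos hq0))
      have := mb _ _ _ _ a2 hp'
      have := mb _ _ _ _ hq' a1
      linarith
    have hvb : |(v : ℝ)| ≤ 2 * H * q := by
      have e : (v : ℝ) = -(R 2 * p) - q' * R 0 := by rw [hv]; push_cast; ring
      rw [e]
      refine (abs_sub _ _).trans ?_
      rw [abs_neg]
      have := mb _ _ _ _ a2 hp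
      have := mb _ _ _ _ hq' a0
      linarith
    have hsec : |-((u : ℝ) * R 1) + R 2 * (v - u * α)| ≤ 12 * H * H * q := by
      refine (abs_add_le _ _).trans ?_
      rw [abs_neg]
      have m1 := mb _ _ _ _ hub a1
      have m2 := mb _ _ _ _ hub hα1
      have m3 := (abs_sub (v : ℝ) (u * α)).trans (add_le_add hvb m2)
      have m4 := mb _ _ _ _ a2 m3
      have : 0 ≤ H * H * q := by positivity
      linarith
    have hfst : |(u : ℝ) * α + v| ≤ H * (C0 * Real.exp (-(7 / 2 * σ) * L) * Real.exp (-L)) := by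
      rw [huv]
      exact mb _ _ _ _ a2 hD
    have hprod := mb _ _ _ _ hfst hsec
    rw [← hEf] at hprod
    have hQ : Real.exp (-L) * q = 1 := by
      rw [hq, ← Real.exp_add]; simp
    have e : H * (C0 * Real.exp (-(7 / 2 * σ) * L) * Real.exp (-L)) * (12 * H * H * q) =
        (H * C0 * (12 * H * H)) * Real.exp (-(7 / 2 * σ) * L) * (Real.exp (-L) * q) := by ring
    rw [e, hQ, mul_one] at hprod
    have := hL1 L hL
    rw [zero_mul, Real.exp_zero] at this
    linarith

end ABT
end

section
namespace ABT
set_option linter.unusedSectionVars false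
set_option linter.unusedSimpArgs false

theorem cfQ_pos {a : ℕ → ℕ} (hpos : ∀ i, 0 < a i) : ∀ n, 0 < cfQ a n := by
  intro n
  induction n using Nat.twoStepInduction with
  | zero => simp [cfQ]
  | one => simpa [cfQ] using hpos 0
  | more n h1 h2 => simp only [cfQ]; positivity

theorem cfQ_le_succ {a : ℕ → ℕ} (hpos : ∀ i, 0 < a i) (n : ℕ) : cfQ a n ≤ cfQ a (n + 1) := by
  cases n with
  | zero => simpa [cfQ, Nat.one_le_iff_ne_zero, Nat.pos_iff_ne_zero] using hpos 0
  | succ n =>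
    simp only [cfQ]
    have := Nat.le_mul_of_pos_left (cfQ a (n + 1)) (hpos (n + 1))
    omega

theorem cfQ_ge {a : ℕ → ℕ} (hpos : ∀ i, 0 < a i) : ∀ n, n ≤ cfQ a n := by
  intro n
  induction n with
  | zero => simp
  | succ n ih =>
    cases n with
    | zero => simpa [cfQ, Nat.one_le_iff_ne_zero, Nat.pos_iff_ne_zero] using hpos 0
    | succ n =>
      simp only [cfQ]
      have := Nat.le_mul_of_pos_left (cfQ a (n + 1)) (hpos (n + 1))
      have := cfQ_pos hpos n
      omega

theorem cfQ_pow {a : ℕ → ℕ} (hpos : ∀ i, 0 < a i) : ∀ n, 2 ^ n ≤ 2 * cfQ a n ^ 2 := by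
  intro n
  induction n using Nat.twoStepInduction with
  | zero => simp [cfQ]
  | one =>
    have := cfQ_pos hpos 1
    nlinarith
  | more n h1 h2 =>
    have e1 : 2 * cfQ a n ≤ cfQ a (n + 2) := by
      have := Nat.le_mul_of_pos_left (cfQ a (n + 1)) (hpos (n + 1))
      have := cfQ_le_succ hpos n
      simp only [cfQ]
      omega
    have e2 := Nat.pow_le_pow_left e1 2
    rw [pow_add]
    nlinarith

theorem cfP_le {a : ℕ → ℕ} (hpos : ∀ i, 0 < a i) : ∀ n, cfP a n ≤ cfQ a n := by
  intro n
  induction n using Nat.twoStepInduction with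
  | zero => simp [cfP]
  | one => simpa [cfP, cfQ, Nat.one_le_iff_ne_zero, Nat.pos_iff_ne_zero] using hpos 0
  | more n h1 h2 =>
    simp only [cfP, cfQ]
    gcongr

theorem cf_det (a : ℕ → ℕ) (n : ℕ) :
    (cfQ a n : ℤ) * cfP a (n + 1) - cfQ a (n + 1) * cfP a n = (-1) ^ n := by
  induction n with
  | zero => simp [cfP, cfQ]
  | succ n ih =>
    simp only [cfP, cfQ]
    push_cast
    rw [pow_succ, ← ih]
    ring

/-- `cft n` is the absolute value of `q_{n-1} α - p_{n-1}`. -/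
noncomputable def cft (a : ℕ → ℕ) (α : ℝ) : ℕ → ℝ
  | 0 => 1
  | n + 1 => (-1) ^ n * (cfQ a n * α - cfP a n)

theorem cft_rec (a : ℕ → ℕ) (α : ℝ) (n : ℕ) :
    cft a α n = a n * cft a α (n + 1) + cft a α (n + 2) := by
  cases n with
  | zero => simp [cft, cfQ, cfP]
  | succ n =>
    simp only [cft, cfQ, cfP]
    push_cast
    ring

theorem cf_d (a : ℕ → ℕ) (α : ℝ) (n : ℕ) :
    (cfQ a n : ℝ) * α - cfP a n = (-1) ^ n * cft a α (n + 1) := by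
  simp only [cft]
  rw [← mul_assoc, ← mul_pow]
  simp

theorem cross_nonneg (a : ℕ → ℕ) (n k : ℕ) :
    0 ≤ (-1 : ℤ) ^ n * (cfQ a n * cfP a (n + k) - cfP a n * cfQ a (n + k)) := by
  induction k using Nat.twoStepInduction with
  | zero => simp [mul_comm]
  | one =>
    have := cf_det a n
    have e : (cfQ a n : ℤ) * cfP a (n + 1) - cfP a n * cfQ a (n + 1) = (-1) ^ n := by linarith
    rw [e, ← mul_pow]
    simp
  | more k h1 h2 =>
    have e : (-1 : ℤ) ^ n * (cfQ a n * cfP a (n + (k + 2)) - cfP a n * cfQ a (n + (k + 2))) =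
      a (n + k + 1) * ((-1 : ℤ) ^ n * (cfQ a n * cfP a (n + (k + 1)) -
        cfP a n * cfQ a (n + (k + 1)))) +
      ((-1 : ℤ) ^ n * (cfQ a n * cfP a (n + k) - cfP a n * cfQ a (n + k))) := by
      rw [show n + (k + 2) = (n + k) + 2 by ring, show n + (k + 1) = n + k + 1 by ring]
      simp only [cfP, cfQ]
      push_cast
      ring
    rw [e]
    positivity

theorem cft_nonneg {a : ℕ → ℕ} (hpos : ∀ i, 0 < a i) {α : ℝ}
    (hα : Tendsto (fun ℓ => (cfP a ℓ : ℝ) / (cfQ a ℓ : ℝ)) atTop (𝓝 α)) (n : ℕ) :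
    0 ≤ cft a α n := by
  cases n with
  | zero => simp [cft]
  | succ n =>
    simp only [cft]
    have hlim : Tendsto (fun ℓ => (-1 : ℝ) ^ n * (cfQ a n * ((cfP a ℓ : ℝ) / (cfQ a ℓ : ℝ)) -
        cfP a n)) atTop (𝓝 ((-1 : ℝ) ^ n * (cfQ a n * α - cfP a n))) :=
      ((hα.const_mul _).sub_const _).const_mul _
    apply ge_of_tendsto hlim
    filter_upwards [eventually_ge_atTop n] with m hm
    obtain ⟨k, rfl⟩ := Nat.exists_eq_add_of_le hm
    have h1 := cross_nonneg a n k
    have h2 : (0 : ℝ) ≤ (-1 : ℝ) ^ n * (cfQ a n * cfP a (n + k) - cfP a n * cfQ a (n + k)) := by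
      exact_mod_cast h1
    have hq : (0 : ℝ) < cfQ a (n + k) := by exact_mod_cast cfQ_pos hpos (n + k)
    have e : (-1 : ℝ) ^ n * (cfQ a n * ((cfP a (n + k) : ℝ) / (cfQ a (n + k) : ℝ)) - cfP a n) =
      ((-1 : ℝ) ^ n * (cfQ a n * cfP a (n + k) - cfP a n * cfQ a (n + k))) / cfQ a (n + k) := by
      field_simp
    rw [e]
    positivity

theorem cft_det (a : ℕ → ℕ) (α : ℝ) (n : ℕ) :
    (cfQ a n : ℝ) * cft a α (n + 2) + cfQ a (n + 1) * cft a α (n + 1) = 1 := by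
  have h : (cfQ a n : ℝ) * cfP a (n + 1) - cfQ a (n + 1) * cfP a n = (-1) ^ n := by
    exact_mod_cast cf_det a n
  have h2 : ((-1 : ℝ) ^ n) * (-1) ^ n = 1 := by rw [← mul_pow]; simp
  simp only [cft, pow_succ]
  linear_combination (-1 : ℝ) ^ n * h + h2

theorem cft_pos {a : ℕ → ℕ} (hpos : ∀ i, 0 < a i) {α : ℝ}
    (hα : Tendsto (fun ℓ => (cfP a ℓ : ℝ) / (cfQ a ℓ : ℝ)) atTop (𝓝 α)) (n : ℕ) :
    0 < cft a α n := by
  cases n with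
  | zero => simp [cft]
  | succ n =>
    rcases (cft_nonneg hpos hα (n + 1)).lt_or_eq with h | h
    · exact h
    · exfalso
      have h1 := cft_rec a α (n + 1)
      have h2 := cft_nonneg hpos hα (n + 2)
      have h3 := cft_nonneg hpos hα (n + 3)
      have h4 : (1 : ℝ) ≤ a (n + 1) := by exact_mod_cast hpos (n + 1)
      have h5 : cft a α (n + 2) = 0 := by
        rw [← h] at h1
        rw [show n + 1 + 1 = n + 2 by ring, show n + 1 + 2 = n + 3 by ring] at h1
        nlinarith
      have h6 := cft_det a α n
      rw [h5, ← h] at h6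
      simp at h6

theorem cft_lt {a : ℕ → ℕ} (hpos : ∀ i, 0 < a i) {α : ℝ}
    (hα : Tendsto (fun ℓ => (cfP a ℓ : ℝ) / (cfQ a ℓ : ℝ)) atTop (𝓝 α)) (n : ℕ) :
    cft a α (n + 1) < cft a α n := by
  have h1 := cft_rec a α n
  have h2 := cft_pos hpos hα (n + 1)
  have h3 := cft_pos hpos hα (n + 2)
  have h4 : (1 : ℝ) ≤ a n := by exact_mod_cast hpos n
  nlinarith

theorem cft_le {a : ℕ → ℕ} (hpos : ∀ i, 0 < a i) {α : ℝ}
    (hα : Tendsto (fun ℓ => (cfP a ℓ : ℝ) / (cfQ a ℓ : ℝ)) atTop (𝓝 α)) (n : ℕ) :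
    cfQ a n * cft a α n ≤ 1 := by
  cases n with
  | zero => simp [cft, cfQ]
  | succ n =>
    have h1 := cft_det a α n
    have h2 := cft_pos hpos hα (n + 2)
    have h3 : (0 : ℝ) ≤ cfQ a n * cft a α (n + 2) := by positivity
    linarith

theorem cf_irrational {a : ℕ → ℕ} (hpos : ∀ i, 0 < a i) {α : ℝ}
    (hα : Tendsto (fun ℓ => (cfP a ℓ : ℝ) / (cfQ a ℓ : ℝ)) atTop (𝓝 α)) : Irrational α := by
  rintro ⟨x, hx⟩
  set n := x.den with hn
  have h1 := cft_le hpos hα (n + 1)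
  have h2 := cft_pos hpos hα (n + 1)
  have h3 := cfQ_ge hpos (n + 1)
  have h4 : ((n : ℝ) + 1) ≤ cfQ a (n + 1) := by exact_mod_cast h3
  have h5 := cf_d a α n
  have hden : (0 : ℝ) < n := by exact_mod_cast x.den_pos
  have hnx : (n : ℝ) * α = x.num := by
    rw [← hx, Rat.cast_def]
    field_simp
    rw [hn]
    ring
  have h6 : (((cfQ a n : ℤ) * x.num - n * cfP a n : ℤ) : ℝ) = (-1) ^ n * (n * cft a α (n + 1)) := by
    push_cast
    linear_combination (n : ℝ) * h5 - (cfQ a n : ℝ) * hnx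
  have h7 : |(((cfQ a n : ℤ) * x.num - n * cfP a n : ℤ) : ℝ)| = n * cft a α (n + 1) := by
    rw [h6, abs_mul, abs_pow]
    simp [abs_of_pos h2]
  have h8 : (n : ℝ) * cft a α (n + 1) < 1 := by nlinarith
  rw [← h7] at h8
  have h9 : ((cfQ a n : ℤ) * x.num - n * cfP a n : ℤ) = 0 := by
    rw [← Int.abs_lt_one_iff]
    exact_mod_cast h8
  rw [h9] at h7
  simp at h7
  rcases h7 with h | h
  · exact absurd h x.den_nz
  · exact absurd h h2.ne'

theorem shift_gen (a : ℕ → ℕ) (f : ℕ → ℝ) (hf : ∀ n, f (n + 2) = a (n + 1) * f (n + 1) + f n)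
    (r k : ℕ) (hper : ∀ n < k, a (n + (r + 1)) = a n) :
    ∀ n ≤ k, f (r + 1 + n) = f (r + 1) * cfQ a n + f r * cfP a n := by
  intro n
  induction n using Nat.twoStepInduction with
  | zero => intro _; simp [cfQ, cfP]
  | one =>
    intro h
    have h1 := hf r
    have h2 := hper 0 (by omega)
    rw [zero_add] at h2
    rw [show r + 1 + 1 = r + 2 by ring, h1, h2]
    simp [cfQ, cfP]
    ring
  | more n h1 h2 =>
    intro h
    have e1 := h1 (by omega)
    have e2 := h2 (by omega)
    have e3 := hf (r + 1 + n)
    have e4 := hper (n + 1) (by omega)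
    rw [show n + 1 + (r + 1) = r + 1 + n + 1 by ring] at e4
    rw [show r + 1 + (n + 2) = r + 1 + n + 2 by ring, e3, e4,
      show r + 1 + n + 1 = r + 1 + (n + 1) by ring, e2, e1]
    simp only [cfQ, cfP]
    push_cast
    ring

/-- the key quantity is small -/
theorem key_small {a : ℕ → ℕ} (hpos : ∀ i, 0 < a i) {α : ℝ}
    (hα : Tendsto (fun ℓ => (cfP a ℓ : ℝ) / (cfQ a ℓ : ℝ)) atTop (𝓝 α))
    (r k : ℕ) (hper : ∀ n < k, a (n + (r + 1)) = a n) :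
    |(cfQ a (r + 1) : ℝ) * α - cfP a (r + 1) + α * (cfQ a r * α - cfP a r)| *
      (cfQ a (r + 1) * cfQ a k ^ 2) ≤ 2 := by
  set Dv := (cfQ a (r + 1) : ℝ) * α - cfP a (r + 1) + α * (cfQ a r * α - cfP a r) with hD
  have hs1 := shift_gen a (fun n => (cfQ a n : ℝ) * α - cfP a n) (by
    intro n
    simp only [cfQ, cfP]
    push_cast
    ring) r k hper k le_rfl
  have hs2 := shift_gen a (fun n => (cfQ a n : ℝ)) (by
    intro n
    simp only [cfQ]
    push_cast
    ring) r k hper k le_rfl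
  have hqk : (0 : ℝ) < cfQ a k := by exact_mod_cast cfQ_pos hpos k
  have hqr : (0 : ℝ) < cfQ a (r + 1) := by exact_mod_cast cfQ_pos hpos (r + 1)
  have e1 : Dv * cfQ a k = ((cfQ a (r + 1 + k) : ℝ) * α - cfP a (r + 1 + k)) +
      (cfQ a r * α - cfP a r) * (cfQ a k * α - cfP a k) := by
    rw [hs1, hD]
    ring
  rw [cf_d, cf_d, cf_d] at e1
  have t1 := cft_pos hpos hα (r + 1 + k + 1)
  have t2 := cft_pos hpos hα (r + 1)
  have t3 := cft_pos hpos hα (k + 1)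
  have e2 : |Dv| * cfQ a k ≤ cft a α (r + 1 + k + 1) + cft a α (r + 1) * cft a α (k + 1) := by
    have : |Dv| * cfQ a k = |Dv * cfQ a k| := by rw [abs_mul, abs_of_pos hqk]
    rw [this, e1]
    refine (abs_add_le _ _).trans (le_of_eq ?_)
    simp only [abs_mul, abs_pow, abs_neg, abs_one, one_pow, one_mul, abs_of_pos t1,
      abs_of_pos t2, abs_of_pos t3]
  have l1 : (cfQ a (r + 1) * cfQ a k : ℝ) * cft a α (r + 1 + k + 1) ≤ 1 := by
    have h1 := cft_le hpos hα (r + 1 + k)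
    have h2 := cft_lt hpos hα (r + 1 + k)
    have h3 : (cfQ a (r + 1) * cfQ a k : ℝ) ≤ cfQ a (r + 1 + k) := by
      rw [hs2]
      have : (0 : ℝ) ≤ cfQ a r * cfP a k := by positivity
      linarith
    calc (cfQ a (r + 1) * cfQ a k : ℝ) * cft a α (r + 1 + k + 1)
        ≤ cfQ a (r + 1 + k) * cft a α (r + 1 + k) := by gcongr
      _ ≤ 1 := h1
  have l2 : (cfQ a (r + 1) * cft a α (r + 1)) * (cfQ a k * cft a α (k + 1)) ≤ 1 := by
    have h1 := cft_le hpos hα (r + 1)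
    have h2 : cfQ a k * cft a α (k + 1) ≤ 1 := by
      have h3 := cft_le hpos hα k
      have h4 := cft_lt hpos hα k
      nlinarith
    exact mul_le_one₀ h1 (by positivity) h2
  have e3 := mul_le_mul_of_nonneg_left e2 (mul_pos hqr hqk).le
  calc |Dv| * (cfQ a (r + 1) * cfQ a k ^ 2) =
        (cfQ a (r + 1) * cfQ a k : ℝ) * (|Dv| * cfQ a k) := by ring
    _ ≤ _ := e3
    _ = (cfQ a (r + 1) * cfQ a k : ℝ) * cft a α (r + 1 + k + 1) +
        (cfQ a (r + 1) * cft a α (r + 1)) * (cfQ a k * cft a α (k + 1)) := by ring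
    _ ≤ 2 := by linarith

theorem digit_unique {x y z z' : ℝ} {m m' : ℕ} (hz : 0 ≤ z) (hz' : 0 ≤ z') (hzy : z < y)
    (hzy' : z' < y) (h : x = m * y + z) (h' : x = m' * y + z') : m = m' := by
  have key : ∀ (m m' : ℕ) (z z' : ℝ), 0 ≤ z → z' < y → (m : ℝ) * y + z = m' * y + z' → z < y →
      ¬ m' < m := by
    intro m m' z z' h0 h1 h2 h3 hlt
    have : (m' : ℝ) + 1 ≤ m := by exact_mod_cast hlt
    nlinarith
  have h1 := key m m' z z' hz hzy' (by linarith) hzy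
  have h2 := key m' m z' z hz' hzy (by linarith) hzy'
  omega

theorem periodic_of_zero {a : ℕ → ℕ} (hpos : ∀ i, 0 < a i) {α : ℝ}
    (hα : Tendsto (fun ℓ => (cfP a ℓ : ℝ) / (cfQ a ℓ : ℝ)) atTop (𝓝 α)) (r : ℕ)
    (h0 : (cfQ a (r + 1) : ℝ) * α - cfP a (r + 1) + α * (cfQ a r * α - cfP a r) = 0) :
    EventuallyPeriodic a := by
  have hα1 : cft a α 1 = α := by simp [cft, cfQ, cfP]
  have h1 : cft a α (r + 2) = cft a α (r + 1) * cft a α 1 := by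
    rw [cf_d, cf_d, pow_succ] at h0
    rw [hα1]
    have hne : ((-1 : ℝ) ^ r) ≠ 0 := by simp
    apply mul_left_cancel₀ hne
    linarith
  set c := cft a α (r + 1) with hc
  have hc0 : 0 < c := cft_pos hpos hα (r + 1)
  have main : ∀ n, cft a α (r + 1 + n) = c * cft a α n ∧
      cft a α (r + 1 + (n + 1)) = c * cft a α (n + 1) ∧ a (r + 1 + n) = a n := by
    have step : ∀ n, cft a α (r + 1 + n) = c * cft a α n →
      cft a α (r + 1 + (n + 1)) = c * cft a α (n + 1) → a (r + 1 + n) = a n ∧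
      cft a α (r + 1 + (n + 2)) = c * cft a α (n + 2) := by
      intro n e1 e2
      have r1 := cft_rec a α (r + 1 + n)
      have r2 := cft_rec a α n
      rw [show r + 1 + n + 1 = r + 1 + (n + 1) by ring,
        show r + 1 + n + 2 = r + 1 + (n + 2) by ring, e2, e1] at r1
      have ha : a (r + 1 + n) = a n := by
        refine digit_unique (x := c * cft a α n) (y := c * cft a α (n + 1))
          (z := cft a α (r + 1 + (n + 2))) (z' := c * cft a α (n + 2))
          (cft_nonneg hpos hα _) (mul_nonneg hc0.le (cft_nonneg hpos hα _)) ?_ ?_ r1 ?_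
        · rw [← e2]
          exact cft_lt hpos hα (r + 1 + (n + 1))
        · exact mul_lt_mul_of_pos_left (cft_lt hpos hα (n + 1)) hc0
        · rw [r2]; ring
      refine ⟨ha, ?_⟩
      rw [ha, r2] at r1
      linarith
    intro n
    induction n with
    | zero =>
      have e1 : cft a α (r + 1 + 0) = c * cft a α 0 := by simp [cft, hc]
      have e2 : cft a α (r + 1 + (0 + 1)) = c * cft a α (0 + 1) := h1
      exact ⟨e1, e2, (step 0 e1 e2).1⟩
    | succ n ih =>
      have e3 := (step n ih.1 ih.2.1).2
      exact ⟨ih.2.1, e3, (step (n + 1) ih.2.1 e3).1⟩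
  refine ⟨0, r + 1, by omega, ?_⟩
  intro n _
  rw [add_comm]
  exact (main n).2.2

theorem prefix_periodic {a : ℕ → ℕ} {V : List ℕ} {w : ℝ} (h : BeginsWithPow a V w) (n : ℕ)
    (hn : n + V.length < ⌈w * V.length⌉₊) : a (n + V.length) = a n := by
  have h1 := h _ hn
  have h2 := h n (by omega)
  rw [Nat.add_mod_right, h2] at h1
  exact (Option.some.inj h1).symm

set_option maxHeartbeats 1000000 in
theorem main_thm (a : ℕ → ℕ) (hpos : ∀ i, 0 < a i) (α : ℝ)
    (hα : Tendsto (fun ℓ => (cfP a ℓ : ℝ) / (cfQ a ℓ : ℝ)) atTop (𝓝 α))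
    (hbdd : ∃ B : ℝ, ∀ ℓ : ℕ, 1 ≤ ℓ → (cfQ a ℓ : ℝ) ^ (1 / (ℓ : ℝ)) ≤ B)
    (w : ℝ) (hw : 1 < w)
    (hcond : ConditionStar a w) (halg : IsAlgebraic ℤ α) : False := by
  obtain ⟨hnp, V, hVne, hVmono, hV⟩ := hcond
  obtain ⟨B0, hB0⟩ := hbdd
  set B := max B0 2 with hB
  have hB2 : 2 ≤ B := le_max_right _ _
  have hlogB : 0 < Real.log B := Real.log_pos (by linarith)
  have hlog2 : 0 < Real.log 2 := Real.log_pos (by norm_num)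
  have hirr := cf_irrational hpos hα
  have hα1 : |α| ≤ 1 := by
    have e : cft a α 1 = α := by simp [cft, cfQ, cfP]
    have h1 := cft_pos hpos hα 1
    have h2 := cft_lt hpos hα 0
    rw [e] at h1 h2
    simp only [cft] at h2
    rw [abs_of_pos h1]
    exact h2.le
  set σ : ℝ := 2 / 7 * ((w - 1) * Real.log 2 / Real.log B) with hσ
  have hσ0 : 0 < σ := by
    have : 0 < w - 1 := by linarith
    positivity
  -- combined bound
  obtain ⟨L0, hL0⟩ : ∃ L0 : ℝ, ∀ L, L0 ≤ L → ∀ p q p' q' δ : ℤ, (q : ℝ) = Real.exp L →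
      |(q' : ℝ)| ≤ q → |(p : ℝ)| ≤ q → |(p' : ℝ)| ≤ q →
      q' * p - q * p' = δ → δ * δ = 1 → |(q' : ℝ) * α - p'| ≤ Real.exp (-L) →
      |(q : ℝ) * α - p + α * (q' * α - p')| ≤ 4 * Real.exp (-(7 / 2 * σ) * L) * Real.exp (-L) →
      (q : ℝ) * α - p + α * (q' * α - p') = 0 := by
    by_cases hnq : ∀ R : Fin 3 → ℤ, R ≠ 0 → ev α R ≠ 0
    · obtain ⟨L0, hL0⟩ := propD α halg hα1 hnq σ hσ0 4 (by norm_num)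
      exact ⟨L0, fun L hL p q p' q' δ h1 h2 _ _ h5 h6 h7 h8 =>
        (hL0 L hL p q p' q' δ h1 h2 h5 h6 h7 h8).elim⟩
    · push Not at hnq
      obtain ⟨R, hR, hRα⟩ := hnq
      obtain ⟨L0, hL0⟩ := propE α hirr hα1 R hR hRα σ hσ0 4 (by norm_num)
      exact ⟨L0, fun L hL p q p' q' δ h1 h2 h3 h4 _ _ _ h8 =>
        hL0 L hL p q p' q' h1 h2 h3 h4 h8⟩
  obtain ⟨m, hm⟩ := exists_nat_gt (Real.exp L0)
  have hVm : m ≤ (V m).length := hVmono.le_apply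
  obtain ⟨r, hr⟩ : ∃ r, (V m).length = r + 1 :=
    Nat.exists_eq_succ_of_ne_zero (by simpa using hVne m)
  set k := ⌈w * (V m).length⌉₊ - (V m).length with hk
  have hper : ∀ n < k, a (n + (r + 1)) = a n := by
    intro n hn
    have := prefix_periodic (hV m) n (by omega)
    rwa [hr] at this
  have hkge : (w - 1) * (r + 1) ≤ k := by
    have h1 : w * (V m).length ≤ ⌈w * (V m).length⌉₊ := Nat.le_ceil _
    have h2 : ((⌈w * (V m).length⌉₊ : ℕ) : ℝ) ≤ k + (V m).length := by
      have : ⌈w * (V m).length⌉₊ ≤ k + (V m).length := by omega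
      exact_mod_cast this
    have h3 : ((V m).length : ℝ) = r + 1 := by rw [hr]; push_cast; ring
    rw [h3] at h1 h2
    linarith
  have hqpos : (0 : ℝ) < cfQ a (r + 1) := by exact_mod_cast cfQ_pos hpos (r + 1)
  set L := Real.log (cfQ a (r + 1)) with hL
  have hexp : (cfQ a (r + 1) : ℝ) = Real.exp L := (Real.exp_log hqpos).symm
  have hLL0 : L0 ≤ L := by
    rw [hL, Real.le_log_iff_exp_le hqpos]
    refine hm.le.trans ?_
    have h1 := cfQ_ge hpos (r + 1)
    have : m ≤ cfQ a (r + 1) := by omega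
    exact_mod_cast this
  have hLle : L ≤ (r + 1) * Real.log B := by
    have h1 := (hB0 (r + 1) (by omega)).trans (le_max_left B0 2)
    have h2 : (0 : ℝ) < ((r + 1 : ℕ) : ℝ) := by positivity
    have h3 := Real.log_le_log (by positivity) h1
    rw [Real.log_rpow hqpos, one_div, inv_mul_le_iff₀ h2] at h3
    push_cast at h3
    exact h3
  have hqk : (0 : ℝ) < cfQ a k := by exact_mod_cast cfQ_pos hpos k
  have hqk2 : Real.exp (7 / 2 * σ * L) ≤ 2 * (cfQ a k : ℝ) ^ 2 := by
    have h1 : ((2 : ℝ)) ^ k ≤ 2 * (cfQ a k : ℝ) ^ 2 := by exact_mod_cast cfQ_pow hpos k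
    refine le_trans ?_ h1
    have h2 : (2 : ℝ) ^ k = Real.exp (k * Real.log 2) := by
      rw [Real.exp_nat_mul, Real.exp_log (by norm_num)]
    rw [h2]
    apply Real.exp_le_exp.2
    have h3 : 7 / 2 * σ * Real.log B = (w - 1) * Real.log 2 := by
      rw [hσ]
      field_simp
    calc 7 / 2 * σ * L ≤ 7 / 2 * σ * ((r + 1) * Real.log B) := by gcongr
      _ = (w - 1) * (r + 1) * Real.log 2 := by linear_combination ((r : ℝ) + 1) * h3
      _ ≤ k * Real.log 2 := by gcongr
  have hsmall := key_small hpos hα r k hper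
  have hfin := hL0 L hLL0 (cfP a (r + 1)) (cfQ a (r + 1)) (cfP a r) (cfQ a r) ((-1) ^ r)
    (by exact_mod_cast hexp) ?_ ?_ ?_ (cf_det a r) (by rw [← mul_pow]; simp) ?_ ?_
  · apply hnp
    apply periodic_of_zero hpos hα r
    simpa using hfin
  · have := cfQ_le_succ hpos r
    simp only [Int.cast_natCast, Nat.abs_cast]
    exact_mod_cast this
  · have := cfP_le hpos (r + 1)
    simp only [Int.cast_natCast, Nat.abs_cast]
    exact_mod_cast this
  · have := (cfP_le hpos r).trans (cfQ_le_succ hpos r)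
    simp only [Int.cast_natCast, Nat.abs_cast]
    exact_mod_cast this
  · simp only [Int.cast_natCast]
    rw [cf_d, abs_mul, abs_pow, abs_neg, abs_one, one_pow, one_mul,
      abs_of_pos (cft_pos hpos hα (r + 1)), Real.exp_neg, ← hexp, ← one_div, le_div_iff₀ hqpos,
      mul_comm]
    exact cft_le hpos hα (r + 1)
  · simp only [Int.cast_natCast]
    set Dv := |(cfQ a (r + 1) : ℝ) * α - cfP a (r + 1) + α * (cfQ a r * α - cfP a r)| with hDv
    have hDv0 : 0 ≤ Dv := abs_nonneg _
    have e1 : Real.exp (-(7 / 2 * σ) * L) = (Real.exp (7 / 2 * σ * L))⁻¹ := by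
      rw [← Real.exp_neg]; congr 1; ring
    rw [e1, Real.exp_neg, ← hexp]
    have hX := Real.exp_pos (7 / 2 * σ * L)
    set X := Real.exp (7 / 2 * σ * L) with hXdef
    rw [mul_assoc, ← mul_inv, ← div_eq_mul_inv, le_div_iff₀ (by positivity)]
    have : Dv * (X * cfQ a (r + 1)) ≤ Dv * ((2 * (cfQ a k : ℝ) ^ 2) * cfQ a (r + 1)) := by
      gcongr
    linarith

end ABT
end

/-- Theorem 1, second assertion: if the sequence of partial quotients of
`α = [0; a_1, a_2, …]` satisfies Condition `(*)_w` for some rational `w > 1`,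
and if the sequence `(q_ℓ^{1/ℓ})_{ℓ ≥ 1}` is bounded, then `α` is transcendental. -/
theorem statement1 (a : ℕ → ℕ) (hpos : ∀ i, 0 < a i) (α : ℝ)
    (hα : Tendsto (fun ℓ => (cfP a ℓ : ℝ) / (cfQ a ℓ : ℝ)) atTop (𝓝 α))
    (hbdd : ∃ B : ℝ, ∀ ℓ : ℕ, 1 ≤ ℓ → (cfQ a ℓ : ℝ) ^ (1 / (ℓ : ℝ)) ≤ B)
    (w : ℚ) (hw : 1 < w)
    (hcond : ConditionStar a (w : ℝ)) :
    Transcendental ℚ α := by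
  intro halg
  exact ABT.main_thm a hpos α hα hbdd (w : ℝ) (by exact_mod_cast hw) hcond
    ((IsFractionRing.isAlgebraic_iff ℤ ℚ ℝ).2 halg)
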